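/- There exists a strong (O₃ × ℤ₂)-equivariant deformation retraction from Hom_N(S²) to O₃; that is, a jointly continuous map ρ : Hom_N(S²) × [0,1] → Hom_N(S²) such that ρ(f,0) = f for all f ∈ Hom_N(S²), ρ(f,1) is the restriction to S² of an orthogonal matrix for all f, ρ(Q,t) = Q for every Q ∈ O₃ and t ∈ [0,1], and ρ(Q ∘ f ∘ σ_s, t) = Q ∘ ρ(f,t) ∘ σ_s for every Q ∈ O₃, s ∈ {1,-1}, f ∈ Hom_N(S²), and t ∈ [0,1]. -/

import Mathlib

open Metric unitInterval MeasureTheory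

noncomputable section

/-- The Euclidean 3-space. -/
abbrev E3 : Type := EuclideanSpace ℝ (Fin 3)

/-- The unit 2-sphere in `ℝ³`. -/
abbrev Sph : Type := Metric.sphere (0 : E3) 1

/-- The surface measure on the sphere: the 2-dimensional Hausdorff measure
(the metric on the sphere is induced from `ℝ³`, so this agrees with the restriction of the
2-dimensional Hausdorff measure of `ℝ³`). -/
def μSph : Measure Sph := Measure.hausdorffMeasure 2

/-- The group of nullity-preserving self-homeomorphisms of the sphere, as a subspace of
`C(S², S²)` (whose compact-open topology coincides with the sup-metric topology). -/
abbrev HomNS2 : Type :=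
  {f : C(Sph, Sph) // IsHomeomorph f ∧ ∀ A : Set Sph, μSph A = 0 ↔ μSph (f '' A) = 0}

/-- `g` is the restriction to the sphere of the (orthogonal) matrix `Q`. -/
def AgreesWith (g : HomNS2) (Q : Matrix (Fin 3) (Fin 3) ℝ) : Prop :=
  ∀ x : Sph, ((g.1 x : E3)) = Q.mulVec (x : E3)

open Metric Set Filter Topology MeasureTheory ComplexConjugate unitInterval
open scoped Real

def CConv {ι : Type*} (l : Filter ι) (f : ι → ℂ → ℂ) (g : ℂ → ℂ) (V : Set ℂ) : Prop :=
  ∀ z ∈ V, Tendsto (fun q : ι × ℂ => f q.1 q.2) (l ×ˢ 𝓝 z) (𝓝 (g z))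
def ELH {ι : Type*} (l : Filter ι) (f : ι → ℂ → ℂ) (V : Set ℂ) : Prop :=
  ∀ z ∈ V, ∃ r > 0, ball z r ⊆ V ∧ ∀ᶠ i in l, DifferentiableOn ℂ (f i) (ball z r)
lemma CConv.pt {ι : Type*} {l : Filter ι} {f : ι → ℂ → ℂ} {g : ℂ → ℂ} {V : Set ℂ}
    (h : CConv l f g V) {z : ι → ℂ} {w : ℂ} (hw : w ∈ V) (hz : Tendsto z l (𝓝 w)) :
    Tendsto (fun i => f i (z i)) l (𝓝 (g w)) :=
  (h w hw).comp (tendsto_id.prodMk hz)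
lemma im_bound {f : ℂ → ℂ} {z : ℂ} {r B : ℝ} (hr : 0 < r) (hB : 0 < B)
    (hf : DifferentiableOn ℂ f (ball z r)) (hb : ∀ w ∈ ball z r, |(f w).im| ≤ B) {w : ℂ}
    (hw : w ∈ ball z (r / 2)) : ‖f w - f z‖ ≤ 8 * B / r * ‖w - z‖ := by
  have hw2 : ‖w - z‖ < r / 2 := by simpa [dist_eq_norm] using hw
  have key := Complex.borelCaratheodory_zero (f := fun u => -Complex.I * (f (z + u) - f z))
    (M := 2 * B) (R := r) (z := w - z) (by positivity) ?_ ?_ hr ?_ (by simp)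
  · simp only [add_sub_cancel, norm_mul, norm_neg, Complex.norm_I, one_mul] at key
    refine key.trans ?_
    rw [div_mul_eq_mul_div, div_le_div_iff₀ (by linarith) hr]
    nlinarith [norm_nonneg (w - z), mul_nonneg hB.le (norm_nonneg (w - z))]
  · apply DifferentiableOn.const_mul
    apply DifferentiableOn.sub_const
    apply hf.comp (by fun_prop)
    intro u hu
    simpa using hu
  · intro u hu
    have h1 := hb (z + u) (by simpa using hu)
    have h2 := hb z (mem_ball_self hr)
    simp
    rw [abs_le] at h1 h2
    linarith
  · simp; linarith
lemma normal_family {ι : Type*} (𝒰 : Ultrafilter ι) {f : ι → ℂ → ℂ} {W : Set ℂ}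
    (hWc : IsPreconnected W) {B : ℝ} (hB : 0 < B)
    (hloc : ∀ z ∈ W, ∃ r > 0, ∀ᶠ i in 𝒰, DifferentiableOn ℂ (f i) (ball z r) ∧
      ∀ w ∈ ball z r, |(f i w).im| ≤ B)
    {z₀ : ℂ} (hz₀ : z₀ ∈ W) {zi : ι → ℂ} (hzi : Tendsto zi 𝒰 (𝓝 z₀)) {C : ℝ}
    (hC : ∀ᶠ i in 𝒰, ‖f i (zi i)‖ ≤ C) : ∃ g, CConv 𝒰 f g W := by
  classical
  let V : Set ℂ := {z | ∃ C, ∀ᶠ i in 𝒰, ‖f i z‖ ≤ C}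
  have step : ∀ z ∈ W, ∃ r > 0, ∀ w ∈ ball z r, (w ∈ V → z ∈ V) ∧ (z ∈ V → w ∈ V) := by
    intro z hz
    obtain ⟨r, hr, h⟩ := hloc z hz
    refine ⟨r / 2, by positivity, fun w hw => ?_⟩
    have hd : ∀ᶠ i in 𝒰, ‖f i w - f i z‖ ≤ 8 * B / r * ‖w - z‖ := by
      filter_upwards [h] with i hi using im_bound hr hB hi.1 hi.2 hw
    constructor
    · rintro ⟨c, hc⟩
      refine ⟨c + 8 * B / r * ‖w - z‖, ?_⟩
      filter_upwards [hc, hd] with i h1 h2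
      have := norm_sub_norm_le (f i z) (f i w)
      rw [norm_sub_rev] at this; linarith
    · rintro ⟨c, hc⟩
      refine ⟨c + 8 * B / r * ‖w - z‖, ?_⟩
      filter_upwards [hc, hd] with i h1 h2
      have := norm_sub_norm_le (f i w) (f i z)
      linarith
  have hz₀V : z₀ ∈ V := by
    obtain ⟨r, hr, h⟩ := hloc z₀ hz₀
    refine ⟨C + 8 * B / r * (r/2), ?_⟩
    filter_upwards [hC, h, hzi (ball_mem_nhds z₀ (half_pos hr))] with i h1 h2 h3
    have h4 := im_bound hr hB h2.1 h2.2 h3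
    have h5 : ‖zi i - z₀‖ ≤ r/2 := by
      have : dist (zi i) z₀ < r/2 := h3
      rw [dist_eq_norm] at this; exact this.le
    have := norm_sub_norm_le (f i z₀) (f i (zi i))
    rw [norm_sub_rev] at this
    have h6 : 8 * B / r * ‖zi i - z₀‖ ≤ 8 * B / r * (r/2) := by gcongr
    linarith
  have hWV : W ⊆ V := by
    have ho1 : IsOpen {z | ∃ r > 0, ball z r ⊆ V} := by
      rw [Metric.isOpen_iff]
      rintro z ⟨r, hr, h⟩
      refine ⟨r/2, by positivity, fun w hw => ⟨r/2, by positivity, fun u hu => h ?_⟩⟩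
      simp only [mem_ball] at *
      linarith [dist_triangle u w z]
    have ho2 : IsOpen {z | ∃ r > 0, ball z r ⊆ Vᶜ} := by
      rw [Metric.isOpen_iff]
      rintro z ⟨r, hr, h⟩
      refine ⟨r/2, by positivity, fun w hw => ⟨r/2, by positivity, fun u hu => h ?_⟩⟩
      simp only [mem_ball] at *
      linarith [dist_triangle u w z]
    intro z hz
    by_contra hzV
    have hcov : ∀ z ∈ W, (z ∈ V → ∃ r > 0, ball z r ⊆ V) ∧ (z ∉ V → ∃ r > 0, ball z r ⊆ Vᶜ) := by
      intro z hz
      obtain ⟨r, hr, h⟩ := step z hz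
      exact ⟨fun hv => ⟨r, hr, fun w hw => (h w hw).2 hv⟩,
        fun hv => ⟨r, hr, fun w hw hwV => hv ((h w hw).1 hwV)⟩⟩
    obtain ⟨x, hx, ⟨r, hr, h1⟩, ⟨r', hr', h2⟩⟩ := hWc _ _ ho1 ho2 (fun w hw => by
      by_cases hwV : w ∈ V
      · exact Or.inl ((hcov w hw).1 hwV)
      · exact Or.inr ((hcov w hw).2 hwV)) ⟨z₀, hz₀, (hcov z₀ hz₀).1 hz₀V⟩ ⟨z, hz, (hcov z hz).2 hzV⟩
    exact h2 (mem_ball_self hr') (h1 (mem_ball_self hr))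
  have hlim : ∀ z ∈ W, ∃ y, Tendsto (fun i => f i z) 𝒰 (𝓝 y) := by
    intro z hz
    obtain ⟨c, hc⟩ := hWV hz
    have : (closedBall (0:ℂ) c) ∈ 𝒰.map (fun i => f i z) := by
      rw [Ultrafilter.mem_map]
      exact Filter.mem_of_superset hc fun i hi => by simpa using hi
    obtain ⟨y, -, hy⟩ := (isCompact_closedBall (0:ℂ) c).ultrafilter_le_nhds' _ this
    exact ⟨y, hy⟩
  choose! g hg using hlim
  refine ⟨g, fun z hz => ?_⟩
  obtain ⟨r, hr, h⟩ := hloc z hz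
  rw [Metric.tendsto_nhds]
  intro ε hε
  obtain ⟨δ, hδ, hδ2⟩ : ∃ δ > 0, 8 * B / r * δ < ε / 2 := by
    refine ⟨ε / 2 / (8 * B / r + 1), by positivity, ?_⟩
    rw [mul_div_assoc', div_lt_iff₀ (by positivity)]
    have : 0 < 8 * B / r := by positivity
    nlinarith
  have e1 : ∀ᶠ i in (𝒰 : Filter ι), (DifferentiableOn ℂ (f i) (ball z r) ∧
      ∀ w ∈ ball z r, |(f i w).im| ≤ B) ∧ dist (f i z) (g z) < ε / 2 :=
    h.and (Metric.tendsto_nhds.1 (hg z hz) (ε/2) (by positivity))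
  have e2 : ∀ᶠ w in 𝓝 z, w ∈ ball z (r/2) ∧ w ∈ ball z δ :=
    Filter.inter_mem (ball_mem_nhds z (by positivity : 0 < r/2)) (ball_mem_nhds z hδ)
  filter_upwards [e1.prod_mk e2] with q hq
  obtain ⟨⟨h1, h2⟩, h3, h4⟩ := hq
  have h5 := im_bound hr hB h1.1 h1.2 h3
  have h6 : ‖q.2 - z‖ ≤ δ := by
    have : dist q.2 z < δ := h4
    rw [dist_eq_norm] at this; exact this.le
  have h7 : 8 * B / r * ‖q.2 - z‖ ≤ 8 * B / r * δ := by gcongr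
  calc dist (f q.1 q.2) (g z) ≤ dist (f q.1 q.2) (f q.1 z) + dist (f q.1 z) (g z) := dist_triangle _ _ _
    _ < ε := by rw [dist_eq_norm]; linarith
lemma CConv.locUnif {ι : Type*} {l : Filter ι} [l.NeBot] {f : ι → ℂ → ℂ} {g : ℂ → ℂ} {V : Set ℂ}
    (hV : IsOpen V) (h : CConv l f g V) : ContinuousOn g V ∧ TendstoLocallyUniformlyOn f g l V := by
  have key : ∀ z ∈ V, ∀ ε > 0, ∃ r > 0, ball z r ⊆ V ∧
      (∀ᶠ i in l, ∀ w ∈ ball z r, dist (f i w) (g z) < ε) ∧ ∀ w ∈ ball z r, dist (g w) (g z) ≤ ε := by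
    intro z hz ε hε
    have := Metric.tendsto_nhds.1 (h z hz) ε hε
    obtain ⟨p, hp, q, hq, hpq⟩ := Filter.eventually_prod_iff.1 this
    obtain ⟨r, hr, hr2⟩ := Metric.eventually_nhds_iff_ball.1 (hq.and (hV.mem_nhds hz))
    refine ⟨r, hr, fun w hw => (hr2 w hw).2, ?_, ?_⟩
    · filter_upwards [hp] with i hi w hw using hpq hi (hr2 w hw).1
    · intro w hw
      have hwl : Tendsto (fun i => f i w) l (𝓝 (g w)) := h.pt (hr2 w hw).2 tendsto_const_nhds
      refine le_of_tendsto (hwl.dist tendsto_const_nhds) ?_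
      filter_upwards [hp] with i hi using (hpq hi (hr2 w hw).1).le
  constructor
  · intro z hz
    refine ContinuousAt.continuousWithinAt ?_
    rw [Metric.continuousAt_iff]
    intro ε hε
    obtain ⟨r, hr, -, -, h2⟩ := key z hz (ε/2) (by positivity)
    exact ⟨r, hr, fun {w} hw => (h2 w hw).trans_lt (by linarith)⟩
  · rw [Metric.tendstoLocallyUniformlyOn_iff]
    intro ε hε z hz
    obtain ⟨r, hr, -, h1, h2⟩ := key z hz (ε/2) (by positivity)
    refine ⟨ball z r, mem_nhdsWithin_of_mem_nhds (ball_mem_nhds z hr), ?_⟩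
    filter_upwards [h1] with i hi w hw
    have := hi w hw
    have := h2 w hw
    calc dist (g w) (f i w) ≤ dist (g w) (g z) + dist (f i w) (g z) := dist_triangle_right _ _ _
      _ < ε := by linarith
lemma CConv.holo {ι : Type*} {l : Filter ι} [l.NeBot] {f : ι → ℂ → ℂ} {g : ℂ → ℂ} {V : Set ℂ}
    (h : CConv l f g V) (hE : ELH l f V) : DifferentiableOn ℂ g V ∧
      ∀ z ∈ V, Tendsto (fun i => deriv (f i) z) l (𝓝 (deriv g z)) := by
  have key : ∀ z ∈ V, DifferentiableAt ℂ g z ∧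
      Tendsto (fun i => deriv (f i) z) l (𝓝 (deriv g z)) := by
    intro z hz
    obtain ⟨r, hr, hrV, hd⟩ := hE z hz
    have hc : CConv l f g (ball z r) := fun w hw => h w (hrV hw)
    have hu := (hc.locUnif isOpen_ball).2
    have h1 := hu.differentiableOn hd isOpen_ball
    exact ⟨h1.differentiableAt (ball_mem_nhds z hr),
      (hu.deriv hd isOpen_ball).tendsto_at (mem_ball_self hr)⟩
  exact ⟨fun z hz => (key z hz).1.differentiableWithinAt, fun z hz => (key z hz).2⟩
theorem inj_map_nhds {f : ℂ → ℂ} {U : Set ℂ} (hU : IsOpen U) (hf : DifferentiableOn ℂ f U)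
    (hi : InjOn f U) {z : ℂ} (hz : z ∈ U) : 𝓝 (f z) ≤ map f (𝓝 z) := by
  have ha := hf.analyticAt (hU.mem_nhds hz)
  refine ha.eventually_constant_or_nhds_le_map_nhds.resolve_left fun h => ?_
  have h2 : ∀ᶠ w in 𝓝[≠] z, False := by
    filter_upwards [h.filter_mono nhdsWithin_le_nhds, self_mem_nhdsWithin,
      nhdsWithin_le_nhds (hU.mem_nhds hz)] with w h1 h2 h3
    exact h2 (hi h3 hz h1)
  exact h2.exists.elim fun _ h => h
theorem inj_isOpen {f : ℂ → ℂ} {U V : Set ℂ} (hU : IsOpen U) (hf : DifferentiableOn ℂ f U)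
    (hi : InjOn f U) (hV : IsOpen V) (hVU : V ⊆ U) : IsOpen (f '' V) := by
  rw [isOpen_iff_mem_nhds]
  rintro _ ⟨z, hz, rfl⟩
  exact inj_map_nhds hU hf hi (hVU hz) (image_mem_map (hV.mem_nhds hz))
theorem inj_inv {f g : ℂ → ℂ} {U : Set ℂ} (hU : IsOpen U) (hf : DifferentiableOn ℂ f U)
    (hg : ∀ z ∈ U, g (f z) = z) : DifferentiableOn ℂ g (f '' U) := by
  have hi : InjOn f U := fun a ha b hb h => by rw [← hg a ha, ← hg b hb, h]
  have hc : ∀ z ∈ U, ContinuousAt g (f z) := by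
    intro z hz
    rw [ContinuousAt, hg z hz]
    have := inj_map_nhds hU hf hi hz
    refine Tendsto.mono_left ?_ this
    rw [tendsto_map'_iff]
    refine Tendsto.congr' ?_ tendsto_id
    filter_upwards [hU.mem_nhds hz] with w hw
    simp [hg w hw]
  have hgood : ∀ z ∈ U, deriv f z ≠ 0 → DifferentiableAt ℂ g (f z) := by
    intro z hz hd
    have hs : HasStrictDerivAt f (deriv f z) z :=
      (hf.analyticAt (hU.mem_nhds hz)).hasStrictDerivAt
    have hd2 : HasDerivAt f (deriv f z) (g (f z)) := by rw [hg z hz]; exact hs.hasDerivAt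
    refine (HasDerivAt.of_local_left_inverse (hc z hz) hd2 hd ?_).differentiableAt
    have := inj_map_nhds hU hf hi hz (image_mem_map (hU.mem_nhds hz))
    filter_upwards [this]
    rintro _ ⟨w, hw, rfl⟩
    rw [hg w hw]
  rintro _ ⟨z, hz, rfl⟩
  apply DifferentiableAt.differentiableWithinAt
  by_cases hd : deriv f z ≠ 0
  · exact hgood z hz hd
  push Not at hd
  have hda : AnalyticAt ℂ (deriv f) z := (hf.analyticAt (hU.mem_nhds hz)).deriv
  have hev : ∀ᶠ w in 𝓝[≠] z, deriv f w ≠ 0 := by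
    refine hda.eventually_eq_zero_or_eventually_ne_zero.resolve_left fun h => ?_
    obtain ⟨r, hr, hb⟩ := Metric.eventually_nhds_iff_ball.1 (h.and (hU.eventually_mem hz))
    have hconst : ∀ x ∈ ball z r, ∀ y ∈ ball z r, f x = f y := fun x hx y hy =>
      (convex_ball z r).is_const_of_fderivWithin_eq_zero (𝕜 := ℂ)
      (f := f) (fun w hw => (hf.differentiableAt (hU.mem_nhds (hb w hw).2)).differentiableWithinAt)
      (fun w hw => by
        rw [fderivWithin_of_isOpen isOpen_ball hw]
        ext; simp [(hb w hw).1]) hx hy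
    have hw : z + (r/2 : ℝ) ∈ ball z r := by
      simp [abs_of_pos hr]; linarith
    have := hi hz (hb _ hw).2 (hconst _ (mem_ball_self hr) _ hw)
    have : (r:ℂ) = 0 := by
      push_cast at this
      linear_combination (-2) * this
    exact hr.ne' (by exact_mod_cast this)
  refine (Complex.analyticAt_of_differentiable_on_punctured_nhds_of_continuousAt ?_
    (hc z hz)).differentiableAt
  have h1 : ∀ᶠ w in 𝓝 z, w ≠ z → DifferentiableAt ℂ g (f w) := by
    filter_upwards [eventually_nhdsWithin_iff.1 hev, hU.eventually_mem hz] with w h1 h2 h3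
    exact hgood w h2 (h1 h3)
  have h2 := inj_map_nhds hU hf hi hz (eventually_map.2 (by
    have h3 : ∀ᶠ w in 𝓝 z, f w ≠ f z → DifferentiableAt ℂ g (f w) := by
      filter_upwards [h1] with w hw hne
      exact hw fun h => hne (by rw [h])
    exact h3 : ∀ᶠ y in map f (𝓝 z), y ≠ f z → DifferentiableAt ℂ g y))
  exact eventually_nhdsWithin_iff.2 h2
theorem inj_deriv_ne {f : ℂ → ℂ} {U : Set ℂ} (hU : IsOpen U) (hf : DifferentiableOn ℂ f U)
    (hi : InjOn f U) {z : ℂ} (hz : z ∈ U) : deriv f z ≠ 0 := by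
  classical
  have hl := hi.leftInvOn_invFunOn
  set g := Function.invFunOn f U
  have hg := inj_inv hU hf (g := g) hl
  have h1 : DifferentiableAt ℂ g (f z) :=
    hg.differentiableAt ((inj_isOpen hU hf hi hU subset_rfl).mem_nhds (mem_image_of_mem _ hz))
  have h2 := hf.differentiableAt (hU.mem_nhds hz)
  have h3 : deriv (g ∘ f) z = deriv g (f z) * deriv f z := deriv_comp z h1 h2
  have h4 : deriv (g ∘ f) z = 1 := by
    rw [Filter.EventuallyEq.deriv_eq (f := id)]
    · simp
    · filter_upwards [hU.mem_nhds hz] with w hw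
      exact hl hw
  intro h0
  rw [h4, h0, mul_zero] at h3
  exact one_ne_zero h3
theorem hurwitz_cover {ι : Type*} {l : Filter ι} [l.NeBot] {f : ι → ℂ → ℂ} {g : ℂ → ℂ} {V : Set ℂ}
    (hV : IsOpen V) (h : CConv l f g V) (hE : ELH l f V) {z : ℂ} (hz : z ∈ V)
    (hnc : ¬ ∀ᶠ w in 𝓝 z, g w = g z) {N : Set ℂ} (hN : N ∈ 𝓝 z) :
    ∃ ε > 0, ∀ᶠ i in l, ball (g z) ε ⊆ f i '' N := by
  have hga : AnalyticAt ℂ g z := (h.holo hE).1.analyticAt (hV.mem_nhds hz)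
  have hne : ∀ᶠ w in 𝓝[≠] z, g w ≠ g z :=
    ((hga.eventually_eq_or_eventually_ne analyticAt_const)).resolve_left hnc
  obtain ⟨R, hR, hRV, hRf⟩ := hE z hz
  obtain ⟨r', hr', hb⟩ := Metric.eventually_nhds_iff_ball.1
    ((eventually_nhdsWithin_iff.1 hne).and hN)
  obtain ⟨r, hr, hrR⟩ : ∃ r > 0, r < min R r' := exists_between (lt_min hR hr')
  have hrR1 := hrR.trans_le (min_le_left _ _)
  have hrR2 := hrR.trans_le (min_le_right _ _)
  obtain ⟨hgc, hlu⟩ := h.locUnif hV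
  have hcb : closedBall z r ⊆ V := (closedBall_subset_ball hrR1).trans hRV
  have hu : TendstoUniformlyOn f g l (closedBall z r) :=
    (tendstoLocallyUniformlyOn_iff_forall_isCompact hV).1 hlu _ hcb (isCompact_closedBall z r)
  have hsn : (sphere z r).Nonempty := NormedSpace.sphere_nonempty.2 hr.le
  obtain ⟨w0, hw0, hmin⟩ := (isCompact_sphere z r).exists_isMinOn hsn
    (f := fun w => ‖g w - g z‖)
    ((hgc.mono (sphere_subset_closedBall.trans hcb)).sub continuousOn_const).norm
  set δ := ‖g w0 - g z‖
  have hδ : 0 < δ := by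
    rw [norm_pos_iff, sub_ne_zero]
    refine (hb w0 ?_).1 ?_
    · exact (closedBall_subset_ball hrR2) (sphere_subset_closedBall hw0)
    · rintro rfl; simp at hw0; linarith
  refine ⟨δ/8, by positivity, ?_⟩
  filter_upwards [Metric.tendstoUniformlyOn_iff.1 hu (δ/8) (by positivity), hRf] with i hi hd
  have hz0 := hi z (mem_closedBall_self hr.le)
  have hs : ∀ w ∈ sphere z r, δ/2 ≤ ‖f i w - f i z‖ := by
    intro w hw
    have h1 := hi w (sphere_subset_closedBall hw)
    have h2 : δ ≤ ‖g w - g z‖ := hmin hw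
    rw [dist_eq_norm] at h1 hz0
    have h3 : ‖g w - g z‖ ≤ ‖g w - f i w‖ + ‖f i w - f i z‖ + ‖g z - f i z‖ := by
      rw [show g w - g z = (g w - f i w) + (f i w - f i z) - (g z - f i z) by ring]
      exact (norm_sub_le _ _).trans (by gcongr; exact norm_add_le _ _)
    linarith
  have hda : AnalyticOnNhd ℂ (f i) (ball z R) := hd.analyticOnNhd isOpen_ball
  have hfr : ∃ᶠ w in 𝓝 z, f i w ≠ f i z := by
    intro hcon
    have hcon' : f i =ᶠ[𝓝 z] fun _ => f i z := by
      filter_upwards [hcon] with w hw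
      simpa using hw
    have := hda.eqOn_of_preconnected_of_eventuallyEq analyticOnNhd_const
      (convex_ball z R).isPreconnected (mem_ball_self hR) hcon'
    have h5 := this ((closedBall_subset_ball hrR1) (sphere_subset_closedBall hw0))
    have h6 := hs w0 hw0
    simp only at h5
    rw [h5] at h6
    simp at h6
    linarith
  have hdc : DiffContOnCl ℂ (f i) (ball z r) :=
    (hd.mono ((closure_ball z hr.ne').le.trans (closedBall_subset_ball hrR1))).diffContOnCl
  have hfin := hdc.ball_subset_image_closedBall hr hs hfr
  have hsub : ball (g z) (δ/8) ⊆ ball (f i z) (δ/2/2) := by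
    apply ball_subset_ball'
    linarith
  refine hsub.trans (hfin.trans (image_mono ?_))
  intro w hw
  exact (hb w (closedBall_subset_ball hrR2 hw)).2
theorem not_const_of_near {g : ℂ → ℂ} {V : Set ℂ} (hV : IsOpen V) (hc : IsPreconnected V)
    (hg : DifferentiableOn ℂ g V) (hnc : ∃ a ∈ V, ∃ b ∈ V, g a ≠ g b) {z : ℂ} (hz : z ∈ V) :
    ¬ ∀ᶠ w in 𝓝 z, g w = g z := by
  intro h
  obtain ⟨a, ha, b, hb, hab⟩ := hnc
  have h1 := (hg.analyticOnNhd hV).eqOn_of_preconnected_of_eventuallyEq analyticOnNhd_const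
      hc hz h
  exact hab ((h1 ha).trans (h1 hb).symm)
theorem hurwitz_inj {ι : Type*} {l : Filter ι} [l.NeBot] {f : ι → ℂ → ℂ} {g : ℂ → ℂ} {V : Set ℂ}
    (hV : IsOpen V) (hVc : IsPreconnected V) (h : CConv l f g V) (hE : ELH l f V)
    (hinj : ∀ z ∈ V, ∀ w ∈ V, ∃ r > 0, ∀ᶠ i in l, InjOn (f i) (ball z r ∪ ball w r))
    (hnc : ∃ a ∈ V, ∃ b ∈ V, g a ≠ g b) : InjOn g V := by
  intro z hz w hw hzw
  by_contra hne
  obtain ⟨r, hr, hri⟩ := hinj z hz w hw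
  have hd := (h.holo hE).1
  set s := min r (dist z w / 2)
  have hs : 0 < s := lt_min hr (half_pos (dist_pos.2 hne))
  obtain ⟨ε1, h1, h1e⟩ := hurwitz_cover hV h hE hz (not_const_of_near hV hVc hd hnc hz)
    (ball_mem_nhds z hs)
  obtain ⟨ε2, h2, h2e⟩ := hurwitz_cover hV h hE hw (not_const_of_near hV hVc hd hnc hw)
    (ball_mem_nhds w hs)
  obtain ⟨i, hi1, hi2, hi3⟩ := (hri.and (h1e.and h2e)).exists
  obtain ⟨a, ha, hae⟩ := hi2 (mem_ball_self h1)
  obtain ⟨b, hb, hbe⟩ := hi3 (mem_ball_self h2)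
  have hsr : s ≤ r := min_le_left _ _
  have := hi1 (Or.inl (ball_subset_ball hsr ha)) (Or.inr (ball_subset_ball hsr hb))
    (by rw [hae, hbe, hzw])
  subst this
  have h3 : s ≤ dist z w / 2 := min_le_right _ _
  have := dist_triangle_right z w a
  rw [mem_ball] at ha hb
  rw [dist_comm z a, dist_comm w a] at this
  linarith
noncomputable def bl (a z : ℂ) : ℂ := (z - a) / (1 - conj a * z)
theorem bl_den {a z : ℂ} (ha : ‖a‖ < 1) (hz : ‖z‖ < 1) : 1 - conj a * z ≠ 0 := by
  intro h
  have h1 : conj a * z = 1 := by linear_combination -h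
  have h2 : ‖a‖ * ‖z‖ = 1 := by
    have := congrArg norm h1
    simpa using this
  nlinarith [norm_nonneg a, norm_nonneg z]
theorem bl_norm {a z : ℂ} (ha : ‖a‖ < 1) (hz : ‖z‖ < 1) : ‖bl a z‖ < 1 := by
  have hd := bl_den ha hz
  rw [bl, norm_div, div_lt_one (norm_pos_iff.2 hd)]
  rw [← sq_lt_sq₀ (norm_nonneg _) (norm_nonneg _), Complex.sq_norm, Complex.sq_norm]
  have h1 : 0 < (1 - Complex.normSq a) * (1 - Complex.normSq z) := by
    rw [← Complex.sq_norm, ← Complex.sq_norm]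
    have := norm_nonneg a; have := norm_nonneg z
    apply mul_pos <;> nlinarith
  have h2 : Complex.normSq (1 - conj a * z) - Complex.normSq (z - a)
      = (1 - Complex.normSq a) * (1 - Complex.normSq z) := by
    simp [Complex.normSq_apply]; ring
  linarith
theorem bl_inv {a z : ℂ} (ha : ‖a‖ < 1) (hz : ‖z‖ < 1) : bl (-a) (bl a z) = z := by
  have hd := bl_den ha hz
  have h1 : 1 - conj (-a) * bl a z ≠ 0 := bl_den (by simpa) (bl_norm ha hz)
  rw [bl, div_eq_iff h1, bl]
  simp only [map_neg]
  generalize conj a = c at *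
  have e : z - a = (z - a) / (1 - c * z) * (1 - c * z) := (div_mul_cancel₀ _ hd).symm
  linear_combination -e
theorem bl_hasDeriv {a z : ℂ} (ha : ‖a‖ < 1) (hz : ‖z‖ < 1) :
    HasDerivAt (bl a) ((1 - conj a * a) / (1 - conj a * z)^2) z := by
  have hd := bl_den ha hz
  have h1 : HasDerivAt (fun z => z - a) 1 z := (hasDerivAt_id z).sub_const a
  have h2 : HasDerivAt (fun z => 1 - conj a * z) (-(conj a)) z := by
    simpa using ((hasDerivAt_id z).const_mul (conj a)).const_sub 1
  refine (h1.div h2 hd).congr_deriv ?_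
  congr 1
  ring
theorem bl_diff {a : ℂ} (ha : ‖a‖ < 1) : DifferentiableOn ℂ (bl a) (ball 0 1) := fun z hz =>
  (bl_hasDeriv ha (by simpa using hz)).differentiableAt.differentiableWithinAt
theorem bl_maps {a : ℂ} (ha : ‖a‖ < 1) : MapsTo (bl a) (ball 0 1) (ball 0 1) := fun z hz => by
  simpa using bl_norm ha (by simpa using hz)
theorem bl_injOn {a : ℂ} (ha : ‖a‖ < 1) : InjOn (bl a) (ball 0 1) := fun z hz w hw h => by
  rw [← bl_inv ha (by simpa using hz : ‖z‖ < 1), ← bl_inv ha (by simpa using hw : ‖w‖ < 1), h]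
theorem riemann_mapping {U : Set ℂ} (hUo : IsOpen U) (hUc : IsSimplyConnected U) (hU : ∀ z ∈ U, |z.im| < 1) :
    ∃ h : ℂ → ℂ, DifferentiableOn ℂ h U ∧ InjOn h U ∧ h '' U = ball 0 1 := by
  obtain ⟨z₀, hz₀⟩ := hUc.nonempty
  let Fam : Set (ℂ → ℂ) := {f | DifferentiableOn ℂ f U ∧ InjOn f U ∧ MapsTo f U (ball 0 1) ∧ f z₀ = 0}
  obtain ⟨f0, hf0⟩ : Fam.Nonempty := by
    have hd : ∀ z ∈ U, 1 < ‖z + 2 * Complex.I‖ := fun z hz => by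
      refine lt_of_lt_of_le ?_ (Complex.abs_im_le_norm _)
      have := abs_lt.1 (hU z hz)
      simp
      rw [lt_abs]; left; linarith
    have hd0 : ∀ z ∈ U, z + 2 * Complex.I ≠ 0 := fun z hz h => by
      have := hd z hz
      rw [h] at this; simp at this; linarith
    set f : ℂ → ℂ := fun z => (z + 2 * Complex.I)⁻¹ with hf
    have h1 : MapsTo f U (ball 0 1) := fun z hz => by
      simp only [f, mem_ball_zero_iff, norm_inv]
      exact inv_lt_one_of_one_lt₀ (hd z hz)
    have h2 : InjOn f U := fun a _ b _ h => by simpa [f] using h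
    have h3 : DifferentiableOn ℂ f U := (differentiableOn_id.add_const _).inv hd0
    have hn : ‖f z₀‖ < 1 := by simpa using h1 hz₀
    refine ⟨fun z => bl (f z₀) (f z), ?_, ?_, ?_, ?_⟩
    · exact (bl_diff hn).comp h3 h1
    · exact (bl_injOn hn).comp h2 h1
    · exact (bl_maps hn).comp h1
    · simp [bl]
  let S : Set ℝ := (fun f => ‖deriv f z₀‖) '' Fam
  obtain ⟨R, hR, hRU⟩ := Metric.isOpen_iff.1 hUo z₀ hz₀
  have hSb : BddAbove S := by
    refine ⟨1 / R, ?_⟩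
    rintro _ ⟨f, ⟨h1, h2, h3, h4⟩, rfl⟩
    exact Complex.norm_deriv_le_div_of_mapsTo_ball (h1.mono hRU)
      (by rw [h4]; exact (h3.mono_left hRU).mono_right ball_subset_closedBall) hR
  have hSn : S.Nonempty := ⟨_, f0, hf0, rfl⟩
  have hM : 0 < sSup S :=
    lt_of_lt_of_le (norm_pos_iff.2 (inj_deriv_ne hUo hf0.1 hf0.2.1 hz₀)) (le_csSup hSb ⟨f0, hf0, rfl⟩)
  obtain ⟨u, -, hu, huS⟩ := exists_seq_tendsto_sSup hSn hSb
  choose f hf hfu using huS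
  have hlocal : ∀ z ∈ U, ∃ r > 0, ball z r ⊆ U := fun z hz => Metric.isOpen_iff.1 hUo z hz
  have hUpre : IsPreconnected U := hUc.isPathConnected.isConnected.isPreconnected
  obtain ⟨g, hg⟩ := normal_family (hyperfilter ℕ) (f := f) (W := U) (B := 1) (C := 0) (z₀ := z₀)
    (zi := fun _ => z₀) hUpre one_pos (fun z hz => by
      obtain ⟨r, hr, hb⟩ := hlocal z hz
      refine ⟨r, hr, Eventually.of_forall fun i => ⟨(hf i).1.mono hb, fun w hw => ?_⟩⟩
      have := (hf i).2.2.1 (hb hw)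
      rw [mem_ball_zero_iff] at this
      exact (Complex.abs_im_le_norm _).trans this.le) hz₀ tendsto_const_nhds
      (Eventually.of_forall fun i => by simp [(hf i).2.2.2])
  have hE : ELH ((hyperfilter ℕ : Ultrafilter ℕ) : Filter ℕ) f U := fun z hz => by
    obtain ⟨r, hr, hb⟩ := hlocal z hz
    exact ⟨r, hr, hb, Eventually.of_forall fun i => (hf i).1.mono hb⟩
  obtain ⟨hgd, hgder⟩ := hg.holo hE
  have hgM : ‖deriv g z₀‖ = sSup S := by
    have h1 := (hgder z₀ hz₀).norm
    have h2 : Tendsto u (hyperfilter ℕ : Ultrafilter ℕ) (𝓝 (sSup S)) :=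
      hu.mono_left (Nat.hyperfilter_le_atTop)
    refine tendsto_nhds_unique h1 (h2.congr fun i => (hfu i).symm)
  have hg0 : g z₀ = 0 := by
    have := hg.pt hz₀ (z := fun _ => z₀) tendsto_const_nhds
    simp only [(hf _).2.2.2] at this
    exact (tendsto_nhds_unique this tendsto_const_nhds)
  have hnc : ∃ a ∈ U, ∃ b ∈ U, g a ≠ g b := by
    by_contra hcon
    push Not at hcon
    have : deriv g z₀ = 0 := by
      rw [Filter.EventuallyEq.deriv_eq (f := fun _ => g z₀)]
      · simp
      · filter_upwards [hUo.mem_nhds hz₀] with w hw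
        exact hcon w hw z₀ hz₀
    rw [this] at hgM
    simp at hgM
    linarith
  have hgi : InjOn g U := hurwitz_inj hUo hUpre hg hE (fun z hz w hw => by
    obtain ⟨r1, hr1, hb1⟩ := hlocal z hz
    obtain ⟨r2, hr2, hb2⟩ := hlocal w hw
    refine ⟨min r1 r2, lt_min hr1 hr2, Eventually.of_forall fun i => (hf i).2.1.mono ?_⟩
    exact union_subset ((ball_subset_ball (min_le_left _ _)).trans hb1)
      ((ball_subset_ball (min_le_right _ _)).trans hb2)) hnc
  have hgm : MapsTo g U (ball 0 1) := by
    have h1 : g '' U ⊆ closedBall 0 1 := by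
      rintro _ ⟨z, hz, rfl⟩
      refine isClosed_closedBall.mem_of_tendsto (hg.pt hz (z := fun _ => z) tendsto_const_nhds) ?_
      exact Eventually.of_forall fun i => ball_subset_closedBall ((hf i).2.2.1 hz)
    have h2 := interior_maximal h1 (inj_isOpen hUo hgd hgi hUo subset_rfl)
    rw [interior_closedBall _ one_ne_zero] at h2
    exact mapsTo_iff_image_subset.2 h2
  refine ⟨g, hgd, hgi, subset_antisymm (mapsTo_iff_image_subset.1 hgm) fun ω hω => ?_⟩
  by_contra hωn
  have hω1 : ‖ω‖ < 1 := by simpa using hω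
  have hkd : DifferentiableOn ℂ (fun z => bl ω (g z)) U := (bl_diff hω1).comp hgd hgm
  have hkm : MapsTo (fun z => bl ω (g z)) U (ball 0 1) := (bl_maps hω1).comp hgm
  have hki : InjOn (fun z => bl ω (g z)) U := (bl_injOn hω1).comp hgi hgm
  set k := fun z => bl ω (g z) with hk
  have hk0 : ∀ z ∈ U, k z ≠ 0 := by
    intro z hz h0
    rw [hk] at h0
    simp only [bl, div_eq_zero_iff] at h0
    rcases h0 with h0 | h0
    · exact hωn ⟨z, hz, by linear_combination h0⟩
    · exact bl_den hω1 (by simpa using hgm hz) h0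
  obtain ⟨q, hqc, hq⟩ := Complex.exists_continuousOn_pow_eq hUc hUo hkd.continuousOn
    (by rintro ⟨z, hz, h⟩; exact hk0 z hz h) two_ne_zero
  replace hq : ∀ z, q z ^ 2 = k z := fun z => hq z
  have hq0 : ∀ z ∈ U, q z ≠ 0 := fun z hz h => hk0 z hz (by rw [← hq, h]; simp)
  have hqder : ∀ z ∈ U, HasDerivAt q (deriv k z / (2 * q z)) z := by
    intro z hz
    have hkz : HasDerivAt k (deriv k z) z := (hkd.differentiableAt (hUo.mem_nhds hz)).hasDerivAt
    have hqz : ContinuousAt q z := hqc.continuousAt (hUo.mem_nhds hz)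
    rw [hasDerivAt_iff_tendsto_slope] at hkz ⊢
    have h1 : Tendsto (fun w => slope k z w / (q w + q z)) (𝓝[≠] z) (𝓝 (deriv k z / (q z + q z))) := by
      refine hkz.div ((hqz.tendsto.mono_left nhdsWithin_le_nhds).add_const _) ?_
      rw [← two_mul]
      exact mul_ne_zero two_ne_zero (hq0 z hz)
    rw [two_mul]
    refine h1.congr' ?_
    have hne : ∀ᶠ w in 𝓝[≠] z, q w + q z ≠ 0 := by
      have : ContinuousAt (fun w => q w + q z) z := hqz.add_const _
      refine (this.eventually_ne ?_).filter_mono nhdsWithin_le_nhds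
      rw [← two_mul]
      exact mul_ne_zero two_ne_zero (hq0 z hz)
    filter_upwards [hne, self_mem_nhdsWithin] with w hw hwz
    have hwz' : w - z ≠ 0 := sub_ne_zero.2 hwz
    rw [slope_def_field, slope_def_field, ← hq, ← hq]
    field_simp
    ring
  have hqm : MapsTo q U (ball 0 1) := by
    intro z hz
    have h1 : ‖q z‖^2 < 1 := by
      rw [← norm_pow, hq]; simpa using hkm hz
    rw [mem_ball_zero_iff]
    nlinarith [norm_nonneg (q z)]
  have hqi : InjOn q U := fun a ha b hb h => hki ha hb (by rw [← hq, ← hq, h])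
  have hb1 : ‖q z₀‖ < 1 := by simpa using hqm hz₀
  have hF : (fun z => bl (q z₀) (q z)) ∈ Fam := by
    refine ⟨(bl_diff hb1).comp (fun z hz => (hqder z hz).differentiableAt.differentiableWithinAt) hqm,
      (bl_injOn hb1).comp hqi hqm, (bl_maps hb1).comp hqm, by simp [bl]⟩
  have hFd := (bl_hasDeriv hb1 hb1).comp z₀ (hqder z₀ hz₀)
  have hkder : deriv k z₀ = (1 - conj ω * ω) * deriv g z₀ := by
    have h1 := (bl_hasDeriv hω1 (show ‖g z₀‖ < 1 by simpa using hgm hz₀)).comp z₀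
      ((hgd.differentiableAt (hUo.mem_nhds hz₀)).hasDerivAt)
    have h2 : deriv k z₀ = _ := h1.deriv
    rw [h2, hg0]; simp
  have hω2 : ω = - q z₀ ^ 2 := by
    rw [hq, hk]; simp [bl, hg0]
  have hmax : ‖deriv (fun z => bl (q z₀) (q z)) z₀‖ ≤ sSup S := le_csSup hSb ⟨_, hF, rfl⟩
  have hFd' : deriv (fun z => bl (q z₀) (q z)) z₀ = _ := hFd.deriv
  rw [hFd', hkder, ← hgM] at hmax
  set b := q z₀ with hb
  have hb0 : b ≠ 0 := hq0 z₀ hz₀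
  have hbd := bl_den hb1 hb1
  have e1 : (1 - conj b * b) / (1 - conj b * b)^2 * ((1 - conj ω * ω) * deriv g z₀ / (2 * b))
      = (1 + conj b * b) / (2 * b) * deriv g z₀ := by
    rw [hω2]
    field_simp
    simp
    ring
  rw [e1, norm_mul] at hmax
  have hgp : 0 < ‖deriv g z₀‖ := by rw [hgM]; exact hM
  have h3 : ‖(1 + conj b * b) / (2 * b)‖ ≤ 1 := by
    by_contra hlt
    push Not at hlt
    nlinarith
  have h4 : conj b * b = ((‖b‖^2 : ℝ) : ℂ) := by
    rw [mul_comm, Complex.mul_conj, Complex.normSq_eq_norm_sq]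
  rw [h4, norm_div, div_le_one (norm_pos_iff.2 (mul_ne_zero two_ne_zero hb0))] at h3
  have h5 : ‖(1 : ℂ) + ((‖b‖^2 : ℝ) : ℂ)‖ = 1 + ‖b‖^2 := by
    rw [show (1 : ℂ) + ((‖b‖^2 : ℝ) : ℂ) = ((1 + ‖b‖^2 : ℝ) : ℂ) by push_cast; ring,
      Complex.norm_real, Real.norm_of_nonneg (by positivity)]
  rw [h5] at h3
  simp at h3
  nlinarith [sq_pos_of_pos (show 0 < 1 - ‖b‖ by linarith)]
noncomputable def tp : ℂ := ((2 * π : ℝ) : ℂ)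
def FD : Set ℂ := {z | 0 < z.re ∧ z.re ≤ 2 * π}
noncomputable def Ar (U : Set ℂ) : ENNReal := volume (U ∩ FD)
def Per (U : Set ℂ) : Prop := ∀ z, z ∈ U ↔ z + tp ∈ U
def Eqv (f : ℂ → ℂ) (W : Set ℂ) : Prop := ∀ z ∈ W, f (z + tp) = f z + tp
@[simp] theorem tp_re : tp.re = 2 * π := by simp [tp]
@[simp] theorem tp_im : tp.im = 0 := by simp [tp]
theorem Per.int {U : Set ℂ} (h : Per U) (k : ℤ) (z : ℂ) : z ∈ U ↔ z + k * tp ∈ U := by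
  induction k using Int.induction_on generalizing z with
  | zero => simp
  | succ n ih =>
    rw [ih z, h]; push_cast; ring_nf
  | pred n ih =>
    rw [ih z, h (z + ((-(n:ℤ) - 1 : ℤ) : ℂ) * tp)]; push_cast; ring_nf
theorem Eqv.int {f : ℂ → ℂ} {W : Set ℂ} (h : Eqv f W) (hW : Per W) (k : ℤ) {z : ℂ} (hz : z ∈ W) :
    f (z + k * tp) = f z + k * tp := by
  induction k using Int.induction_on generalizing z with
  | zero => simp
  | succ n ih =>
    have := h (z + (n:ℤ) * tp) ((hW.int _ _).1 hz)
    rw [ih hz] at this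
    push_cast at this ⊢
    rw [show z + (n + 1) * tp = z + n * tp + tp by ring, this]; ring
  | pred n ih =>
    have := h (z + ((-(n:ℤ) - 1 : ℤ) : ℂ) * tp) ((hW.int _ _).1 hz)
    have h2 := ih hz
    rw [show z + ((-(n:ℤ) - 1 : ℤ) : ℂ) * tp + tp = z + ((-(n:ℤ) : ℤ) : ℂ) * tp by push_cast; ring, h2] at this
    push_cast at this ⊢
    linear_combination -this
theorem measurable_FD : MeasurableSet FD :=
  (measurableSet_lt measurable_const Complex.measurable_re).inter
    (measurableSet_le Complex.measurable_re measurable_const)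
theorem exists_FD (z : ℂ) : ∃ k : ℤ, z + k * tp ∈ FD := by
  obtain ⟨k, hk, -⟩ := existsUnique_add_zsmul_mem_Ioc (Real.two_pi_pos) z.re 0
  refine ⟨k, ?_, ?_⟩
  · simpa using hk.1
  · simpa using hk.2
theorem FD_uniq {z : ℂ} {k l : ℤ} (hk : z + k * tp ∈ FD) (hl : z + l * tp ∈ FD) : k = l := by
  have := (existsUnique_add_zsmul_mem_Ioc (Real.two_pi_pos) z.re 0).unique
    (y₁ := k) (y₂ := l) (by simpa [FD] using hk) (by simpa [FD] using hl)
  exact this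
theorem vol_le_Ar {U E : Set ℂ} (hU : Per U) (hE : MeasurableSet E) (hEU : E ⊆ U)
    (hdis : ∀ z ∈ E, ∀ k : ℤ, k ≠ 0 → z + k * tp ∉ E) : volume E ≤ Ar U := by
  let Ek : ℤ → Set ℂ := fun k => (fun z : ℂ => z + k * tp) ⁻¹' E ∩ FD
  have hEk : ∀ k, MeasurableSet (Ek k) := fun k =>
    ((measurable_id.add_const _) hE).inter measurable_FD
  have h1 : E ⊆ ⋃ k : ℤ, (fun z : ℂ => z + (-(k * tp))) ⁻¹' (Ek k) := by
    intro z hz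
    obtain ⟨k, hk⟩ := exists_FD z
    refine mem_iUnion.2 ⟨-k, ?_, ?_⟩
    · simpa using hz
    · simpa using hk
  have h2 : volume E ≤ ∑' k : ℤ, volume (Ek k) := by
    refine (measure_mono h1).trans ((measure_iUnion_le _).trans ?_)
    simp only [measure_preimage_add_right]
    exact le_rfl
  refine h2.trans ?_
  rw [← measure_iUnion ?_ hEk]
  · refine measure_mono (iUnion_subset fun k z hz => ⟨(hU.int k z).2 (hEU hz.1), hz.2⟩)
  · intro k l hkl
    refine Set.disjoint_left.2 fun z hz1 hz2 => ?_
    have := hdis _ hz1.1 (l - k) (sub_ne_zero.2 hkl.symm)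
    apply this
    have h3 : z + l * tp ∈ E := hz2.1
    simpa [show z + k * tp + (l - k) * tp = z + l * tp by ring] using h3
theorem det_mul_complex (a : ℂ) : (a • (1 : ℂ →L[ℝ] ℂ)).det = ‖a‖ ^ 2 := by
  have h : ((a • (1 : ℂ →L[ℝ] ℂ) : ℂ →L[ℝ] ℂ) : ℂ →ₗ[ℝ] ℂ) = Algebra.lmul ℝ ℂ a := by
    ext
    simp
  rw [ContinuousLinearMap.det, h, ← Algebra.norm_apply, Algebra.norm_complex_apply,
    Complex.normSq_eq_norm_sq]
theorem vol_image {φ : ℂ → ℂ} {W E : Set ℂ} (hW : IsOpen W) (hφ : DifferentiableOn ℂ φ W)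
    (hi : InjOn φ W) (hE : MeasurableSet E) (hEW : E ⊆ W) :
    ∫⁻ z in E, ENNReal.ofReal (‖deriv φ z‖ ^ 2) = volume (φ '' E) := by
  rw [← lintegral_abs_det_fderiv_eq_addHaar_image volume (s := E) (f := φ)
    (f' := fun z => deriv φ z • (1 : ℂ →L[ℝ] ℂ)) hE (fun z hz => ?_) (hi.mono hEW)]
  · refine lintegral_congr fun z => ?_
    rw [det_mul_complex, abs_of_nonneg (by positivity)]
  · exact ((hφ.differentiableAt
      (hW.mem_nhds (hEW hz))).hasDerivAt.complexToReal_fderiv).hasFDerivWithinAt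
def Rect (s t a b : ℝ) : Set ℂ := Ioc s t ×ℂ Ioc a b
theorem measurable_Rect {s t a b : ℝ} : MeasurableSet (Rect s t a b) :=
  (Complex.measurable_re measurableSet_Ioc).inter (Complex.measurable_im measurableSet_Ioc)
theorem Rect_subset {s t a b : ℝ} : Rect s t a b ⊆ Icc s t ×ℂ Icc a b :=
  fun _ hz => ⟨Ioc_subset_Icc_self hz.1, Ioc_subset_Icc_self hz.2⟩
theorem setInt_rect {E : Type*} [NormedAddCommGroup E] [NormedSpace ℝ E] {s t a b : ℝ}
    (hst : s ≤ t) (hab : a ≤ b) {f : ℂ → E}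
    (hf : ContinuousOn f (Icc s t ×ℂ Icc a b)) :
    ∫ z in Rect s t a b, f z = ∫ y in a..b, ∫ x in s..t, f (x + y * Complex.I) := by
  have hcomp : IsCompact (Icc s t ×ℂ Icc a b) := isCompact_Icc.reProdIm isCompact_Icc
  have hint : IntegrableOn f (Rect s t a b) :=
    (hf.integrableOn_compact hcomp).mono_set Rect_subset
  have hpre : Complex.measurableEquivRealProd.symm ⁻¹' (Rect s t a b) = Ioc s t ×ˢ Ioc a b := by
    ext p; simp [Rect, Complex.mem_reProdIm, Complex.measurableEquivRealProd_symm_apply]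
  have hm := Complex.volume_preserving_equiv_real_prod.symm
  have he := Complex.measurableEquivRealProd.symm.measurableEmbedding
  have h1 := hm.setIntegral_preimage_emb he f (Rect s t a b)
  have h2 := (hm.integrableOn_comp_preimage he (f := f) (s := Rect s t a b)).2 hint
  rw [hpre] at h1 h2
  rw [← h1, Measure.volume_eq_prod] at *
  rw [← setIntegral_prod_swap, setIntegral_prod]
  · rw [intervalIntegral.integral_of_le hab]
    refine setIntegral_congr_fun measurableSet_Ioc fun y _ => ?_
    rw [intervalIntegral.integral_of_le hst]
    refine setIntegral_congr_fun measurableSet_Ioc fun x _ => ?_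
    simp [Complex.measurableEquivRealProd_symm_apply, Complex.mk_eq_add_mul_I]
  · exact h2.swap
theorem area_ineq {φ : ℂ → ℂ} {W U : Set ℂ} {a b : ℝ} (hab : a ≤ b) (hW : IsOpen W) (hWp : Per W)
    (hWs : ∀ z : ℂ, a ≤ z.im → z.im ≤ b → z ∈ W) (hφ : DifferentiableOn ℂ φ W) (hi : InjOn φ W)
    (he : Eqv φ W) (hU : Per U) (hm : MapsTo φ W U) (hA : Ar U ≠ ⊤) :
    ∫ z in Rect 0 (2 * π) a b, ‖deriv φ z - 1‖ ^ 2 ≤ (Ar U).toReal - 2 * π * (b - a) := by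
  have hpi := Real.two_pi_pos
  set R := Rect 0 (2 * π) a b with hR
  set K := Icc 0 (2 * π) ×ℂ Icc a b with hK
  have hKW : K ⊆ W := fun z hz => hWs z hz.2.1 hz.2.2
  have hcomp : IsCompact K := isCompact_Icc.reProdIm isCompact_Icc
  have hRK : R ⊆ K := Rect_subset
  have hdc : ContinuousOn (deriv φ) K := (hφ.deriv hW).continuousOn.mono hKW
  have hint : ∀ {E : Type} [NormedAddCommGroup E] {f : ℂ → E}, ContinuousOn f K → IntegrableOn f R :=
    fun hf => (hf.integrableOn_compact hcomp).mono_set hRK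
  have hvol : volume (φ '' R) ≤ Ar U := by
    refine vol_le_Ar hU ?_ ?_ ?_
    · exact measurable_Rect.image_of_continuousOn_injOn (hφ.continuousOn.mono (hRK.trans hKW))
        (hi.mono (hRK.trans hKW))
    · exact image_subset_iff.2 fun z hz => hm (hKW (hRK hz))
    · rintro _ ⟨z, hz, rfl⟩ k hk ⟨w, hw, hwz⟩
      rw [← he.int hWp k (hKW (hRK hz))] at hwz
      have := hi (hKW (hRK hw)) ((hWp.int _ _).1 (hKW (hRK hz))) hwz
      apply hk
      refine (FD_uniq (z := z) (k := k) (l := 0) ?_ ?_)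
      · rw [← this]; exact hw.1
      · simpa using (show z ∈ FD from hz.1)
  have h1 : ∫ z in R, ‖deriv φ z‖ ^ 2 ≤ (Ar U).toReal := by
    rw [integral_eq_lintegral_of_nonneg_ae (Eventually.of_forall fun _ => sq_nonneg _)
      (hint (hdc.norm.pow 2)).aestronglyMeasurable,
      vol_image hW hφ hi measurable_Rect (hRK.trans hKW)]
    exact ENNReal.toReal_mono hA hvol
  have h2 : ∫ z in R, deriv φ z = (2 * π * (b - a) : ℝ) := by
    rw [hR, setInt_rect hpi.le hab hdc]
    have : ∀ y ∈ uIcc a b, (∫ x in (0:ℝ)..(2 * π), deriv φ (x + y * Complex.I)) = tp := by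
      intro y hy
      rw [uIcc_of_le hab] at hy
      have hmem : ∀ x : ℝ, (x + y * Complex.I : ℂ) ∈ W := fun x =>
        hWs _ (by simpa using hy.1) (by simpa using hy.2)
      have hder : ∀ x ∈ uIcc (0:ℝ) (2 * π), HasDerivAt (fun x : ℝ => φ (x + y * Complex.I))
          (deriv φ (x + y * Complex.I)) x := by
        intro x _
        have h := (hφ.differentiableAt (hW.mem_nhds (hmem x))).hasDerivAt
        have h' : HasDerivAt (fun x : ℝ => (x + y * Complex.I : ℂ)) 1 x :=
          (Complex.ofRealCLM.hasDerivAt (x := x)).add_const _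
        have h3 := h.comp x h'
        rw [mul_one] at h3
        exact h3
      rw [intervalIntegral.integral_eq_sub_of_hasDerivAt hder]
      · have := he (0 + y * Complex.I) (by simpa using hmem 0)
        rw [show (0 + y * Complex.I + tp : ℂ) = ((2 * π : ℝ) : ℂ) + y * Complex.I by
          simp [tp]; ring] at this
        rw [this]; simp
      · apply ContinuousOn.intervalIntegrable
        refine ((hφ.deriv hW).continuousOn).comp (by fun_prop) fun x _ => hmem x
    rw [intervalIntegral.integral_congr this]
    simp [tp]; ring
  have h3 : ∫ z in R, ((1:ℝ)) = 2 * π * (b - a) := by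
    rw [hR, setInt_rect hpi.le hab continuousOn_const]
    simp; ring
  have h4 : ∀ z, ‖deriv φ z - 1‖ ^ 2 = ‖deriv φ z‖ ^ 2 - 2 * (deriv φ z).re + 1 := by
    intro z
    rw [Complex.sq_norm, Complex.sq_norm, Complex.normSq_apply, Complex.normSq_apply]
    simp; ring
  simp_rw [h4]
  have i1 : IntegrableOn (fun z => ‖deriv φ z‖ ^ 2) R := hint (hdc.norm.pow 2)
  have i2 : IntegrableOn (fun z => 2 * (deriv φ z).re) R :=
    hint (continuousOn_const.mul (Complex.continuous_re.comp_continuousOn hdc))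
  have i3 : IntegrableOn (fun _ => (1:ℝ)) R := hint continuousOn_const
  have h5 : ∫ z in R, (deriv φ z).re = 2 * π * (b - a) := by
    have := integral_re (𝕜 := ℂ) (hint hdc)
    rw [h2] at this
    simpa using this
  have h6 : ∫ z in R, (‖deriv φ z‖ ^ 2 - 2 * (deriv φ z).re + 1) = (∫ z in R, ‖deriv φ z‖ ^ 2)
      - 2 * (2 * π * (b - a)) + 2 * π * (b - a) := by
    have i4 : Integrable (fun z => ‖deriv φ z‖ ^ 2 - 2 * (deriv φ z).re) (volume.restrict R) :=
      Integrable.sub i1 i2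
    rw [integral_add i4 i3, integral_sub i1 i2, integral_const_mul, h5, h3]
  rw [h6]
  linarith
theorem aut_disc {τ τ' : ℂ → ℂ} (hd : DifferentiableOn ℂ τ (ball 0 1))
    (hd' : DifferentiableOn ℂ τ' (ball 0 1)) (hm : MapsTo τ (ball 0 1) (ball 0 1))
    (hm' : MapsTo τ' (ball 0 1) (ball 0 1)) (hl : ∀ z ∈ ball (0:ℂ) 1, τ' (τ z) = z) :
    ∃ d u : ℂ, ‖d‖ < 1 ∧ ‖u‖ = 1 ∧ d = τ 0 ∧ ∀ z ∈ ball (0:ℂ) 1, τ z = bl (-d) (u * z) := by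
  have h0 : (0:ℂ) ∈ ball (0:ℂ) 1 := by simp
  set d := τ 0 with hdd
  have hdn : ‖d‖ < 1 := by simpa using hm h0
  have hdn' : ‖-d‖ < 1 := by simpa
  set ta := fun z => bl d (τ z) with hσ
  set σ' := fun z => τ' (bl (-d) z) with hσ'
  have hσd : DifferentiableOn ℂ ta (ball 0 1) := (bl_diff hdn).comp hd hm
  have hσd' : DifferentiableOn ℂ σ' (ball 0 1) := hd'.comp (bl_diff hdn') (bl_maps hdn')
  have hσm : MapsTo ta (ball 0 1) (ball 0 1) := (bl_maps hdn).comp hm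
  have hσm' : MapsTo σ' (ball 0 1) (ball 0 1) := hm'.comp (bl_maps hdn')
  have hσ0 : ta 0 = 0 := by simp [hσ, bl, hdd]
  have hinv : ∀ z ∈ ball (0:ℂ) 1, σ' (ta z) = z := fun z hz => by
    simp only [hσ, hσ']
    rw [bl_inv hdn (by simpa using hm hz), hl z hz]
  have hσ0' : σ' 0 = 0 := by have := hinv 0 h0; rwa [hσ0] at this
  have hn : ∀ z ∈ ball (0:ℂ) 1, ‖ta z‖ = ‖z‖ := by
    intro z hz
    apply le_antisymm
    · exact Complex.norm_le_norm_of_mapsTo_ball hσd (hσm.mono_right ball_subset_closedBall) hσ0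
        (by simpa using hz)
    · have := Complex.norm_le_norm_of_mapsTo_ball hσd' (hσm'.mono_right ball_subset_closedBall) hσ0'
        (z := ta z) (by simpa using hσm hz)
      rwa [hinv z hz] at this
  have hhalf : (1/2 : ℂ) ∈ ball (0:ℂ) 1 := by simp; norm_num
  obtain ⟨u, hu, hue⟩ := Complex.affine_of_mapsTo_ball_of_exists_norm_dslope_eq_div' (R₂ := 1) hσd
    (by rw [hσ0]; exact hσm.mono_right ball_subset_closedBall)
    ⟨1/2, hhalf, by
      rw [dslope_of_ne _ (by norm_num), slope_def_field, hσ0, norm_div, sub_zero, sub_zero,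
        hn _ hhalf]; norm_num⟩
  refine ⟨d, u, hdn, by simpa using hu, rfl, fun z hz => ?_⟩
  have h1 := hue hz
  simp only [hσ0, sub_zero, zero_add, smul_eq_mul] at h1
  rw [mul_comm, ← h1]
  exact (bl_inv hdn (by simpa using hm hz)).symm
theorem disc_model {τ τ' : ℂ → ℂ} (hd : DifferentiableOn ℂ τ (ball 0 1))
    (hd' : DifferentiableOn ℂ τ' (ball 0 1)) (hm : MapsTo τ (ball 0 1) (ball 0 1))
    (hm' : MapsTo τ' (ball 0 1) (ball 0 1)) (hl : ∀ z ∈ ball (0:ℂ) 1, τ' (τ z) = z)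
    (hr : ∀ z ∈ ball (0:ℂ) 1, τ (τ' z) = z)
    (hfix : ∀ z ∈ ball (0:ℂ) 1, τ z ≠ z) :
    ∃ k j : ℂ → ℂ, DifferentiableOn ℂ k (ball 0 1) ∧ DifferentiableOn ℂ j {w | 0 < w.im} ∧
      MapsTo k (ball 0 1) {w | 0 < w.im} ∧ MapsTo j {w | 0 < w.im} (ball 0 1) ∧
      (∀ z ∈ ball (0:ℂ) 1, j (k z) = z) ∧ (∀ w ∈ {w : ℂ | 0 < w.im}, k (j w) = w) ∧
      ((∃ r : ℝ, 0 < r ∧ r ≠ 1 ∧ ∀ z ∈ ball (0:ℂ) 1, k (τ z) = r * k z) ∨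
       (∃ r : ℝ, r ≠ 0 ∧ ∀ z ∈ ball (0:ℂ) 1, k (τ z) = k z + r)) := by
  obtain ⟨d, u, hdn, hu, hd0, hτ⟩ := aut_disc hd hd' hm hm' hl
  have h0 : (0:ℂ) ∈ ball (0:ℂ) 1 := by simp
  have hdne : d ≠ 0 := by rw [hd0]; exact hfix 0 h0
  have hune : u ≠ 0 := by rintro rfl; simp at hu
  obtain ⟨A, hA⟩ : ∃ A, A = conj d * u := ⟨_, rfl⟩
  have hAn : ‖A‖ = ‖d‖ := by rw [hA]; simp [hu]
  have hAne : A ≠ 0 := by rw [← norm_pos_iff, hAn]; exact norm_pos_iff.2 hdne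
  have hden : ∀ z ∈ ball (0:ℂ) 1, 1 + A * z ≠ 0 := by
    intro z hz
    have := bl_den (a := -d) (z := u * z) (by simpa) (by simpa [hu] using hz)
    rw [hA]; simpa [mul_assoc] using this
  have hτe : ∀ z ∈ ball (0:ℂ) 1, τ z = (u * z + d) / (1 + A * z) := by
    intro z hz
    rw [hτ z hz, bl, hA]; simp [mul_assoc]
  obtain ⟨s, hs⟩ := IsAlgClosed.exists_eq_mul_self ((1 - u)^2 + 4 * A * d)
  obtain ⟨p, hp⟩ : ∃ p, p = (u - 1 + s) / (2 * A) := ⟨_, rfl⟩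
  obtain ⟨q, hq⟩ : ∃ q, q = (u - 1 - s) / (2 * A) := ⟨_, rfl⟩
  have hsum : A * (p + q) = u - 1 := by rw [hp, hq]; field_simp; ring
  have hprod : A * (p * q) = -d := by
    rw [hp, hq]; field_simp; linear_combination hs
  have hpe : A * p^2 + (1 - u) * p - d = 0 := by linear_combination p * hsum - hprod
  have hqe : A * q^2 + (1 - u) * q - d = 0 := by linear_combination q * hsum - hprod
  clear hp hq
  have hpq : ‖p‖ * ‖q‖ = 1 := by
    have := congrArg norm hprod
    rw [norm_mul, norm_mul, norm_neg, hAn] at this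
    exact mul_left_cancel₀ (norm_ne_zero_iff.2 hdne) (by rw [this, mul_one])
  have hge : ∀ x, A * x^2 + (1 - u) * x - d = 0 → 1 ≤ ‖x‖ := by
    intro x hx
    by_contra hlt
    push Not at hlt
    have hxb : x ∈ ball (0:ℂ) 1 := by simpa using hlt
    apply hfix x hxb
    rw [hτe x hxb, div_eq_iff (hden x hxb)]
    linear_combination -hx
  have hp1 : ‖p‖ = 1 := by nlinarith [hge p hpe, hge q hqe]
  have hq1 : ‖q‖ = 1 := by nlinarith [hge p hpe, hge q hqe]
  have hpp : p * conj p = 1 := by rw [Complex.mul_conj, Complex.normSq_eq_norm_sq, hp1]; simp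
  have hqq : q * conj q = 1 := by rw [Complex.mul_conj, Complex.normSq_eq_norm_sq, hq1]; simp
  have hkey : ∀ x, A * x^2 + (1 - u) * x - d = 0 → ∀ z ∈ ball (0:ℂ) 1,
      τ z - x = (u - x * A) * (z - x) / (1 + A * z) := by
    intro x hx z hz
    rw [hτe z hz, eq_div_iff (hden z hz), sub_mul, div_mul_cancel₀ _ (hden z hz)]
    linear_combination -hx
  have hune' : ∀ x, ‖x‖ = 1 → u - x * A ≠ 0 := by
    intro x hx h
    have : ‖u‖ = ‖x * A‖ := by rw [sub_eq_zero.1 h]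
    rw [norm_mul, hx, hAn, hu] at this
    linarith
  have hzne : ∀ x : ℂ, ‖x‖ = 1 → ∀ z ∈ ball (0:ℂ) 1, z - x ≠ 0 := by
    intro x hx z hz h
    rw [sub_eq_zero.1 h] at hz
    simp [hx] at hz
  by_cases hne : p = q
  · -- parabolic
    subst hne
    set k : ℂ → ℂ := fun z => Complex.I * (p + z) / (p - z) with hk
    set j : ℂ → ℂ := fun w => p * (w - Complex.I) / (w + Complex.I) with hj
    have hz2 : ∀ z ∈ ball (0:ℂ) 1, p - z ≠ 0 := fun z hz h =>
      hzne p hp1 z hz (by linear_combination -h)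
    have hw2 : ∀ w ∈ {w : ℂ | 0 < w.im}, w + Complex.I ≠ 0 := fun w hw h => by
      have := congrArg Complex.im h
      have hw' : 0 < w.im := hw
      simp at this; linarith
    have hp0 : p ≠ 0 := by rintro rfl; simp at hp1
    have hpn : p.re * p.re + p.im * p.im = 1 := by
      rw [← Complex.normSq_apply, Complex.normSq_eq_norm_sq, hp1]; norm_num
    have hkm : MapsTo k (ball 0 1) {w | 0 < w.im} := by
      intro z hz
      have hzn : z.re * z.re + z.im * z.im < 1 := by
        rw [← Complex.normSq_apply, Complex.normSq_eq_norm_sq]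
        have : ‖z‖ < 1 := by simpa using hz
        nlinarith [norm_nonneg z]
      have hpos : 0 < Complex.normSq (p - z) := Complex.normSq_pos.2 (hz2 z hz)
      have : (k z).im = (1 - (z.re * z.re + z.im * z.im)) / Complex.normSq (p - z) := by
        simp only [hk, Complex.div_im]
        rw [← hpn]
        field_simp
        simp; ring
      rw [mem_ofPred_eq, this]
      apply div_pos _ hpos
      linarith
    have hjm : MapsTo j {w | 0 < w.im} (ball 0 1) := by
      intro w hw
      have hw' : 0 < w.im := hw
      rw [mem_ball_zero_iff, hj]
      simp only [norm_div, norm_mul, hp1, one_mul]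
      rw [div_lt_one (norm_pos_iff.2 (hw2 w hw)), ← sq_lt_sq₀ (norm_nonneg _) (norm_nonneg _),
        Complex.sq_norm, Complex.sq_norm, Complex.normSq_apply, Complex.normSq_apply]
      simp; nlinarith
    have hlam : ∀ z ∈ ball (0:ℂ) 1, k (τ z) = k z + (-2 * Complex.I * p * A / (u - p * A)) := by
      intro z hz
      have h1 := hkey p hpe z hz
      have h2 := hden z hz
      have h3 := hune' p hp1
      have h4 : p - τ z ≠ 0 := hz2 _ (hm hz)
      have h5 := hz2 z hz
      have h6 : 1 + A * p = u - p * A := by linear_combination hsum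
      have h7 : 1 / (p - τ z) = 1 / (p - z) - A / (u - p * A) := by
        have e : p - τ z = (u - p * A) * (p - z) / (1 + A * z) := by
          rw [show p - τ z = -(τ z - p) by ring, h1]; ring
        rw [e]
        rw [one_div_div, div_sub_div _ _ h5 h3, div_eq_div_iff (mul_ne_zero h3 h5) (mul_ne_zero h5 h3)]
        linear_combination ((u - p * A) * (p - z)) * h6
      have h8 : ∀ x, p - x ≠ 0 → k x = -Complex.I + 2 * Complex.I * p * (1 / (p - x)) := by
        intro x hx
        simp only [hk]; field_simp; ring
      rw [h8 _ h4, h8 _ h5, h7]; ring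
    set β := -2 * Complex.I * p * A / (u - p * A) with hβ
    have hβ0 : β ≠ 0 := by
      rw [hβ]
      refine div_ne_zero ?_ (hune' p hp1)
      simp [hp0, hAne]
    have hkj : ∀ w ∈ {w : ℂ | 0 < w.im}, k (j w) = w := by
      intro w hw
      have h1 := hw2 w hw
      have h2 := hz2 _ (hjm hw)
      simp only [hk]
      rw [div_eq_iff h2]
      simp only [hj]
      field_simp
      ring_nf
    have him : β.im = 0 := by
      have hb1 : ∀ w : ℂ, 0 < w.im → 0 < w.im + β.im := by
        intro w hw
        have := hkm (hm (hjm hw))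
        rw [mem_ofPred_eq, hlam _ (hjm hw), hkj w hw] at this
        simpa using this
      have hb2 : ∀ w : ℂ, 0 < w.im → 0 < w.im - β.im := by
        intro w hw
        have h1 := hm' (hjm hw)
        have := hlam _ h1
        rw [hr _ (hjm hw), hkj w hw] at this
        have h3 := hkm h1
        rw [this]
        simpa using h3
      by_contra hb
      rcases lt_or_gt_of_ne hb with hb | hb
      · have := hb1 ⟨0, -β.im / 2⟩ (by simp; linarith)
        simp at this; linarith
      · have := hb2 ⟨0, β.im / 2⟩ (by simp; linarith)
        simp at this; linarith
    refine ⟨k, j, ?_, ?_, hkm, hjm, ?_, hkj, Or.inr ⟨β.re, ?_, ?_⟩⟩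
    · exact DifferentiableOn.div (by fun_prop) (by fun_prop) hz2
    · exact DifferentiableOn.div (by fun_prop) (by fun_prop) hw2
    · intro z hz
      have h1 := hz2 z hz
      have h2 := hw2 _ (hkm hz)
      simp only [hj]
      rw [div_eq_iff h2]
      simp only [hk]
      field_simp
      ring
    · intro h; exact hβ0 (Complex.ext h him)
    · intro z hz
      rw [hlam z hz]
      congr 1
      exact (Complex.ext (by simp) (by simp [him]))
  · -- hyperbolic
    obtain ⟨s, hs2, hsi⟩ : ∃ s : ℂ, s * s = q * conj p ∧ s.im < 0 := by
      obtain ⟨s, hs⟩ := IsAlgClosed.exists_eq_mul_self (q * conj p)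
      have hsn : s.im ≠ 0 := by
        intro him
        have hsr : s = (s.re : ℂ) := Complex.ext (by simp) (by simp [him])
        have h1 : ‖s‖ * ‖s‖ = 1 := by rw [← norm_mul, ← hs]; simp [hp1, hq1]
        have h2 : s * s = 1 := by
          rw [hsr] at h1 ⊢
          rw [Complex.norm_real] at h1
          rw [← Complex.ofReal_mul, ← abs_mul_abs_self]
          exact_mod_cast h1
        rw [h2] at hs
        apply hne
        linear_combination (-p) * hs + q * hpp
      rcases lt_or_gt_of_ne hsn with h | h
      · exact ⟨s, hs.symm, h⟩
      · exact ⟨-s, by rw [hs]; ring, by simpa using h⟩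
    have hs1 : ‖s‖ = 1 := by
      have h1 : ‖s‖ * ‖s‖ = 1 := by rw [← norm_mul, hs2]; simp [hp1, hq1]
      nlinarith [norm_nonneg s]
    have hss : s * conj s = 1 := by rw [Complex.mul_conj, Complex.normSq_eq_norm_sq, hs1]; simp
    have hsp : s * p = conj s * q := by
      linear_combination (-s * p) * hss + conj s * p * hs2 + conj s * q * hpp
    have hs0 : s ≠ 0 := by rintro rfl; simp at hs1
    set k : ℂ → ℂ := fun z => s * (z - p) / (z - q) with hk
    set j : ℂ → ℂ := fun w => (q * w - s * p) / (w - s) with hj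
    have hz2 := hzne q hq1
    have hw2 : ∀ w ∈ {w : ℂ | 0 < w.im}, w - s ≠ 0 := fun w hw h => by
      have := congrArg Complex.im h
      have hw' : 0 < w.im := hw
      simp at this; linarith
    have him : ∀ z, z - q ≠ 0 → (k z).im = (-s.im) * (1 - Complex.normSq z) / Complex.normSq (z - q) := by
      intro z hz
      have e : k z = (s * (z - p) * conj (z - q)) / ((Complex.normSq (z - q) : ℝ) : ℂ) := by
        simp only [hk]
        rw [← Complex.mul_conj]
        have : conj (z - q) ≠ 0 := (map_ne_zero _).2 hz
        rw [mul_div_mul_right _ _ this]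
      rw [e, Complex.div_ofReal_im]
      congr 1
      have e2 : s * (z - p) * conj (z - q) = s * ((Complex.normSq z : ℝ) : ℂ) + conj s
          - (s * conj q * z + conj (s * conj q * z)) := by
        rw [← Complex.mul_conj]
        simp only [map_sub, map_mul, Complex.conj_conj]
        linear_combination (conj q - conj z) * hsp + conj s * hqq
      rw [e2, Complex.add_conj]
      simp [-Complex.ofReal_mul]
      ring
    have hkm : MapsTo k (ball 0 1) {w | 0 < w.im} := by
      intro z hz
      have hzn : Complex.normSq z < 1 := by
        rw [Complex.normSq_eq_norm_sq]
        have : ‖z‖ < 1 := by simpa using hz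
        nlinarith [norm_nonneg z]
      have hpos : 0 < Complex.normSq (z - q) := Complex.normSq_pos.2 (hz2 z hz)
      rw [mem_ofPred_eq, him z (hz2 z hz)]
      exact div_pos (mul_pos (by linarith) (by linarith)) hpos
    have hjq : ∀ w ∈ {w : ℂ | 0 < w.im}, j w - q ≠ 0 := by
      intro w hw h
      have h1 := hw2 w hw
      simp only [hj] at h
      rw [div_sub' h1, div_eq_zero_iff] at h
      rcases h with h | h
      · have : s * (q - p) = 0 := by linear_combination h
        rcases mul_eq_zero.1 this with h | h
        · exact hs0 h
        · exact hne (sub_eq_zero.1 h).symm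
      · exact h1 h
    have hkj : ∀ w ∈ {w : ℂ | 0 < w.im}, k (j w) = w := by
      intro w hw
      have h1 := hw2 w hw
      have h2 := hjq w hw
      simp only [hk]
      rw [div_eq_iff h2]
      simp only [hj]
      field_simp
      ring
    have hjm : MapsTo j {w | 0 < w.im} (ball 0 1) := by
      intro w hw
      have h1 := him (j w) (hjq w hw)
      rw [hkj w hw] at h1
      have hw' : 0 < w.im := hw
      have hpos : 0 < Complex.normSq (j w - q) := Complex.normSq_pos.2 (hjq w hw)
      rw [h1, div_pos_iff_of_pos_right hpos, Complex.normSq_eq_norm_sq] at hw'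
      rw [mem_ball_zero_iff]
      have := pos_of_mul_pos_right hw' (by linarith)
      nlinarith [norm_nonneg (j w)]
    set L := (u - p * A) / (u - q * A) with hL
    have hlam : ∀ z ∈ ball (0:ℂ) 1, k (τ z) = L * k z := by
      intro z hz
      have h1 := hden z hz
      have h2 := hune' q hq1
      have h3 := hz2 z hz
      simp only [hk]
      rw [hkey p hpe z hz, hkey q hqe z hz, hL]
      field_simp
    have hLw : ∀ x : ℝ, 0 < L.im * x + L.re := by
      intro x
      have hw : (0:ℝ) < (⟨x, 1⟩ : ℂ).im := one_pos
      have := hkm (hm (hjm hw))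
      rw [mem_ofPred_eq, hlam _ (hjm hw), hkj _ hw] at this
      simp at this
      linarith
    have hLim : L.im = 0 := by
      by_contra h
      have := hLw (-(L.re + 1) / L.im)
      rw [mul_div_cancel₀ _ h] at this
      linarith
    have hLre : L = (L.re : ℂ) := Complex.ext (by simp) (by simp [hLim])
    refine ⟨k, j, ?_, ?_, hkm, hjm, ?_, hkj, Or.inl ⟨L.re, ?_, ?_, ?_⟩⟩
    · exact DifferentiableOn.div (by fun_prop) (by fun_prop) hz2
    · exact DifferentiableOn.div (by fun_prop) (by fun_prop) hw2
    · intro z hz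
      have h1 := hz2 z hz
      have h2 := hw2 _ (hkm hz)
      simp only [hj]
      rw [div_eq_iff h2]
      simp only [hk]
      field_simp
      ring
    · simpa using hLw 0
    · intro h
      rw [h] at hLre
      rw [hL, div_eq_iff (hune' q hq1)] at hLre
      have : A * (p - q) = 0 := by push_cast at hLre; linear_combination -hLre
      rcases mul_eq_zero.1 this with h | h
      · exact hAne h
      · exact hne (sub_eq_zero.1 h)
    · intro z hz
      rw [hlam z hz, ← hLre]
def Str (m : ℝ) : Set ℂ := {z | |z.im| < m}
theorem isOpen_Str {m : ℝ} : IsOpen (Str m) :=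
  isOpen_lt (continuous_abs.comp Complex.continuous_im) continuous_const
theorem convex_Str {m : ℝ} : Convex ℝ (Str m) := by
  have : Str m = Complex.im ⁻¹' (Ioo (-m) m) := by ext z; simp [Str, abs_lt]
  rw [this]
  exact (convex_Ioo _ _).linear_preimage Complex.imLm
theorem per_Str {m : ℝ} : Per (Str m) := fun z => by simp [Str]
theorem Str_mono {m n : ℝ} (h : m ≤ n) : Str m ⊆ Str n := fun _ (hz : _ < m) => lt_of_lt_of_le hz h
theorem Ar_Str {m : ℝ} : Ar (Str m) = ENNReal.ofReal (4 * π * m) := by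
  have e : Str m ∩ FD = Complex.measurableEquivRealProd ⁻¹' (Ioc 0 (2 * π) ×ˢ Ioo (-m) m) := by
    ext z; simp [Str, FD, abs_lt, Complex.measurableEquivRealProd_apply]; tauto
  rw [Ar, e, Complex.volume_preserving_equiv_real_prod.measure_preimage
    (measurableSet_Ioc.prod measurableSet_Ioo).nullMeasurableSet, Measure.volume_eq_prod,
    Measure.prod_prod, Real.volume_Ioc, Real.volume_Ioo, ← ENNReal.ofReal_mul (by simp [Real.pi_nonneg])]
  congr 1; ring
theorem Ar_mono {U V : Set ℂ} (h : U ⊆ V) : Ar U ≤ Ar V := measure_mono (inter_subset_inter_left _ h)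
theorem Ar_ne_top {U : Set ℂ} (h : U ⊆ Str 1) : Ar U ≠ ⊤ :=
  ((Ar_mono h).trans_lt (by rw [Ar_Str]; exact ENNReal.ofReal_lt_top)).ne
theorem ring_unif {U : Set ℂ} (hUo : IsOpen U) (hUc : IsSimplyConnected U) (hU : U ⊆ Str 1)
    (hp : Per U) : ∃ m > 0, ∃ h : ℂ → ℂ, DifferentiableOn ℂ h U ∧ InjOn h U ∧ h '' U = Str m ∧ Eqv h U := by
  have hpi := Real.pi_pos
  obtain ⟨h0, hd, hi, him⟩ := riemann_mapping hUo hUc (fun z hz => hU hz)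
  have hne : U.Nonempty := by
    by_contra h
    rw [not_nonempty_iff_eq_empty] at h
    have : (0:ℂ) ∈ h0 '' U := by rw [him]; simp
    simp [h] at this
  set g := Function.invFunOn h0 U with hg
  have hgl : ∀ z ∈ U, g (h0 z) = z := fun z hz => hi.leftInvOn_invFunOn hz
  have hgd : DifferentiableOn ℂ g (ball 0 1) := by
    rw [← him]; exact inj_inv hUo hd hgl
  have hgm : MapsTo g (ball 0 1) U := by
    rw [← him]; rintro _ ⟨z, hz, rfl⟩; rw [hgl z hz]; exact hz
  have hgr : ∀ w ∈ ball (0:ℂ) 1, h0 (g w) = w := by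
    rw [← him]; rintro _ ⟨z, hz, rfl⟩; rw [hgl z hz]
  have hhm : MapsTo h0 U (ball 0 1) := by rw [← him]; exact mapsTo_image _ _
  have hpm : MapsTo (fun z => z + tp) U U := fun z hz => (hp z).1 hz
  have hpm' : MapsTo (fun z => z - tp) U U := fun z hz => (hp _).2 (by simpa using hz)
  have htp : tp ≠ 0 := fun h => by have := congrArg Complex.re h; simp at this
  obtain ⟨k, j, hkd, hjd, hkm, hjm, hjk, hkj, hor⟩ := disc_model
    (τ := fun w => h0 (g w + tp)) (τ' := fun w => h0 (g w - tp))
    (hd.comp (hgd.add_const _) (hpm.comp hgm)) (hd.comp (hgd.sub_const _) (hpm'.comp hgm))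
    (hhm.comp (hpm.comp hgm)) (hhm.comp (hpm'.comp hgm))
    (fun z hz => by
      show h0 (g (h0 (g z + tp)) - tp) = z
      rw [hgl _ (hpm (hgm hz)), add_sub_cancel_right, hgr _ hz])
    (fun z hz => by
      show h0 (g (h0 (g z - tp)) + tp) = z
      rw [hgl _ (hpm' (hgm hz)), sub_add_cancel, hgr _ hz])
    (fun z hz h => by
      have h2 := congrArg g h
      rw [hgl _ (hpm (hgm hz))] at h2
      exact htp (by simpa using h2))
  rcases hor with ⟨r, hr0, hr1, hr⟩ | ⟨r, hr0, hr⟩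
  · set L := Real.log r with hL
    have hL0 : L ≠ 0 := by
      rw [hL]; exact Real.log_ne_zero_of_pos_of_ne_one hr0 hr1
    have hLc : (L:ℂ) ≠ 0 := by exact_mod_cast hL0
    have hpc : (π:ℂ) ≠ 0 := by exact_mod_cast hpi.ne'
    set c : ℝ := 2 * π / L with hc
    have hc0 : c ≠ 0 := div_ne_zero (by positivity) hL0
    set h : ℂ → ℂ := fun z => (c:ℂ) * (Complex.log (k (h0 z)) - Complex.I * (π / 2 : ℝ)) with hh
    have hsl : ∀ w : ℂ, 0 < w.im → w ∈ Complex.slitPlane := fun w hw => Or.inr hw.ne'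
    have hkm' : MapsTo (fun z => k (h0 z)) U {w | 0 < w.im} := hkm.comp hhm
    have himz : ∀ z, (h z).im = c * ((k (h0 z)).arg - π / 2) := by
      intro z; simp [hh, Complex.log_im]
    refine ⟨π ^ 2 / |L|, by positivity, h, ?_, ?_, ?_, ?_⟩
    · apply DifferentiableOn.const_mul
      apply DifferentiableOn.sub_const
      exact (hkd.comp hd hhm).clog fun z hz => hsl _ (hkm' hz)
    · intro z hz w hw hzw
      have h1 : Complex.log (k (h0 z)) = Complex.log (k (h0 w)) := by
        have := mul_left_cancel₀ (by exact_mod_cast hc0) hzw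
        simpa using this
      have h2 : k (h0 z) = k (h0 w) := by
        have e1 := Complex.exp_log (Complex.slitPlane_ne_zero (hsl _ (hkm' hz)))
        have e2 := Complex.exp_log (Complex.slitPlane_ne_zero (hsl _ (hkm' hw)))
        simp only at e1 e2
        rw [← e1, h1, e2]
      have h3 : h0 z = h0 w := by rw [← hjk _ (hhm hz), h2, hjk _ (hhm hw)]
      exact hi hz hw h3
    · ext w
      constructor
      · rintro ⟨z, hz, rfl⟩
        have h1 : 0 < (k (h0 z)).im := hkm' hz
        have h2 : 0 < (k (h0 z)).arg := by
          rcases (Complex.arg_nonneg_iff.2 h1.le).eq_or_lt with h | h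
          · exact absurd (Complex.arg_eq_zero_iff.1 h.symm).2 h1.ne'
          · exact h
        have h3 : (k (h0 z)).arg < π :=
          Complex.arg_lt_pi_iff.2 (Or.inr h1.ne')
        show |(h z).im| < _
        rw [himz, abs_mul, hc, abs_div, abs_of_pos (by positivity : 0 < 2 * π)]
        have : |(k (h0 z)).arg - π / 2| < π / 2 := by
          rw [abs_lt]; constructor <;> linarith
        calc _ < 2 * π / |L| * (π / 2) := by gcongr
          _ = _ := by ring
      · intro hw
        set a : ℝ := w.im / c + π / 2 with ha
        have hw1 : |w.im / c| < π / 2 := by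
          have hw' : |w.im| < π ^ 2 / |L| := hw
          rw [abs_div, div_lt_iff₀ (abs_pos.2 hc0)]
          calc _ < _ := hw'
            _ = _ := by rw [hc, abs_div, abs_of_pos (by positivity : 0 < 2 * π)]; ring
        rw [abs_lt] at hw1
        set y : ℂ := w / c + Complex.I * (π / 2 : ℝ) with hy
        have hyi : y.im = a := by simp [hy, ha, Complex.div_ofReal_im]
        have hE : 0 < (Complex.exp y).im := by
          rw [Complex.exp_im, hyi]
          exact mul_pos (Real.exp_pos _) (Real.sin_pos_of_pos_of_lt_pi (by linarith) (by linarith))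
        refine ⟨g (j (Complex.exp y)), hgm (hjm hE), ?_⟩
        simp only [hh]
        rw [hgr _ (hjm hE), hkj _ hE, Complex.log_exp (by linarith) (by linarith), hy]
        have : (c:ℂ) ≠ 0 := by exact_mod_cast hc0
        field_simp
        ring
    · intro z hz
      have h1 := hr _ (hhm hz)
      simp only [hgl z hz] at h1
      simp only [hh]
      rw [h1, Complex.log_ofReal_mul hr0 (Complex.slitPlane_ne_zero (hsl _ (hkm' hz))), ← hL, tp, hc]
      push_cast
      field_simp
      ring
  · exfalso
    have hrc : (r:ℂ) ≠ 0 := by exact_mod_cast hr0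
    set W : Set ℂ := {ζ | 0 < r * ζ.im} with hW
    set φ : ℂ → ℂ := fun ζ => g (j (((r / (2 * π) : ℝ) : ℂ) * ζ)) with hφ
    have hWm : MapsTo (fun ζ : ℂ => ((r / (2 * π) : ℝ) : ℂ) * ζ) W {w | 0 < w.im} := by
      intro ζ hζ
      show 0 < (((r / (2 * π) : ℝ) : ℂ) * ζ).im
      rw [Complex.im_ofReal_mul]
      have : 0 < r * ζ.im := hζ
      have e : r / (2 * π) * ζ.im = r * ζ.im / (2 * π) := by ring
      rw [e]; positivity
    have hWo : IsOpen W := isOpen_lt continuous_const (by fun_prop)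
    have hWp : Per W := fun z => by simp [hW]
    have hφd : DifferentiableOn ℂ φ W :=
      hgd.comp (hjd.comp (by fun_prop) hWm) (hjm.comp hWm)
    have hφi : InjOn φ W := by
      intro z hz w hw hzw
      have h1 := congrArg h0 hzw
      simp only [hφ] at h1
      rw [hgr _ (hjm (hWm hz)), hgr _ (hjm (hWm hw))] at h1
      have h2 := congrArg k h1
      rw [hkj _ (hWm hz), hkj _ (hWm hw)] at h2
      exact mul_left_cancel₀ (by exact_mod_cast (div_ne_zero hr0 (by positivity))) h2
    have hφm : MapsTo φ W U := hgm.comp (hjm.comp hWm)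
    have hφe : Eqv φ W := by
      intro z hz
      have h1 := hr _ (hjm (hWm hz))
      simp only at h1
      rw [hkj _ (hWm hz)] at h1
      have h2 := congrArg j h1
      rw [hjk _ (hhm (hpm (hgm (hjm (hWm hz)))))] at h2
      have h3 := congrArg g h2
      rw [hgl _ (hpm (hgm (hjm (hWm hz))))] at h3
      simp only at h3
      simp only [hφ]
      rw [h3]
      congr 2
      rw [tp]
      have : (π:ℂ) ≠ 0 := by exact_mod_cast hpi.ne'
      push_cast
      field_simp
    have hArU : (Ar U).toReal ≤ 4 * π := by
      have := ENNReal.toReal_mono (Ar_ne_top subset_rfl) (Ar_mono hU)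
      rwa [Ar_Str, ENNReal.toReal_ofReal (by positivity), mul_one] at this
    have key : ∀ a b : ℝ, b - a = 3 → (∀ z : ℂ, a ≤ z.im → z.im ≤ b → z ∈ W) → False := by
      intro a b hab hs
      have := area_ineq (by linarith) hWo hWp hs hφd hφi hφe hp hφm (Ar_ne_top hU)
      have h2 : 0 ≤ ∫ z in Rect 0 (2 * π) a b, ‖deriv φ z - 1‖ ^ 2 :=
        integral_nonneg fun _ => sq_nonneg _
      rw [hab] at this
      linarith
    rcases lt_or_gt_of_ne hr0 with hr' | hr'
    · exact key (-4) (-1) (by norm_num) fun z h1 h2 => mul_pos_of_neg_of_neg hr' (by linarith)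
    · exact key 1 4 (by norm_num) fun z h1 h2 => mul_pos hr' (by linarith)
theorem toReal_Ar_Str {m : ℝ} (hm : 0 ≤ m) : (Ar (Str m)).toReal = 4 * π * m := by
  rw [Ar_Str, ENNReal.toReal_ofReal (by have := Real.pi_pos; positivity)]
theorem strip_width {φ : ℂ → ℂ} {m : ℝ} {U : Set ℂ} (hφ : DifferentiableOn ℂ φ (Str m))
    (hi : InjOn φ (Str m)) (he : Eqv φ (Str m)) (hm : MapsTo φ (Str m) U) (hU : Per U)
    (hA : Ar U ≠ ⊤) (b : ℝ) (hb : 0 ≤ b) (hbm : b < m) :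
    ∫ z in Rect 0 (2 * π) (-b) b, ‖deriv φ z - 1‖ ^ 2 ≤ (Ar U).toReal - 4 * π * b := by
  have := area_ineq (a := -b) (b := b) (by linarith) isOpen_Str per_Str
    (fun z h1 h2 => lt_of_le_of_lt (abs_le.2 ⟨h1, h2⟩) hbm) hφ hi he hU hm hA
  linarith
theorem strip_le_Ar {φ : ℂ → ℂ} {m : ℝ} {U : Set ℂ} (hφ : DifferentiableOn ℂ φ (Str m))
    (hi : InjOn φ (Str m)) (he : Eqv φ (Str m)) (hm : MapsTo φ (Str m) U) (hU : Per U)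
    (hA : Ar U ≠ ⊤) : 4 * π * m ≤ (Ar U).toReal := by
  have hpi := Real.pi_pos
  by_contra h
  push Not at h
  have h0 : 0 ≤ (Ar U).toReal := ENNReal.toReal_nonneg
  obtain ⟨b, hb1, hb2⟩ := exists_between (show (Ar U).toReal / (4 * π) < m by
    rw [div_lt_iff₀ (by positivity)]; linarith)
  have := strip_width hφ hi he hm hU hA b (le_trans (by positivity) hb1.le) hb2
  have h2 : 0 ≤ ∫ z in Rect 0 (2 * π) (-b) b, ‖deriv φ z - 1‖ ^ 2 :=
    integral_nonneg fun _ => sq_nonneg _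
  rw [div_lt_iff₀ (by positivity)] at hb1
  linarith
theorem strip_le {φ : ℂ → ℂ} {m n : ℝ} (hφ : DifferentiableOn ℂ φ (Str m))
    (hi : InjOn φ (Str m)) (he : Eqv φ (Str m)) (hm : MapsTo φ (Str m) (Str n))
    (hm0 : 0 < m) : m ≤ n := by
  have hpi := Real.pi_pos
  have h := strip_le_Ar hφ hi he hm per_Str (by rw [Ar_Str]; exact ENNReal.ofReal_ne_top)
  have h0 : (0:ℂ) ∈ Str m := by simpa [Str] using hm0
  have hn : 0 < n := lt_of_le_of_lt (abs_nonneg _) (hm h0)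
  rw [toReal_Ar_Str hn.le] at h
  exact le_of_mul_le_mul_left h (by positivity)
theorem strip_rigid {φ : ℂ → ℂ} {m : ℝ} (hφ : DifferentiableOn ℂ φ (Str m))
    (hi : InjOn φ (Str m)) (he : Eqv φ (Str m)) (hm : MapsTo φ (Str m) (Str m))
    (hm0 : 0 < m) : ∃ c : ℝ, ∀ z ∈ Str m, φ z = z + c := by
  have hpi := Real.pi_pos
  have hd : DifferentiableOn ℂ (deriv φ) (Str m) := hφ.deriv isOpen_Str
  set R := Rect 0 (2 * π) (-(m/2)) (m/2) with hR
  have hcont : ∀ b, b < m → IntegrableOn (fun z => ‖deriv φ z - 1‖ ^ 2) (Rect 0 (2 * π) (-b) b) := by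
    intro b hb
    refine IntegrableOn.mono_set (ContinuousOn.integrableOn_compact
      (isCompact_Icc.reProdIm (isCompact_Icc (a := -b) (b := b))) ?_) Rect_subset
    refine ((hd.continuousOn.mono fun z hz => ?_).sub continuousOn_const).norm.pow 2
    exact lt_of_le_of_lt (abs_le.2 ⟨hz.2.1, hz.2.2⟩) hb
  have hle : ∀ b, m/2 ≤ b → b < m → ∫ z in R, ‖deriv φ z - 1‖ ^ 2 ≤ 4 * π * (m - b) := by
    intro b hb1 hb2
    have h1 := strip_width hφ hi he hm per_Str (by rw [Ar_Str]; exact ENNReal.ofReal_ne_top) b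
      (by linarith) hb2
    rw [toReal_Ar_Str hm0.le] at h1
    have h2 : ∫ z in R, ‖deriv φ z - 1‖ ^ 2 ≤ ∫ z in Rect 0 (2 * π) (-b) b, ‖deriv φ z - 1‖ ^ 2 := by
      refine setIntegral_mono_set (hcont b hb2) (Eventually.of_forall fun _ => sq_nonneg _) ?_
      refine LE.le.eventuallyLE fun z hz => ⟨hz.1, ?_, ?_⟩
      · exact lt_of_le_of_lt (by linarith) hz.2.1
      · exact hz.2.2.trans hb1
    linarith
  have h0 : ∫ z in R, ‖deriv φ z - 1‖ ^ 2 = 0 := by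
    apply le_antisymm _ (integral_nonneg fun _ => sq_nonneg _)
    by_contra h
    push Not at h
    set J := ∫ z in R, ‖deriv φ z - 1‖ ^ 2
    have hb := hle (max (m/2) (m - J / (8 * π))) (le_max_left _ _)
      (max_lt (by linarith) (by have : 0 < J / (8 * π) := by positivity
                                linarith))
    have : m - max (m/2) (m - J / (8 * π)) ≤ J / (8 * π) := by
      have := le_max_right (m/2) (m - J / (8 * π)); linarith
    have h3 : 4 * π * (m - max (m/2) (m - J / (8 * π))) ≤ 4 * π * (J / (8 * π)) := by
      gcongr
    have h4 : 4 * π * (J / (8 * π)) = J / 2 := by field_simp; norm_num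
    linarith
  rw [setIntegral_eq_zero_iff_of_nonneg_ae (Eventually.of_forall fun _ => sq_nonneg _)
    (hcont _ (by linarith))] at h0
  set V : Set ℂ := Ioo 0 (2 * π) ×ℂ Ioo (-(m/2)) (m/2) with hV
  have hVR : V ⊆ R := fun z hz => ⟨⟨hz.1.1, hz.1.2.le⟩, ⟨hz.2.1, hz.2.2.le⟩⟩
  have hVo : IsOpen V := isOpen_Ioo.reProdIm isOpen_Ioo
  have hVS : V ⊆ Str m := fun z hz => by
    have h1 := hz.2.1
    have h2 := hz.2.2
    show |z.im| < m
    rw [abs_lt]; constructor <;> linarith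
  have h1 : EqOn (fun z => ‖deriv φ z - 1‖ ^ 2) 0 V :=
    Measure.eqOn_open_of_ae_eq (ae_restrict_of_ae_restrict_of_subset hVR h0) hVo
      ((((hd.continuousOn.mono hVS).sub continuousOn_const).norm).pow 2) continuousOn_const
  have hz0 : (π : ℂ) ∈ V := ⟨by simp; constructor <;> linarith, by simp; linarith⟩
  have h2 : EqOn (deriv φ) (fun _ => 1) (Str m) := by
    refine (hd.analyticOnNhd isOpen_Str).eqOn_of_preconnected_of_eventuallyEq
      analyticOnNhd_const convex_Str.isPreconnected (hVS hz0) ?_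
    filter_upwards [hVo.mem_nhds hz0] with z hz
    have := h1 hz
    simpa [sub_eq_zero] using this
  have h3 : ∃ a, EqOn φ (· + a) (Str m) := by
    have hc : ∃ a, EqOn (fun z => φ z - z) (fun _ => a) (Str m) := by
      refine ⟨φ 0 - 0, fun z hz => ?_⟩
      refine isOpen_Str.is_const_of_deriv_eq_zero convex_Str.isPreconnected (f := fun z => φ z - z)
        (hφ.sub differentiableOn_id) (fun w hw => ?_) hz (by simpa [Str] using hm0)
      have hdw := hφ.differentiableAt (isOpen_Str.mem_nhds hw)
      simp only [Pi.zero_apply]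
      rw [deriv_fun_sub hdw differentiableAt_fun_id, h2 hw]
      simp
    obtain ⟨a, ha⟩ := hc
    exact ⟨a, fun z hz => by have := ha hz; simp only at this; simp only [← this]; ring⟩
  obtain ⟨a, ha⟩ := h3
  have hai : a.im = 0 := by
    by_contra hne
    have key : ∀ y : ℝ, |y| < m → |y + a.im| < m := by
      intro y hy
      have hy' : (⟨0, y⟩ : ℂ) ∈ Str m := hy
      have := hm hy'
      rw [ha hy'] at this
      simpa [Str] using this
    rcases lt_or_gt_of_ne hne with h | h
    · have h1 : |-m + ((-a.im) ⊓ m) / 2| < m := by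
        have : (0:ℝ) < (-a.im) ⊓ m := lt_min (by linarith) hm0
        rw [abs_lt]; have := min_le_right (-a.im) m; constructor <;> linarith
      have h2 := (abs_lt.1 (key _ h1)).1
      have := min_le_left (-a.im) m
      linarith
    · have h1 : |m - (a.im ⊓ m) / 2| < m := by
        have : (0:ℝ) < a.im ⊓ m := lt_min (by linarith) hm0
        rw [abs_lt]; have := min_le_right a.im m; constructor <;> linarith
      have h2 := (abs_lt.1 (key _ h1)).2
      have := min_le_left a.im m
      linarith
  refine ⟨a.re, fun z hz => ?_⟩
  rw [ha hz]
  congr 1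
  exact Complex.ext (by simp) (by simp [hai])
structure SH (F Fi : ℂ → ℂ) : Prop where
  cF : ContinuousOn F (Str 1)
  cI : ContinuousOn Fi (Str 1)
  mF : MapsTo F (Str 1) (Str 1)
  mI : MapsTo Fi (Str 1) (Str 1)
  l : ∀ z ∈ Str 1, Fi (F z) = z
  r : ∀ z ∈ Str 1, F (Fi z) = z
  e : Eqv F (Str 1)
theorem SH.ei {F Fi : ℂ → ℂ} (h : SH F Fi) : Eqv Fi (Str 1) := fun z hz => by
  have := h.e (Fi z) (h.mI hz)
  rw [h.r z hz] at this
  rw [← this, h.l _ ((per_Str _).1 (h.mI hz))]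
theorem SH.symm {F Fi : ℂ → ℂ} (h : SH F Fi) : SH Fi F :=
  ⟨h.cI, h.cF, h.mI, h.mF, h.r, h.l, h.ei⟩
theorem SH.image {F Fi : ℂ → ℂ} (h : SH F Fi) {V : Set ℂ} (hV : V ⊆ Str 1) :
    F '' V = Str 1 ∩ Fi ⁻¹' V := by
  ext w
  constructor
  · rintro ⟨z, hz, rfl⟩
    exact ⟨h.mF (hV hz), by simpa [h.l z (hV hz)] using hz⟩
  · rintro ⟨h1, h2⟩
    exact ⟨Fi w, h2, h.r w h1⟩
theorem SH.isOpen {F Fi : ℂ → ℂ} (h : SH F Fi) {V : Set ℂ} (hV : V ⊆ Str 1) (ho : IsOpen V) :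
    IsOpen (F '' V) := by
  rw [h.image hV]; exact h.cI.isOpen_inter_preimage isOpen_Str ho
theorem SH.per {F Fi : ℂ → ℂ} (h : SH F Fi) {V : Set ℂ} (hV : V ⊆ Str 1) (hp : Per V) :
    Per (F '' V) := by
  rw [h.image hV]
  intro z
  constructor
  · rintro ⟨h1, h2⟩
    refine ⟨(per_Str z).1 h1, ?_⟩
    rw [mem_preimage, h.ei z h1]; exact (hp _).1 h2
  · rintro ⟨h1, h2⟩
    have h1' := (per_Str z).2 h1
    refine ⟨h1', ?_⟩
    rw [mem_preimage, h.ei z h1'] at h2; exact (hp _).2 h2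
theorem SH.simply {F Fi : ℂ → ℂ} (h : SH F Fi) {r : ℝ} (h0 : 0 < r) (h1 : r ≤ 1) :
    IsSimplyConnected (F '' Str r) := by
  have hs := Str_mono h1
  let e : Str r ≃ₜ (F '' Str r) :=
    { toFun := fun z => ⟨F z, mem_image_of_mem _ z.2⟩
      invFun := fun w => ⟨Fi w, by obtain ⟨w, z, hz, rfl⟩ := w; simpa [h.l z (hs hz)] using hz⟩
      left_inv := fun z => Subtype.ext (h.l z (hs z.2))
      right_inv := fun w => Subtype.ext (by
        obtain ⟨w, z, hz, rfl⟩ := w; simp [h.l z (hs hz)])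
      continuous_toFun := by
        exact (continuousOn_iff_continuous_domRestrict.1 (h.cF.mono hs)).subtype_mk _
      continuous_invFun := by
        refine (continuousOn_iff_continuous_domRestrict.1 (h.cI.mono ?_)).subtype_mk _
        rintro _ ⟨z, hz, rfl⟩; exact h.mF (hs hz) }
  have hc : ContractibleSpace (Str r) :=
    convex_Str.contractibleSpace ⟨0, by simpa [Str] using h0⟩
  have : ContractibleSpace (F '' Str r) := e.contractibleSpace_iff.1 hc
  exact (inferInstance : SimplyConnectedSpace (F '' Str r))
structure NU (F : ℂ → ℂ) (r m : ℝ) (h : ℂ → ℂ) : Prop where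
  pos : 0 < m
  d : DifferentiableOn ℂ h (F '' Str r)
  i : InjOn h (F '' Str r)
  im : h '' (F '' Str r) = Str m
  e : Eqv h (F '' Str r)
  n : (h (F 0)).re + (h (F π)).re = π
theorem SH.exists_NU {F Fi : ℂ → ℂ} (h : SH F Fi) {r : ℝ} (h0 : 0 < r) (h1 : r ≤ 1) :
    ∃ m f, NU F r m f := by
  have hs := Str_mono h1
  obtain ⟨m, hm, f, hd, hi, him, he⟩ := ring_unif (h.isOpen hs isOpen_Str) (h.simply h0 h1)
    (by rintro _ ⟨z, hz, rfl⟩; exact h.mF (hs hz)) (h.per hs per_Str)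
  set c : ℝ := (π - (f (F 0)).re - (f (F π)).re) / 2 with hc
  refine ⟨m, fun z => f z + c, hm, hd.add_const _, ?_, ?_, ?_, ?_⟩
  · intro z hz w hw hzw
    exact hi hz hw (by simpa using hzw)
  · rw [← him]
    rw [show (fun z => f z + c) = (fun z => z + (c:ℂ)) ∘ f from rfl, image_comp, him]
    ext z
    simp only [image_add_right, mem_preimage]
    simp [Str]
  · intro z hz; simp only [he z hz]; ring
  · simp [hc]; ring
theorem NU.inv {F Fi : ℂ → ℂ} (h : SH F Fi) {r m : ℝ} (h1 : r ≤ 1) {f φ : ℂ → ℂ} (hf : NU F r m f)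
    (hφ : ∀ z ∈ F '' Str r, φ (f z) = z) : DifferentiableOn ℂ φ (Str m) ∧ InjOn φ (Str m) ∧
      MapsTo φ (Str m) (F '' Str r) ∧ Eqv φ (Str m) ∧ ∀ w ∈ Str m, f (φ w) = w := by
  have hs := Str_mono h1
  have hr : ∀ w ∈ Str m, f (φ w) = w := by
    rw [← hf.im]; rintro _ ⟨z, hz, rfl⟩; rw [hφ z hz]
  have hm : MapsTo φ (Str m) (F '' Str r) := by
    rw [← hf.im]; rintro _ ⟨z, hz, rfl⟩; rw [hφ z hz]; exact hz
  refine ⟨by rw [← hf.im]; exact inj_inv (h.isOpen hs isOpen_Str) hf.d hφ, ?_, hm, ?_, hr⟩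
  · intro z hz w hw hzw; rw [← hr z hz, hzw, hr w hw]
  · intro w hw
    have := hf.e _ (hm hw)
    rw [hr w hw] at this
    rw [← this, hφ _ ((h.per hs per_Str _).1 (hm hw))]
theorem NU.uniq {F Fi : ℂ → ℂ} (h : SH F Fi) {r m m' : ℝ} (h0 : 0 < r) (h1 : r ≤ 1) {f f' : ℂ → ℂ} (hf : NU F r m f)
    (hf' : NU F r m' f') : m = m' ∧ EqOn f f' (F '' Str r) := by
  have key : ∀ {m m' : ℝ} {f f' : ℂ → ℂ}, NU F r m f → NU F r m' f' →
      ∃ φ : ℂ → ℂ, (∀ z ∈ F '' Str r, φ (f z) = f' z) ∧ DifferentiableOn ℂ φ (Str m) ∧ InjOn φ (Str m) ∧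
      MapsTo φ (Str m) (Str m') ∧ Eqv φ (Str m) := by
    intro m m' f f' hf hf'
    set g := Function.invFunOn f (F '' Str r)
    have hg : ∀ z ∈ F '' Str r, g (f z) = z := fun z hz => hf.i.leftInvOn_invFunOn hz
    obtain ⟨a, b, c, d, e⟩ := hf.inv h h1 hg
    refine ⟨fun w => f' (g w), fun z hz => by simp only [hg z hz], hf'.d.comp a c,
      hf'.i.comp b c, ?_, fun w hw => ?_⟩
    · intro w hw; rw [← hf'.im]; exact mem_image_of_mem _ (c hw)
    · simp only; rw [d w hw, hf'.e _ (c hw)]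
  obtain ⟨φ, k0, k1, k2, k3, k4⟩ := key hf hf'
  obtain ⟨φ', k0', k1', k2', k3', k4'⟩ := key hf' hf
  have hmm : m = m' := le_antisymm (strip_le k1 k2 k4 k3 hf.pos) (strip_le k1' k2' k4' k3' hf'.pos)
  refine ⟨hmm, ?_⟩
  subst hmm
  obtain ⟨c, hc⟩ := strip_rigid k1 k2 k4 k3 hf.pos
  have hz : ∀ z ∈ F '' Str r, f' z = f z + c := fun z hz => by
    rw [← k0 z hz, hc _ (by rw [← hf.im]; exact mem_image_of_mem _ hz)]
  have e1 := hz (F 0) ⟨0, by simpa [Str] using h0, rfl⟩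
  have e2 := hz (F π) ⟨π, by simpa [Str] using h0, rfl⟩
  have := hf'.n
  rw [e1, e2] at this
  simp only [Complex.add_re, Complex.ofReal_re] at this
  have hc0 : c = 0 := by have := hf.n; linarith
  intro z hz'; rw [hz z hz', hc0]; simp
theorem NU.le_one {F Fi : ℂ → ℂ} (h : SH F Fi) {r m : ℝ} (h1 : r ≤ 1) {f : ℂ → ℂ} (hf : NU F r m f) : m ≤ 1 := by
  have hs := Str_mono h1
  obtain ⟨a, b, c, d, e⟩ := hf.inv h h1 (fun z hz => hf.i.leftInvOn_invFunOn hz)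
  refine strip_le a b d (fun w hw => ?_) hf.pos
  obtain ⟨z, hz, h2⟩ := c hw
  rw [← h2]; exact h.mF (hs hz)
theorem ev_prod_nhds {ι : Type*} {l : Filter ι} {z : ℂ} {p : ι × ℂ → Prop}
    (h : ∀ᶠ q in l ×ˢ 𝓝 z, p q) : ∃ ε > 0, ∀ᶠ i in l, ∀ w ∈ ball z ε, p (i, w) := by
  rw [eventually_prod_iff] at h
  obtain ⟨pa, ha, pb, hb, hab⟩ := h
  obtain ⟨ε, hε, hb⟩ := Metric.eventually_nhds_iff_ball.1 hb
  exact ⟨ε, hε, ha.mono fun i hi w hw => hab hi (hb w hw)⟩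
theorem open_sub_Str {S : Set ℂ} (hS : IsOpen S) {c : ℝ} (h : ∀ z ∈ S, |z.im| ≤ c) : S ⊆ Str c := by
  intro z hz
  obtain ⟨ε, hε, hb⟩ := Metric.isOpen_iff.1 hS z hz
  have hm : ∀ t : ℝ, |t| = ε / 2 → |z.im + t| ≤ c := by
    intro t ht
    have := h (z + t * Complex.I) (hb (by
      simp only [mem_ball, dist_eq_norm, add_sub_cancel_left, norm_mul, Complex.norm_I, mul_one,
        Complex.norm_real, Real.norm_eq_abs, ht]
      linarith))
    simpa using this
  have h1 := hm (ε / 2) (abs_of_pos (by linarith))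
  have h2 := hm (-(ε / 2)) (by rw [abs_neg]; exact abs_of_pos (by linarith))
  show |z.im| < c
  rw [abs_le] at h1 h2
  rw [abs_lt]; constructor <;> linarith
theorem zero_mem_Str {r : ℝ} (h : 0 < r) (x : ℝ) : (x : ℂ) ∈ Str r := by simpa [Str] using h
theorem unif_limit {ι : Type*} (𝒰 : Ultrafilter ι) {F Fi : ι → ℂ → ℂ} {F0 Fi0 : ℂ → ℂ}
    (hS : ∀ i, SH (F i) (Fi i)) (hS0 : SH F0 Fi0) (hF : CConv 𝒰 F F0 (Str 1))
    (hFi : CConv 𝒰 Fi Fi0 (Str 1)) {r : ι → ℝ} {r0 : ℝ} (hr : ∀ i, 0 < r i ∧ r i ≤ 1)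
    (hr0 : 0 < r0) (hr1 : r0 ≤ 1) (hrt : Tendsto r 𝒰 (𝓝 r0)) {m : ι → ℝ} {h φ : ι → ℂ → ℂ}
    {m0 : ℝ} {h0 φ0 : ℂ → ℂ} (hN : ∀ i, NU (F i) (r i) (m i) (h i))
    (hφ : ∀ i, ∀ z ∈ F i '' Str (r i), φ i (h i z) = z) (hN0 : NU F0 r0 m0 h0)
    (hφ0 : ∀ z ∈ F0 '' Str r0, φ0 (h0 z) = z) :
    Tendsto m 𝒰 (𝓝 m0) ∧ CConv 𝒰 h h0 (F0 '' Str r0) ∧ CConv 𝒰 φ φ0 (Str m0) := by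
  have hpi := Real.pi_pos
  set U0 := F0 '' Str r0 with hU0
  have hs0 := Str_mono hr1
  have hs := fun i => Str_mono (hr i).2
  have hU0o : IsOpen U0 := hS0.isOpen hs0 isOpen_Str
  have hU0p : Per U0 := hS0.per hs0 per_Str
  have hU0c : IsPreconnected U0 := convex_Str.isPreconnected.image _ (hS0.cF.mono hs0)
  have hU01 : U0 ⊆ Str 1 := by rintro _ ⟨z, hz, rfl⟩; exact hS0.mF (hs0 hz)
  have hUi1 : ∀ i, F i '' Str (r i) ⊆ Str 1 := by
    rintro i _ ⟨z, hz, rfl⟩; exact (hS i).mF (hs i hz)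
  have hinvi := fun i => (hN i).inv (hS i) (hr i).2 (hφ i)
  have hm1 : ∀ i, m i ≤ 1 := fun i => (hN i).le_one (hS i) (hr i).2
  have himh : ∀ i, ∀ z ∈ F i '' Str (r i), h i z ∈ Str (m i) := fun i z hz => by
    rw [← (hN i).im]; exact mem_image_of_mem _ hz
  have hD : ∀ z ∈ U0, ∃ ε > 0, ball z ε ⊆ U0 ∧ ∀ᶠ i in (𝒰 : Filter ι), ball z ε ⊆ F i '' Str (r i) := by
    intro z hz
    have hz' := hz
    rw [hU0, hS0.image hs0] at hz'
    obtain ⟨q, hq1, hq2⟩ := exists_between (show |(Fi0 z).im| < r0 from hz'.2)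
    have h1 := hFi z hz'.1
    have h2 : ∀ᶠ w in 𝓝 (Fi0 z), |w.im| < q :=
      (isOpen_lt (by fun_prop) continuous_const).mem_nhds hq1
    obtain ⟨ε, hε, he⟩ := ev_prod_nhds (h1.eventually h2)
    obtain ⟨ε', hε', he'⟩ := Metric.isOpen_iff.1 hU0o z hz
    refine ⟨min ε ε', lt_min hε hε', (ball_subset_ball (min_le_right _ _)).trans he', ?_⟩
    filter_upwards [he, hrt.eventually (lt_mem_nhds hq2)] with i hi hri w hw
    rw [(hS i).image (hs i)]
    refine ⟨hU01 (he' (ball_subset_ball (min_le_right _ _) hw)), ?_⟩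
    exact (hi w (ball_subset_ball (min_le_left _ _) hw)).trans hri
  have hbase : ∀ i, ∃ x ∈ Icc (0:ℝ) π, (h i (F i x)).re = x := by
    intro i
    have hc : ContinuousOn (fun x : ℝ => (h i (F i x)).re - x) (Icc 0 π) := by
      refine ContinuousOn.sub (Complex.continuous_re.comp_continuousOn ?_) continuousOn_id
      refine (hN i).d.continuousOn.comp (((hS i).cF.mono (hs i)).comp
        Complex.continuous_ofReal.continuousOn fun x _ => zero_mem_Str (hr i).1 x) fun x _ => ?_
      exact mem_image_of_mem _ (zero_mem_Str (hr i).1 x)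
    have hn := (hN i).n
    have e0 : (h i (F i ((0:ℝ):ℂ))) = h i (F i 0) := by simp
    rcases le_total ((h i (F i 0)).re) 0 with h1 | h1
    · obtain ⟨x, hx, hx2⟩ := intermediate_value_Icc hpi.le hc
        (show (0:ℝ) ∈ _ from ⟨by simpa using h1, by linarith⟩)
      exact ⟨x, hx, by simp only at hx2; linarith⟩
    · obtain ⟨x, hx, hx2⟩ := intermediate_value_Icc' hpi.le hc
        (show (0:ℝ) ∈ _ from ⟨by linarith, by simpa using h1⟩)
      exact ⟨x, hx, by simp only at hx2; linarith⟩
  choose x hx hxe using hbase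
  obtain ⟨xs, hxs, hxt⟩ : ∃ a ∈ Icc (0:ℝ) π, Tendsto x 𝒰 (𝓝 a) := by
    have := isCompact_Icc.ultrafilter_le_nhds (𝒰.map x) (s := Icc (0:ℝ) π)
      (by rw [le_principal_iff]; exact Filter.mem_map.2 (Filter.univ_mem' hx))
    exact this
  obtain ⟨ms, hms, hmt⟩ : ∃ a ∈ Icc (0:ℝ) 1, Tendsto m 𝒰 (𝓝 a) := by
    have := isCompact_Icc.ultrafilter_le_nhds (𝒰.map m) (s := Icc (0:ℝ) 1)
      (by rw [le_principal_iff]; exact Filter.mem_map.2 (Filter.univ_mem' fun i => ⟨(hN i).pos.le, hm1 i⟩))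
    exact this
  have hb0 : F0 xs ∈ U0 := mem_image_of_mem _ (zero_mem_Str hr0 xs)
  have hbt : Tendsto (fun i => F i (x i)) 𝒰 (𝓝 (F0 xs)) :=
    hF.pt (zero_mem_Str one_pos xs) ((Complex.continuous_ofReal.tendsto xs).comp hxt)
  have hbn : ∀ i, ‖h i (F i (x i))‖ ≤ π + 1 := by
    intro i
    refine (Complex.norm_le_abs_re_add_abs_im _).trans (add_le_add ?_ ?_)
    · rw [hxe i, abs_of_nonneg (hx i).1]; exact (hx i).2
    · exact (show _ < m i from himh i _ (mem_image_of_mem _ (zero_mem_Str (hr i).1 _))).le.trans (hm1 i)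
  obtain ⟨κ, hκ⟩ := normal_family (f := h) 𝒰 hU0c one_pos (fun z hz => by
    obtain ⟨ε, hε, -, he⟩ := hD z hz
    refine ⟨ε, hε, he.mono fun i hi => ⟨(hN i).d.mono hi, fun w hw => ?_⟩⟩
    exact (show _ < m i from himh i w (hi hw)).le.trans (hm1 i)) hb0 hbt (Eventually.of_forall hbn)
  have hE : ELH (𝒰 : Filter ι) h U0 := fun z hz => by
    obtain ⟨ε, hε, h1, he⟩ := hD z hz
    exact ⟨ε, hε, h1, he.mono fun i hi => (hN i).d.mono hi⟩
  have hκd := (hκ.holo hE).1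
  have hκt : ∀ z ∈ U0, Tendsto (fun i => h i z) 𝒰 (𝓝 (κ z)) := fun z hz => hκ.pt hz tendsto_const_nhds
  have hin : ∀ z ∈ U0, ∀ᶠ i in (𝒰 : Filter ι), z ∈ F i '' Str (r i) := fun z hz => by
    obtain ⟨ε, hε, h1, he⟩ := hD z hz
    exact he.mono fun i hi => hi (mem_ball_self hε)
  have hκe : Eqv κ U0 := fun z hz => by
    refine tendsto_nhds_unique (hκt _ ((hU0p z).1 hz)) (((hκt z hz).add_const tp).congr' ?_)
    filter_upwards [hin z hz] with i hi
    exact ((hN i).e z hi).symm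
  have htp : tp ≠ 0 := fun h => by have := congrArg Complex.re h; simp at this
  have hκnc : ∃ a ∈ U0, ∃ b ∈ U0, κ a ≠ κ b := by
    refine ⟨_, hb0, _, (hU0p _).1 hb0, ?_⟩
    rw [hκe _ hb0]; intro h'; exact htp (by simpa using h')
  have hκi : InjOn κ U0 := by
    refine hurwitz_inj hU0o hU0c hκ hE (fun z hz w hw => ?_) hκnc
    obtain ⟨ε, hε, -, he⟩ := hD z hz
    obtain ⟨ε', hε', -, he'⟩ := hD w hw
    refine ⟨min ε ε', lt_min hε hε', ?_⟩
    filter_upwards [he, he'] with i hi hi'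
    refine (hN i).i.mono (union_subset ?_ ?_)
    · exact (ball_subset_ball (min_le_left _ _)).trans hi
    · exact (ball_subset_ball (min_le_right _ _)).trans hi'
  have hκo : IsOpen (κ '' U0) := inj_isOpen hU0o hκd hκi hU0o subset_rfl
  have hκm : κ '' U0 ⊆ Str ms := by
    refine open_sub_Str hκo ?_
    rintro _ ⟨z, hz, rfl⟩
    refine le_of_tendsto_of_tendsto (((continuous_abs.comp Complex.continuous_im).tendsto _).comp (hκt z hz)) hmt ?_
    filter_upwards [hin z hz] with i hi
    exact (show _ < m i from himh i z hi).le
  have hms0 : 0 < ms := lt_of_le_of_lt (abs_nonneg _) (hκm (mem_image_of_mem _ hb0))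
  have hD' : ∀ w ∈ Str ms, ∃ ε > 0, ball w ε ⊆ Str ms ∧ ∀ᶠ i in (𝒰 : Filter ι), ball w ε ⊆ Str (m i) := by
    intro w hw
    obtain ⟨q, hq1, hq2⟩ := exists_between (show |w.im| < ms from hw)
    obtain ⟨ε, hε, he⟩ := Metric.isOpen_iff.1 isOpen_Str w (show w ∈ Str q from hq1)
    refine ⟨ε, hε, he.trans (Str_mono hq2.le), ?_⟩
    filter_upwards [hmt.eventually (lt_mem_nhds hq2)] with i hi
    exact he.trans (Str_mono hi.le)
  have hφ1 : ∀ i, MapsTo (φ i) (Str (m i)) (Str 1) := fun i => (hinvi i).2.2.1.mono_right (hUi1 i)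
  obtain ⟨φs, hφs⟩ := normal_family (f := φ) 𝒰 convex_Str.isPreconnected one_pos (W := Str ms) (fun z hz => by
    obtain ⟨ε, hε, -, he⟩ := hD' z hz
    refine ⟨ε, hε, he.mono fun i hi => ⟨(hinvi i).1.mono hi, fun w hw => ?_⟩⟩
    exact (show _ < (1:ℝ) from hφ1 i (hi hw)).le) (hκm (mem_image_of_mem _ hb0)) (hκ.pt hb0 hbt)
    (C := ‖F0 xs‖ + 1) (by
      filter_upwards [hbt.norm.eventually (gt_mem_nhds (lt_add_one _))] with i hi
      rw [hφ i _ (mem_image_of_mem _ (zero_mem_Str (hr i).1 _))]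
      exact hi.le)
  have hE' : ELH (𝒰 : Filter ι) φ (Str ms) := fun z hz => by
    obtain ⟨ε, hε, h1, he⟩ := hD' z hz
    exact ⟨ε, hε, h1, he.mono fun i hi => (hinvi i).1.mono hi⟩
  have hφsd := (hφs.holo hE').1
  have hφκ : ∀ z ∈ U0, φs (κ z) = z := fun z hz => by
    refine tendsto_nhds_unique (hφs.pt (hκm (mem_image_of_mem _ hz)) (hκt z hz)) ?_
    refine tendsto_const_nhds.congr' ?_
    filter_upwards [hin z hz] with i hi
    exact (hφ i z hi).symm
  have hφsnc : ∃ a ∈ Str ms, ∃ b ∈ Str ms, φs a ≠ φs b := by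
    refine ⟨κ _, hκm (mem_image_of_mem _ hb0), κ _, hκm (mem_image_of_mem _ ((hU0p _).1 hb0)), ?_⟩
    rw [hφκ _ hb0, hφκ _ ((hU0p _).1 hb0)]; intro h'; exact htp (by simpa using h')
  have hφsi : InjOn φs (Str ms) := by
    refine hurwitz_inj isOpen_Str convex_Str.isPreconnected hφs hE' (fun z hz w hw => ?_) hφsnc
    obtain ⟨ε, hε, -, he⟩ := hD' z hz
    obtain ⟨ε', hε', -, he'⟩ := hD' w hw
    refine ⟨min ε ε', lt_min hε hε', ?_⟩
    filter_upwards [he, he'] with i hi hi'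
    refine (hinvi i).2.1.mono (union_subset ?_ ?_)
    · exact (ball_subset_ball (min_le_left _ _)).trans hi
    · exact (ball_subset_ball (min_le_right _ _)).trans hi'
  have hφst : ∀ z ∈ Str ms, Tendsto (fun i => φ i z) 𝒰 (𝓝 (φs z)) := fun z hz => hφs.pt hz tendsto_const_nhds
  have hin' : ∀ z ∈ Str ms, ∀ᶠ i in (𝒰 : Filter ι), z ∈ Str (m i) := fun z hz => by
    obtain ⟨ε, hε, h1, he⟩ := hD' z hz
    exact he.mono fun i hi => hi (mem_ball_self hε)
  have hφse : Eqv φs (Str ms) := fun z hz => by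
    refine tendsto_nhds_unique (hφst _ ((per_Str z).1 hz)) (((hφst z hz).add_const tp).congr' ?_)
    filter_upwards [hin' z hz] with i hi
    exact ((hinvi i).2.2.2.1 z hi).symm
  have hφso : IsOpen (φs '' Str ms) := inj_isOpen isOpen_Str hφsd hφsi isOpen_Str subset_rfl
  have hφs1 : φs '' Str ms ⊆ Str 1 := by
    refine open_sub_Str hφso ?_
    rintro _ ⟨z, hz, rfl⟩
    refine le_of_tendsto (((continuous_abs.comp Complex.continuous_im).tendsto _).comp (hφst z hz)) ?_
    filter_upwards [hin' z hz] with i hi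
    exact (show _ < (1:ℝ) from hφ1 i hi).le
  have hφsU : MapsTo φs (Str ms) U0 := by
    have h1 : Fi0 '' (φs '' Str ms) ⊆ Str r0 := by
      refine open_sub_Str (hS0.symm.isOpen hφs1 hφso) ?_
      rintro _ ⟨_, ⟨w, hw, rfl⟩, rfl⟩
      have := hFi.pt (hφs1 (mem_image_of_mem _ hw)) (hφst w hw)
      refine le_of_tendsto_of_tendsto (((continuous_abs.comp Complex.continuous_im).tendsto _).comp this) hrt ?_
      filter_upwards [hin' w hw] with i hi
      have h2 := (hinvi i).2.2.1 hi
      rw [(hS i).image (hs i)] at h2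
      exact (show _ < r i from h2.2).le
    intro w hw
    rw [hU0, hS0.image hs0]
    exact ⟨hφs1 (mem_image_of_mem _ hw), h1 (mem_image_of_mem _ (mem_image_of_mem _ hw))⟩
  have hκφ : ∀ w ∈ Str ms, κ (φs w) = w := fun w hw =>
    hφsi (hκm (mem_image_of_mem _ (hφsU hw))) hw (hφκ _ (hφsU hw))
  have hNk : NU F0 r0 ms κ := by
    refine ⟨hms0, hκd, hκi, ?_, hκe, ?_⟩
    · refine hκm.antisymm fun w hw => ⟨φs w, hφsU hw, hκφ w hw⟩
    · have t : ∀ y : ℝ, Tendsto (fun i => (h i (F i y)).re) 𝒰 (𝓝 (κ (F0 y)).re) := fun y =>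
        (Complex.continuous_re.tendsto _).comp (hκ.pt (mem_image_of_mem _ (zero_mem_Str hr0 y))
          (hF.pt (zero_mem_Str one_pos y) tendsto_const_nhds))
      have t2 := (t 0).add (t π)
      simp only [Complex.ofReal_zero] at t2
      exact tendsto_nhds_unique t2 (tendsto_const_nhds.congr fun i => ((hN i).n).symm)
  obtain ⟨e1, e2⟩ := hNk.uniq hS0 hr0 hr1 hN0
  subst e1
  refine ⟨hmt, fun z hz => by rw [← e2 hz]; exact hκ z hz, fun w hw => ?_⟩
  have : φ0 w = φs w := by
    rw [← hN0.im] at hw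
    obtain ⟨z, hz, rfl⟩ := hw
    rw [hφ0 z hz, ← e2 hz, hφκ z hz]
  rw [this]; exact hφs w hw
noncomputable def sc (r : ℝ) (z : ℂ) : ℂ := z.re + (r * z.im : ℝ) * Complex.I
@[simp] theorem sc_re (r : ℝ) (z : ℂ) : (sc r z).re = z.re := by simp [sc]
@[simp] theorem sc_im (r : ℝ) (z : ℂ) : (sc r z).im = r * z.im := by simp [sc]
theorem sc_sc (r s : ℝ) (z : ℂ) : sc r (sc s z) = sc (r * s) z := by
  apply Complex.ext <;> simp [mul_assoc]
theorem sc_one (z : ℂ) : sc 1 z = z := by apply Complex.ext <;> simp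
theorem sc_cont : Continuous (fun p : ℝ × ℂ => sc p.1 p.2) := by
  unfold sc; fun_prop
theorem sc_tp (r : ℝ) (z : ℂ) : sc r (z + tp) = sc r z + tp := by
  apply Complex.ext <;> simp
theorem sc_real (r x : ℝ) : sc r x = x := by apply Complex.ext <;> simp
theorem sc_mem {r m : ℝ} (hr : 0 < r) {z : ℂ} : sc r z ∈ Str (r * m) ↔ z ∈ Str m := by
  simp only [Str, mem_ofPred_eq, sc_im, abs_mul, abs_of_pos hr]
  exact mul_lt_mul_iff_right₀ hr
theorem sc_mem1 {r : ℝ} (hr : 0 < r) {z : ℂ} : sc r z ∈ Str r ↔ z ∈ Str 1 := by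
  have := sc_mem (m := 1) hr (z := z); rwa [mul_one] at this
theorem sc_inv_mem {r : ℝ} (hr : 0 < r) {z : ℂ} : sc r⁻¹ z ∈ Str 1 ↔ z ∈ Str r := by
  have := sc_mem (m := r) (inv_pos.2 hr) (z := z); rwa [inv_mul_cancel₀ hr.ne'] at this
open Classical in
noncomputable def mU (F : ℂ → ℂ) (r : ℝ) : ℝ :=
  if h : ∃ m f, NU F r m f then h.choose else 1
open Classical in
noncomputable def hU (F : ℂ → ℂ) (r : ℝ) : ℂ → ℂ :=
  if h : ∃ m f, NU F r m f then h.choose_spec.choose else id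
noncomputable def pU (F : ℂ → ℂ) (r : ℝ) : ℂ → ℂ := Function.invFunOn (hU F r) (F '' Str r)
noncomputable def GU (F : ℂ → ℂ) (r : ℝ) (z : ℂ) : ℂ := sc (mU F r)⁻¹ (hU F r (F (sc r z)))
noncomputable def GiU (F Fi : ℂ → ℂ) (r : ℝ) (z : ℂ) : ℂ := sc r⁻¹ (Fi (pU F r (sc (mU F r) z)))
theorem SH.nu {F Fi : ℂ → ℂ} (h : SH F Fi) {r : ℝ} (h0 : 0 < r) (h1 : r ≤ 1) :
    NU F r (mU F r) (hU F r) := by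
  have he := h.exists_NU h0 h1
  rw [mU, hU, dif_pos he, dif_pos he]
  exact he.choose_spec.choose_spec
theorem pU_h {F Fi : ℂ → ℂ} (h : SH F Fi) {r : ℝ} (h0 : 0 < r) (h1 : r ≤ 1) :
    ∀ z ∈ F '' Str r, pU F r (hU F r z) = z :=
  fun _ hz => (h.nu h0 h1).i.leftInvOn_invFunOn hz
theorem SH.G {F Fi : ℂ → ℂ} (h : SH F Fi) {r : ℝ} (h0 : 0 < r) (h1 : r ≤ 1) :
    SH (GU F r) (GiU F Fi r) := by
  have hN := h.nu h0 h1
  have hs := Str_mono h1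
  obtain ⟨a, b, c, d, e⟩ := hN.inv h h1 (pU_h h h0 h1)
  have m1 : MapsTo (sc r) (Str 1) (Str r) := fun z hz => (sc_mem1 h0).2 hz
  have m2 : MapsTo F (Str r) (F '' Str r) := mapsTo_image _ _
  have m3 : MapsTo (hU F r) (F '' Str r) (Str (mU F r)) := by
    intro z hz; rw [← hN.im]; exact mem_image_of_mem _ hz
  have m4 : MapsTo (sc (mU F r)⁻¹) (Str (mU F r)) (Str 1) := fun z hz => (sc_inv_mem hN.pos).2 hz
  have n1 : MapsTo (sc (mU F r)) (Str 1) (Str (mU F r)) := fun z hz => (sc_mem1 hN.pos).2 hz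
  have hU1 : F '' Str r ⊆ Str 1 := by rintro _ ⟨z, hz, rfl⟩; exact h.mF (hs hz)
  have n3 : MapsTo Fi (F '' Str r) (Str r) := by
    rintro _ ⟨z, hz, rfl⟩; rw [h.l z (hs hz)]; exact hz
  have n4 : MapsTo (sc r⁻¹) (Str r) (Str 1) := fun z hz => (sc_inv_mem h0).2 hz
  have cs : ∀ t, Continuous (sc t) := fun t => sc_cont.comp (by fun_prop : Continuous fun z : ℂ => (t, z))
  refine ⟨?_, ?_, ?_, ?_, ?_, ?_, ?_⟩
  · exact (cs _).comp_continuousOn (hN.d.continuousOn.comp ((h.cF.mono hs).comp (cs _).continuousOn m1) (m2.comp m1))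
  · exact (cs _).comp_continuousOn ((h.cI.mono hU1).comp (a.continuousOn.comp (cs _).continuousOn n1) (c.comp n1))
  · exact m4.comp (m3.comp (m2.comp m1))
  · exact n4.comp (n3.comp (c.comp n1))
  · intro z hz
    have k1 := m2 (m1 hz)
    simp only [GU, GiU]
    rw [sc_sc, mul_inv_cancel₀ hN.pos.ne', sc_one, pU_h h h0 h1 _ k1, h.l _ (hs (m1 hz)), sc_sc,
      inv_mul_cancel₀ h0.ne', sc_one]
  · intro z hz
    have k1 := c (n1 hz)
    simp only [GU, GiU]
    rw [sc_sc, mul_inv_cancel₀ h0.ne', sc_one, h.r _ (hU1 k1), e _ (n1 hz), sc_sc,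
      inv_mul_cancel₀ hN.pos.ne', sc_one]
  · intro z hz
    simp only [GU]
    rw [sc_tp, h.e _ (hs (m1 hz)), hN.e _ (m2 (m1 hz)), sc_tp]
theorem SH.G_norm {F Fi : ℂ → ℂ} (h : SH F Fi) {r : ℝ} (h0 : 0 < r) (h1 : r ≤ 1) :
    (GU F r 0).re + (GU F r π).re = π := by
  have := (h.nu h0 h1).n
  have e : sc r 0 = 0 := by simpa using sc_real r 0
  simp only [GU, sc_re, sc_real, e]; exact this
theorem SH.G_eq {F Fi : ℂ → ℂ} (h : SH F Fi) {r : ℝ} (h0 : 0 < r) (h1 : r ≤ 1) {m : ℝ} {f : ℂ → ℂ}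
    (hf : NU F r m f) {z : ℂ} (hz : z ∈ Str 1) : GU F r z = sc m⁻¹ (f (F (sc r z))) := by
  obtain ⟨e1, e2⟩ := (h.nu h0 h1).uniq h h0 h1 hf
  rw [GU, e1, e2 (mem_image_of_mem _ ((sc_mem1 h0).2 hz))]
theorem SH.G_one {F Fi : ℂ → ℂ} (h : SH F Fi) (hn : (F 0).re + (F π).re = π)
    {z : ℂ} (hz : z ∈ Str 1) : GU F 1 z = F z := by
  have him : F '' Str 1 = Str 1 := by
    rw [h.image subset_rfl]; exact inter_eq_left.2 h.mI
  have : NU F 1 1 id := by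
    refine ⟨one_pos, differentiableOn_id, injOn_id _, ?_, fun _ _ => rfl, hn⟩
    rw [him, image_id]
  rw [h.G_eq one_pos le_rfl this hz, inv_one, sc_one, sc_one, id]
theorem SH.G_id {F Fi : ℂ → ℂ} (h : SH F Fi) {r : ℝ} (h0 : 0 < r) (h1 : r ≤ 1) (hF : ∀ z ∈ Str 1, F z = z)
    {z : ℂ} (hz : z ∈ Str 1) : GU F r z = z := by
  have him : F '' Str r = Str r := by
    rw [image_congr (g := id) fun z hz => hF z (Str_mono h1 hz), image_id]
  have : NU F r r id := by
    refine ⟨h0, differentiableOn_id, injOn_id _, ?_, fun _ _ => rfl, ?_⟩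
    · rw [him, image_id]
    · rw [hF _ (zero_mem_Str one_pos _), show (0:ℂ) = ((0:ℝ):ℂ) by simp, hF _ (zero_mem_Str one_pos _)]
      simp
  rw [h.G_eq h0 h1 this hz, hF _ (Str_mono h1 ((sc_mem1 h0).2 hz)), id, sc_sc, inv_mul_cancel₀ h0.ne', sc_one]
noncomputable def sg (z : ℂ) : ℂ := conj z + π
noncomputable def sgi (z : ℂ) : ℂ := conj z - π
theorem sg_sgi (z : ℂ) : sg (sgi z) = z := by simp [sg, sgi]
theorem sgi_sg (z : ℂ) : sgi (sg z) = z := by simp [sg, sgi]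
theorem sg_mem {r : ℝ} {z : ℂ} : sg z ∈ Str r ↔ z ∈ Str r := by simp [sg, Str]
theorem sgi_mem {r : ℝ} {z : ℂ} : sgi z ∈ Str r ↔ z ∈ Str r := by simp [sgi, Str]
theorem sg_tp (z : ℂ) : sg (z + tp) = sg z + tp := by
  apply Complex.ext <;> simp [sg]; ring
theorem sgi_tp (z : ℂ) : sgi (z + tp) = sgi z + tp := by
  apply Complex.ext <;> simp [sgi]; ring
theorem sg_sc (r : ℝ) (z : ℂ) : sg (sc r z) = sc r (sg z) := by
  apply Complex.ext <;> simp [sg]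
theorem sgi_sc (r : ℝ) (z : ℂ) : sgi (sc r z) = sc r (sgi z) := by
  apply Complex.ext <;> simp [sgi]
theorem SH.G_sg {F Fi F' Fi' : ℂ → ℂ} (h : SH F Fi) (h' : SH F' Fi') {r : ℝ} (h0 : 0 < r) (h1 : r ≤ 1)
    (hF : ∀ z ∈ Str 1, F' z = sgi (F (sg z))) {z : ℂ} (hz : z ∈ Str 1) :
    GU F' r z = sgi (GU F r (sg z)) := by
  have hN := h.nu h0 h1
  have hs := Str_mono h1
  have hmem : ∀ w, w ∈ F' '' Str r ↔ sg w ∈ F '' Str r := by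
    intro w
    constructor
    · rintro ⟨z, hz, rfl⟩
      exact ⟨sg z, sg_mem.2 hz, by rw [hF z (hs hz), sg_sgi]⟩
    · rintro ⟨z, hz, he⟩
      refine ⟨sgi z, sgi_mem.2 hz, ?_⟩
      rw [hF _ (hs (sgi_mem.2 hz)), sg_sgi, he, sgi_sg]
  have : NU F' r (mU F r) (fun w => sgi (hU F r (sg w))) := by
    refine ⟨hN.pos, ?_, ?_, ?_, ?_, ?_⟩
    · have hd : DifferentiableOn ℂ (fun w => hU F r (w + π)) {w | w + π ∈ F '' Str r} :=
        hN.d.comp (by fun_prop) fun w hw => hw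
      have hUo : IsOpen {w : ℂ | w + π ∈ F '' Str r} :=
        (h.isOpen hs isOpen_Str).preimage (by fun_prop : Continuous fun w : ℂ => w + π)
      intro w hw
      have hw' : conj w ∈ {w : ℂ | w + π ∈ F '' Str r} := (hmem w).1 hw
      have := (hd.differentiableAt (hUo.mem_nhds hw')).conj_conj
      rw [Complex.conj_conj] at this
      exact (this.sub_const _).differentiableWithinAt
    · intro z hz w hw hzw
      have h2 := congrArg sg hzw
      simp only [sg_sgi] at h2
      have h3 := congrArg sgi (hN.i ((hmem z).1 hz) ((hmem w).1 hw) h2)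
      rwa [sgi_sg, sgi_sg] at h3
    · ext w
      constructor
      · rintro ⟨z, hz, rfl⟩
        refine sgi_mem.2 ?_
        rw [← hN.im]; exact mem_image_of_mem _ ((hmem z).1 hz)
      · intro hw
        have : sg w ∈ Str (mU F r) := sg_mem.2 hw
        rw [← hN.im] at this
        obtain ⟨z, hz, he⟩ := this
        refine ⟨sgi z, (hmem _).2 (by rwa [sg_sgi]), ?_⟩
        simp only [sg_sgi, he, sgi_sg]
    · intro z hz
      simp only
      rw [sg_tp, hN.e _ ((hmem z).1 hz), sgi_tp]
    · have hn := hN.n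
      have e0 : F' 0 = sgi (F π) := by
        have := hF ((0:ℝ):ℂ) (zero_mem_Str one_pos _)
        simpa [sg] using this
      have e1 : F' π = sgi (F 0 + tp) := by
        rw [hF _ (zero_mem_Str one_pos _)]
        have h2 := h.e ((0:ℝ):ℂ) (zero_mem_Str one_pos _)
        simp only [Complex.ofReal_zero] at h2
        rw [← h2]; congr 2
        simp [sg, tp]; ring
      rw [e0, e1, sg_sgi, sg_sgi, hN.e _ ⟨0, by simpa using zero_mem_Str h0 0, rfl⟩]
      simp only [sgi, Complex.sub_re, Complex.conj_re, Complex.ofReal_re, Complex.add_re, tp_re]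
      linarith
  rw [h'.G_eq h0 h1 this hz, hF _ (hs ((sc_mem1 h0).2 hz)), sg_sgi, ← sgi_sc, GU, sg_sc]
structure CF {P : Type*} [TopologicalSpace P] (F Fi : P → ℂ → ℂ) : Prop where
  sh : ∀ p, SH (F p) (Fi p)
  c : ContinuousOn (fun q : P × ℂ => F q.1 q.2) (univ ×ˢ Str 1)
  ci : ContinuousOn (fun q : P × ℂ => Fi q.1 q.2) (univ ×ˢ Str 1)
theorem CF.symm {P : Type*} [TopologicalSpace P] {F Fi : P → ℂ → ℂ} (h : CF F Fi) : CF Fi F :=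
  ⟨fun p => (h.sh p).symm, h.ci, h.c⟩
theorem CF.comp {P Q : Type*} [TopologicalSpace P] [TopologicalSpace Q] {F Fi : P → ℂ → ℂ} (h : CF F Fi)
    {g : Q → P} (hg : Continuous g) : CF (fun q => F (g q)) (fun q => Fi (g q)) :=
  ⟨fun p => h.sh _, h.c.comp (by fun_prop : Continuous fun q : Q × ℂ => (g q.1, q.2)).continuousOn
    (fun _ hq => ⟨trivial, hq.2⟩), h.ci.comp (by fun_prop : Continuous fun q : Q × ℂ => (g q.1, q.2)).continuousOn
    (fun _ hq => ⟨trivial, hq.2⟩)⟩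
theorem CF.at {P : Type*} [TopologicalSpace P] {F Fi : P → ℂ → ℂ} (h : CF F Fi) (p : P) {z : ℂ} (hz : z ∈ Str 1) :
    ContinuousAt (fun q : P × ℂ => F q.1 q.2) (p, z) :=
  h.c.continuousAt ((isOpen_univ.prod isOpen_Str).mem_nhds ⟨trivial, hz⟩)
theorem CF.cconv {P ι : Type*} [TopologicalSpace P] {F Fi : P → ℂ → ℂ} (h : CF F Fi) {l : Filter ι}
    {p : ι → P} {p0 : P} (hp : Tendsto p l (𝓝 p0)) : CConv l (fun i => F (p i)) (F p0) (Str 1) := by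
  intro z hz
  have := h.at p0 hz
  rw [ContinuousAt, nhds_prod_eq] at this
  exact this.comp (hp.prodMap tendsto_id)
theorem CF.G {P : Type*} [TopologicalSpace P] {F Fi : P → ℂ → ℂ} (h : CF F Fi) {r : P → ℝ}
    (hr : Continuous r) (h0 : ∀ p, 0 < r p) (h1 : ∀ p, r p ≤ 1) :
    CF (fun p => GU (F p) (r p)) (fun p => GiU (F p) (Fi p) (r p)) ∧
    Continuous fun p => mU (F p) (r p) := by
  have sct : ∀ {ι : Type _} {l : Filter ι} {t : ι → ℝ} {t0 : ℝ} {z : ι → ℂ} {z0 : ℂ},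
      Tendsto t l (𝓝 t0) → Tendsto z l (𝓝 z0) → Tendsto (fun i => sc (t i) (z i)) l (𝓝 (sc t0 z0)) :=
    fun ht hz => (sc_cont.tendsto (_, _)).comp (ht.prodMk_nhds hz)
  have key : ∀ {ι : Type _} (𝒰 : Ultrafilter ι) {p : ι → P} {p0 : P}, Tendsto p 𝒰 (𝓝 p0) → _ :=
    fun {ι} 𝒰 {p p0} hp => unif_limit 𝒰 (fun i => h.sh (p i)) (h.sh p0) (h.cconv hp) (h.symm.cconv hp)
      (r := fun i => r (p i)) (fun i => ⟨h0 (p i), h1 (p i)⟩) (h0 p0) (h1 p0) ((hr.tendsto p0).comp hp)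
      (fun i => (h.sh (p i)).nu (h0 _) (h1 _)) (fun i => pU_h (h.sh (p i)) (h0 _) (h1 _))
      ((h.sh p0).nu (h0 _) (h1 _)) (pU_h (h.sh p0) (h0 _) (h1 _))
  refine ⟨⟨fun p => (h.sh p).G (h0 p) (h1 p), ?_, ?_⟩, ?_⟩
  · rintro ⟨p0, z0⟩ ⟨-, hz⟩
    apply ContinuousAt.continuousWithinAt
    rw [ContinuousAt, tendsto_iff_ultrafilter]
    intro 𝒰 h𝒰
    have hp : Tendsto (fun q : P × ℂ => q.1) 𝒰 (𝓝 p0) := (continuous_fst.tendsto (p0, z0)).mono_left h𝒰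
    have hz' : Tendsto (fun q : P × ℂ => q.2) 𝒰 (𝓝 z0) := (continuous_snd.tendsto (p0, z0)).mono_left h𝒰
    obtain ⟨k1, k2, k3⟩ := key 𝒰 hp
    have hz1 : sc (r p0) z0 ∈ Str (r p0) := (sc_mem1 (h0 p0)).2 hz
    refine sct (k1.inv₀ ((h.sh p0).nu (h0 _) (h1 _)).pos.ne') (k2.pt (mem_image_of_mem _ hz1) ?_)
    exact (h.cconv hp).pt (Str_mono (h1 p0) hz1) (sct ((hr.tendsto p0).comp hp) hz')
  · rintro ⟨p0, z0⟩ ⟨-, hz⟩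
    apply ContinuousAt.continuousWithinAt
    rw [ContinuousAt, tendsto_iff_ultrafilter]
    intro 𝒰 h𝒰
    have hp : Tendsto (fun q : P × ℂ => q.1) 𝒰 (𝓝 p0) := (continuous_fst.tendsto (p0, z0)).mono_left h𝒰
    have hz' : Tendsto (fun q : P × ℂ => q.2) 𝒰 (𝓝 z0) := (continuous_snd.tendsto (p0, z0)).mono_left h𝒰
    obtain ⟨k1, k2, k3⟩ := key 𝒰 hp
    have hN := (h.sh p0).nu (h0 p0) (h1 p0)
    have hz1 : sc (mU (F p0) (r p0)) z0 ∈ Str (mU (F p0) (r p0)) := (sc_mem1 hN.pos).2 hz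
    refine sct (((hr.tendsto p0).comp hp).inv₀ (h0 p0).ne') ((h.symm.cconv hp).pt ?_ (k3.pt hz1 (sct k1 hz')))
    obtain ⟨w, hw, he⟩ := (hN.inv (h.sh p0) (h1 p0) (pU_h (h.sh p0) (h0 p0) (h1 p0))).2.2.1 hz1
    rw [← he]; exact (h.sh p0).mF (Str_mono (h1 p0) hw)
  · rw [continuous_iff_continuousAt]
    intro p0
    rw [ContinuousAt, tendsto_iff_ultrafilter]
    intro 𝒰 h𝒰
    exact (key 𝒰 (p := id) h𝒰).1
def NP (F : ℂ → ℂ) : Prop := ∀ A ⊆ Str 1, volume A = 0 → volume (F '' A) = 0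
theorem diff_null {f : ℂ → ℂ} {A : Set ℂ} (hf : DifferentiableOn ℂ f A) (h : volume A = 0) :
    volume (f '' A) = 0 :=
  addHaar_image_eq_zero_of_differentiableOn_of_addHaar_eq_zero volume
    (fun z hz => (hf z hz).restrictScalars ℝ) h
theorem sc_null (r : ℝ) {A : Set ℂ} (h : volume A = 0) : volume (sc r '' A) = 0 := by
  refine addHaar_image_eq_zero_of_differentiableOn_of_addHaar_eq_zero volume
    (Differentiable.differentiableOn ?_) h
  have : sc r = fun z : ℂ => ((Complex.reCLM z : ℝ) : ℂ) + ((r * Complex.imCLM z : ℝ) : ℂ) * Complex.I := by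
    ext z; simp [sc]
  rw [this]
  have h1 : Differentiable ℝ (fun x : ℝ => (x : ℂ)) := Complex.ofRealCLM.differentiable
  exact (h1.comp Complex.reCLM.differentiable).add
    ((h1.comp ((differentiable_const r).mul Complex.imCLM.differentiable)).mul_const _)
theorem SH.G_null {F Fi : ℂ → ℂ} (h : SH F Fi) {r : ℝ} (h0 : 0 < r) (h1 : r ≤ 1) (hF : NP F) :
    NP (GU F r) := fun A hA h2 => by
  have hN := h.nu h0 h1
  have m1 : sc r '' A ⊆ Str r := by rintro _ ⟨z, hz, rfl⟩; exact (sc_mem1 h0).2 (hA hz)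
  have := sc_null (mU F r)⁻¹ (diff_null (hN.d.mono (image_mono m1))
    (hF _ (m1.trans (Str_mono h1)) (sc_null r h2)))
  simp only [image_image] at this; exact this
theorem SH.Gi_null {F Fi : ℂ → ℂ} (h : SH F Fi) {r : ℝ} (h0 : 0 < r) (h1 : r ≤ 1) (hF : NP Fi) :
    NP (GiU F Fi r) := fun A hA h2 => by
  have hN := h.nu h0 h1
  obtain ⟨a, b, c, d, e⟩ := hN.inv h h1 (pU_h h h0 h1)
  have m1 : sc (mU F r) '' A ⊆ Str (mU F r) := by
    rintro _ ⟨z, hz, rfl⟩; exact (sc_mem1 hN.pos).2 (hA hz)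
  have m2 : pU F r '' (sc (mU F r) '' A) ⊆ Str 1 := by
    rintro _ ⟨z, hz, rfl⟩
    obtain ⟨w, hw, he⟩ := c (m1 hz)
    rw [← he]; exact h.mF (Str_mono h1 hw)
  have := sc_null r⁻¹ (hF _ m2 (diff_null (a.mono m1) (sc_null _ h2)))
  simp only [image_image] at this; exact this
theorem im_tp (z : ℂ) (k : ℤ) : (z + k * tp).im = z.im := by simp
theorem re_tp (z : ℂ) (k : ℤ) : (z + k * tp).re = z.re + k * (2 * π) := by simp
theorem tube {P : Type*} [TopologicalSpace P] {p0 : P} {b : ℝ} {R : P → ℂ → Prop}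
    (hper : ∀ p z, |z.im| ≤ b → ∀ k : ℤ, R p (z + k * tp) → R p z)
    (hR : ∀ z, |z.im| ≤ b → ∀ᶠ q in 𝓝 (p0, z), R q.1 q.2) :
    ∀ᶠ p in 𝓝 p0, ∀ z, |z.im| ≤ b → R p z := by
  have hK : IsCompact (Icc 0 (2 * π) ×ℂ Icc (-b) b) := isCompact_Icc.reProdIm isCompact_Icc
  filter_upwards [hK.eventually_forall_of_forall_eventually (fun z hz => hR z (abs_le.2 hz.2))] with p hp z hz
  obtain ⟨k, hk⟩ := exists_FD z
  refine hper p z hz k (hp _ ⟨⟨hk.1.le, hk.2⟩, ?_⟩)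
  rw [mem_preimage, im_tp]; exact abs_le.1 hz
theorem mem_Str_of {b : ℝ} (hb : b < 1) {z : ℂ} (h : |z.im| ≤ b) : z ∈ Str 1 := h.trans_lt hb
theorem CF.ends {P : Type*} [TopologicalSpace P] {G Gi : P → ℂ → ℂ} (h : CF G Gi) (p0 : P) {e : ℝ} (he : e < 1) :
    ∃ c, 0 < c ∧ c < 1 ∧ ∀ᶠ p in 𝓝 p0, ∀ z ∈ Str 1, c ≤ |z.im| → e < |(G p z).im| := by
  obtain ⟨c, hc0, hc1, hc⟩ : ∃ c, 0 < c ∧ c < 1 ∧ ∀ z, |z.im| ≤ e → |(Gi p0 z).im| < c := by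
    have hK : IsCompact (Icc 0 (2 * π) ×ℂ Icc (-e) e) := isCompact_Icc.reProdIm isCompact_Icc
    have hs : (Icc 0 (2 * π) ×ℂ Icc (-e) e) ⊆ Str 1 := fun z hz => mem_Str_of he (abs_le.2 hz.2)
    obtain ⟨c, hc1, hc⟩ : ∃ c, c < 1 ∧ ∀ z ∈ (Icc 0 (2 * π) ×ℂ Icc (-e) e), |(Gi p0 z).im| ≤ c := by
      rcases (Icc 0 (2 * π) ×ℂ Icc (-e) e).eq_empty_or_nonempty with h0 | h0
      · exact ⟨0, one_pos, by simp [h0]⟩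
      · obtain ⟨w, hw, hm⟩ := hK.exists_isMaxOn h0
          ((continuous_abs.comp Complex.continuous_im).comp_continuousOn ((h.sh p0).cI.mono hs))
        exact ⟨_, (h.sh p0).mI (hs hw), fun z hz => hm hz⟩
    refine ⟨max ((c + 1) / 2) (1 / 2), by positivity, max_lt (by linarith) (by norm_num), fun z hz => ?_⟩
    obtain ⟨k, hk⟩ := exists_FD z
    have := hc (z + k * tp) ⟨⟨hk.1.le, hk.2⟩, by rw [mem_preimage, im_tp]; exact abs_le.1 hz⟩
    rw [(h.sh p0).ei.int per_Str k (mem_Str_of he hz), im_tp] at this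
    exact (this.trans_lt (by linarith)).trans_le (le_max_left _ _)
  refine ⟨c, hc0, hc1, ?_⟩
  have := tube (p0 := p0) (b := e) (R := fun p z => |(Gi p z).im| < c) (fun p z hz k hk => by
    rwa [(h.sh p).ei.int per_Str k (mem_Str_of he hz), im_tp] at hk) (fun z hz =>
      ((continuous_abs.comp Complex.continuous_im).continuousAt.comp (h.symm.at p0 (mem_Str_of he hz))).eventually_lt
        continuousAt_const (hc z hz))
  filter_upwards [this] with p hp z hz hcz
  by_contra hn
  have := hp _ (not_lt.1 hn)
  rw [(h.sh p).l z hz] at this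
  linarith
theorem sgn_const {f : ℂ → ℝ} {S : Set ℂ} (hS : IsPreconnected S) (hf : ContinuousOn f S) {e : ℝ} (he : 0 ≤ e)
    (h : ∀ z ∈ S, e < |f z|) {z0 : ℂ} (h0 : z0 ∈ S) (hp : 0 < f z0) : ∀ z ∈ S, e < f z := by
  intro z hz
  by_contra hn
  have h1 : f z ≤ 0 := by
    by_contra h2
    have := h z hz
    rw [abs_of_pos (not_le.1 h2)] at this
    exact hn this
  obtain ⟨w, hw, hw0⟩ := hS.intermediate_value hz h0 hf ⟨h1, hp.le⟩
  have := h w hw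
  rw [hw0, abs_zero] at this
  linarith
def U2 (G : ℂ → ℂ) : Prop := ∃ c, 0 < c ∧ c < 1 ∧ ∀ z ∈ Str 1,
  (c ≤ z.im → 0 < (G z).im) ∧ (z.im ≤ -c → (G z).im < 0)
def Up (c : ℝ) : Set ℂ := {z | c ≤ z.im ∧ z.im < 1}
def Dn (c : ℝ) : Set ℂ := {z | -1 < z.im ∧ z.im ≤ -c}
theorem Up_conn (c : ℝ) : IsPreconnected (Up c) :=
  ((convex_halfSpace_im_ge c).inter (convex_halfSpace_im_lt 1)).isPreconnected
theorem Dn_conn (c : ℝ) : IsPreconnected (Dn c) :=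
  ((convex_halfSpace_im_gt (-1)).inter (convex_halfSpace_im_le (-c))).isPreconnected
theorem Up_sub {c : ℝ} (h : 0 < c) : Up c ⊆ Str 1 := fun _ hz => abs_lt.2 ⟨by linarith [hz.1], hz.2⟩
theorem Dn_sub {c : ℝ} (h : 0 < c) : Dn c ⊆ Str 1 := fun _ hz => abs_lt.2 ⟨hz.1, by linarith [hz.2]⟩
noncomputable def ic (c : ℝ) : ℂ := c * Complex.I
@[simp] theorem ic_im (c : ℝ) : (ic c).im = c := by simp [ic]
theorem ic_Up {c : ℝ} (h1 : c < 1) : ic c ∈ Up c := ⟨by simp, by simpa⟩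
theorem ic_Dn {c : ℝ} (h1 : c < 1) : ic (-c) ∈ Dn c := ⟨by simpa, by simp⟩
theorem SH.sgn {G Gi : ℂ → ℂ} (h : SH G Gi) {c e : ℝ} (hc : 0 < c) (hc1 : c < 1) (he : 0 ≤ e)
    (hE : ∀ z ∈ Str 1, c ≤ |z.im| → e < |(G z).im|) :
    (0 < (G (ic c)).im → ∀ z ∈ Up c, e < (G z).im) ∧ (0 < (G (ic (-c))).im → ∀ z ∈ Dn c, e < (G z).im) ∧
    (0 < -(G (ic c)).im → ∀ z ∈ Up c, e < -(G z).im) ∧ (0 < -(G (ic (-c))).im → ∀ z ∈ Dn c, e < -(G z).im) := by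
  have hcont := Complex.continuous_im.comp_continuousOn h.cF
  have hU : ∀ z ∈ Up c, e < |(G z).im| := fun z hz => hE z (Up_sub hc hz) (hz.1.trans (le_abs_self _))
  have hD : ∀ z ∈ Dn c, e < |(G z).im| := fun z hz => hE z (Dn_sub hc hz)
    ((le_neg.1 hz.2).trans (neg_le_abs _))
  exact ⟨sgn_const (Up_conn c) (hcont.mono (Up_sub hc)) he hU (ic_Up hc1),
    sgn_const (Dn_conn c) (hcont.mono (Dn_sub hc)) he hD (ic_Dn hc1),
    sgn_const (Up_conn c) (hcont.mono (Up_sub hc)).neg he (by simpa using hU) (ic_Up hc1),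
    sgn_const (Dn_conn c) (hcont.mono (Dn_sub hc)).neg he (by simpa using hD) (ic_Dn hc1)⟩
theorem CF.im_at {P : Type*} [TopologicalSpace P] {G Gi : P → ℂ → ℂ} (h : CF G Gi) (p0 : P) {z : ℂ} (hz : z ∈ Str 1) :
    ContinuousAt (fun p => (G p z).im) p0 :=
  Complex.continuous_im.continuousAt.comp
    (ContinuousAt.comp (x := p0) (f := fun p => (p, z)) (h.at p0 hz) (by fun_prop))
theorem CF.UF {P : Type*} [TopologicalSpace P] {G Gi : P → ℂ → ℂ} (h : CF G Gi) {p0 : P} (hU : U2 (G p0))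
    {e : ℝ} (he : e < 1) : ∃ c, 0 < c ∧ c < 1 ∧ ∀ᶠ p in 𝓝 p0, ∀ z ∈ Str 1,
      (c ≤ z.im → e < (G p z).im) ∧ (z.im ≤ -c → (G p z).im < -e) := by
  obtain ⟨c1, h0, h1, h2⟩ := h.ends p0 (max_lt he one_pos)
  obtain ⟨c2, h0', h1', h2'⟩ := hU
  have hm0 : 0 < max c1 c2 := lt_max_of_lt_left h0
  have hm1 : max c1 c2 < 1 := max_lt h1 h1'
  have a1 := (h2' (ic (max c1 c2)) (Up_sub hm0 (ic_Up hm1))).1 (by simp)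
  have a2 := (h2' (ic (-max c1 c2)) (Dn_sub hm0 (ic_Dn hm1))).2 (by
    rw [ic_im]; linarith [le_max_right c1 c2])
  refine ⟨_, hm0, hm1, ?_⟩
  filter_upwards [h2, continuousAt_const.eventually_lt (h.im_at p0 (Up_sub hm0 (ic_Up hm1))) a1,
    (h.im_at p0 (Dn_sub hm0 (ic_Dn hm1))).eventually_lt continuousAt_const a2] with p k1 k2 k3 z hz
  obtain ⟨s1, -, -, s2⟩ := (h.sh p).sgn hm0 hm1 (le_max_right e 0)
    (fun z hz hh => k1 z hz ((le_max_left _ _).trans hh))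
  have hz' : -1 < z.im ∧ z.im < 1 := abs_lt.1 hz
  constructor
  · intro hh; exact (le_max_left _ _).trans_lt (s1 k2 z ⟨hh, hz'.2⟩)
  · intro hh
    have := s2 (by linarith) z ⟨hz'.1, hh⟩
    linarith [le_max_left e 0]
theorem CF.U2_all {P : Type*} [TopologicalSpace P] [PreconnectedSpace P] {G Gi : P → ℂ → ℂ} (h : CF G Gi)
    {p1 : P} (h1 : U2 (G p1)) (p : P) : U2 (G p) := by
  have hcl : IsClopen {p | U2 (G p)} := by
    constructor
    · rw [← isOpen_compl_iff, isOpen_iff_mem_nhds]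
      intro p0 hp0
      obtain ⟨c, c0, c1, hc⟩ := h.ends p0 (e := 0) one_pos
      have hS := (h.sh p0).sgn c0 c1 le_rfl hc.self_of_nhds
      have mU := Up_sub c0 (ic_Up c1)
      have mD := Dn_sub c0 (ic_Dn c1)
      have nU := hc.self_of_nhds _ mU (by simp [le_abs_self])
      have nD := hc.self_of_nhds _ mD (by simp [le_abs_self])
      have hcase : (G p0 (ic c)).im < 0 ∨ 0 < (G p0 (ic (-c))).im := by
        by_contra hn
        push Not at hn
        refine hp0 ⟨c, c0, c1, fun z hz => ⟨fun hh => ?_, fun hh => ?_⟩⟩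
        · exact hS.1 (lt_of_le_of_ne hn.1 (abs_pos.1 nU).symm) z ⟨hh, (abs_lt.1 hz).2⟩
        · linarith [hS.2.2.2 (neg_pos.2 (lt_of_le_of_ne hn.2 (abs_pos.1 nD))) z ⟨(abs_lt.1 hz).1, hh⟩]
      rcases hcase with hh | hh
      · filter_upwards [hc, (h.im_at p0 mU).eventually_lt continuousAt_const hh] with p q1 q2
        rintro ⟨c', d0, d1, hd⟩
        have hm : max c c' < 1 := max_lt c1 d1
        have a := ((h.sh p).sgn c0 c1 le_rfl q1).2.2.1 (neg_pos.2 q2) (ic (max c c')) ⟨by simp, by simpa using ⟨c1, d1⟩⟩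
        have b := (hd (ic (max c c')) (Up_sub (lt_max_of_lt_left c0) (ic_Up hm))).1 (by simp)
        linarith
      · filter_upwards [hc, continuousAt_const.eventually_lt (h.im_at p0 mD) hh] with p q1 q2
        rintro ⟨c', d0, d1, hd⟩
        have hm : max c c' < 1 := max_lt c1 d1
        have a := ((h.sh p).sgn c0 c1 le_rfl q1).2.1 q2 (ic (-max c c')) ⟨by simpa using ⟨c1, d1⟩, by simp⟩
        have b := (hd (ic (-max c c')) (Dn_sub (lt_max_of_lt_left c0) (ic_Dn hm))).2 (by simp)
        linarith
    · rw [isOpen_iff_mem_nhds]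
      intro p0 hp0
      obtain ⟨c, c0, c1, hc⟩ := h.UF hp0 (e := 0) one_pos
      filter_upwards [hc] with p hp
      exact ⟨c, c0, c1, fun z hz => by simpa using hp z hz⟩
  have : {p | U2 (G p)} = univ := hcl.eq_univ ⟨p1, h1⟩
  exact (this ▸ mem_univ p : p ∈ {p | U2 (G p)})
theorem SH.CF {G Gi : ℂ → ℂ} (h : SH G Gi) (P : Type*) [TopologicalSpace P] :
    CF (fun _ : P => G) (fun _ : P => Gi) :=
  ⟨fun _ => h, h.cF.comp continuousOn_snd fun _ hq => hq.2, h.cI.comp continuousOn_snd fun _ hq => hq.2⟩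
theorem SH.UF {G Gi : ℂ → ℂ} (h : SH G Gi) (hU : U2 G) {e : ℝ} (he : e < 1) :
    ∃ c, 0 < c ∧ c < 1 ∧ ∀ z ∈ Str 1, (c ≤ z.im → e < (G z).im) ∧ (z.im ≤ -c → (G z).im < -e) := by
  obtain ⟨c, h0, h1, h2⟩ := (h.CF Unit).UF (p0 := ()) hU he
  exact ⟨c, h0, h1, h2.self_of_nhds⟩
theorem SH.U2_symm {G Gi : ℂ → ℂ} (h : SH G Gi) (hU : U2 G) : U2 Gi := by
  obtain ⟨c, h0, h1, h2⟩ := hU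
  obtain ⟨c', h0', h1', h2'⟩ := (h.symm.CF Unit).ends () h1
  have h3 := h2'.self_of_nhds
  refine ⟨c', h0', h1', fun z hz => ⟨fun hh => ?_, fun hh => ?_⟩⟩
  · have := h3 z hz (hh.trans (le_abs_self _))
    by_contra hn
    rw [abs_of_nonpos (not_lt.1 hn)] at this
    have := (h2 (Gi z) (h.mI hz)).2 (by linarith)
    rw [h.r z hz] at this; linarith
  · have := h3 z hz ((le_neg.1 hh).trans (neg_le_abs _))
    by_contra hn
    rw [abs_of_nonneg (not_lt.1 hn)] at this
    have := (h2 (Gi z) (h.mI hz)).1 this.le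
    rw [h.r z hz] at this; linarith
theorem SH.U2_G {F Fi : ℂ → ℂ} (h : SH F Fi) (hn : (F 0).re + (F π).re = π) (hU : U2 F)
    {r : ℝ} (h0 : 0 < r) (h1 : r ≤ 1) : U2 (GU F r) := by
  have : PreconnectedSpace (Ioc (0:ℝ) 1) := Subtype.preconnectedSpace isPreconnected_Ioc
  have := ((h.CF (Ioc (0:ℝ) 1)).G (r := fun p => p.1) continuous_subtype_val (fun p => p.2.1) (fun p => p.2.2)).1
  refine this.U2_all (p1 := ⟨1, by simp⟩) ?_ ⟨r, h0, h1⟩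
  obtain ⟨c, a, b, d⟩ := hU
  exact ⟨c, a, b, fun z hz => by simpa only [h.G_one hn hz] using d z hz⟩
theorem la_path {γ γ' : ℝ → ℂ} {s t m d : ℝ} (hst : s ≤ t) (ht : t ≤ s + 4 * m) (hm : 0 < m) (hd : 0 < d)
    (hγ : ∀ x ∈ Icc s t, HasDerivAt γ (γ' x) x) (hc : ContinuousOn γ' (Icc s t))
    (hI : ∫⁻ x in Ioc s t, ENNReal.ofReal (‖γ' x‖ ^ 2) ≤ ENNReal.ofReal (d ^ 2 / (8 * m))) :
    ‖γ t - γ s‖ < d := by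
  have hu : uIcc s t = Icc s t := uIcc_of_le hst
  have hcn := hc.norm
  have i1 : IntervalIntegrable (fun x => ‖γ' x‖ ^ 2) volume s t :=
    ContinuousOn.intervalIntegrable (by rw [hu]; exact hcn.pow 2)
  have i2 : IntervalIntegrable (fun x => ‖γ' x‖) volume s t :=
    ContinuousOn.intervalIntegrable (by rw [hu]; exact hcn)
  have e1 := intervalIntegral.integral_eq_sub_of_hasDerivAt (f := γ) (f' := γ') (a := s) (b := t)
    (by rw [hu]; exact hγ) (ContinuousOn.intervalIntegrable (by rwa [hu]))
  have e2 : ∫ x in s..t, ‖γ' x‖ ^ 2 ≤ d ^ 2 / (8 * m) := by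
    rw [intervalIntegral.integral_of_le hst, integral_eq_lintegral_of_nonneg_ae
      (Eventually.of_forall fun _ => sq_nonneg _) i1.1.aestronglyMeasurable]
    exact ENNReal.toReal_le_of_le_ofReal (by positivity) hI
  rw [← e1]
  calc ‖∫ x in s..t, γ' x‖ ≤ ∫ x in s..t, ‖γ' x‖ := intervalIntegral.norm_integral_le_integral_norm hst
    _ ≤ ∫ x in s..t, ((2 * m / d) * ‖γ' x‖ ^ 2 + d / (8 * m)) := by
        refine intervalIntegral.integral_mono_on hst i2 ((i1.const_mul _).add intervalIntegrable_const) fun x _ => ?_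
        have : 2 * m / d * ‖γ' x‖ ^ 2 + d / (8 * m) - ‖γ' x‖ = 2 * m / d * (‖γ' x‖ - d / (4 * m)) ^ 2 := by
          field_simp; ring
        have h2 : 0 ≤ 2 * m / d * (‖γ' x‖ - d / (4 * m)) ^ 2 := by positivity
        linarith
    _ = (2 * m / d) * (∫ x in s..t, ‖γ' x‖ ^ 2) + d / (8 * m) * (t - s) := by
        rw [intervalIntegral.integral_add (i1.const_mul _) intervalIntegrable_const,
          intervalIntegral.integral_const_mul, intervalIntegral.integral_const, smul_eq_mul]; ring
    _ ≤ (2 * m / d) * (d ^ 2 / (8 * m)) + d / (8 * m) * (4 * m) := by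
        gcongr; linarith
    _ < d := by
        have : (2 * m / d) * (d ^ 2 / (8 * m)) + d / (8 * m) * (4 * m) = 3 / 4 * d := by field_simp; ring
        rw [this]; linarith
theorem la_slice {f : ℝ → ENNReal} {s t m d : ℝ} (hm : 0 < m) (hd : 0 < d) (hst : s + 2 * m ≤ t)
    (h : ∫⁻ x in Ioo s t, f x < ENNReal.ofReal (d ^ 2 / 4)) :
    ∃ x ∈ Ioo s t, f x ≤ ENNReal.ofReal (d ^ 2 / (8 * m)) := by
  by_contra hn
  push Not at hn
  have : ∫⁻ _ in Ioo s t, ENNReal.ofReal (d ^ 2 / (8 * m)) ≤ ∫⁻ x in Ioo s t, f x :=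
    setLIntegral_mono' measurableSet_Ioo fun x hx => (hn x hx).le
  rw [setLIntegral_const, Real.volume_Ioo, ← ENNReal.ofReal_mul (by positivity)] at this
  refine absurd (this.trans_lt h) (not_lt.2 (ENNReal.ofReal_le_ofReal ?_))
  calc d ^ 2 / 4 = d ^ 2 / (8 * m) * (2 * m) := by field_simp; ring
    _ ≤ _ := by gcongr; linarith
theorem la_fubini {f : ℂ → ENNReal} (hf : Measurable f) {S T : Set ℝ} :
    ∫⁻ z in S ×ℂ T, f z = ∫⁻ x in S, ∫⁻ y in T, f (x + y * Complex.I) ∧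
    ∫⁻ z in S ×ℂ T, f z = ∫⁻ y in T, ∫⁻ x in S, f (x + y * Complex.I) := by
  have e : ∫⁻ z in S ×ℂ T, f z = ∫⁻ q in S ×ˢ T, f (q.1 + q.2 * Complex.I) := by
    have hp : Complex.measurableEquivRealProd.symm ⁻¹' (S ×ℂ T) = S ×ˢ T := by
      ext q; simp [Complex.measurableEquivRealProd, Complex.mem_reProdIm]
    rw [← (Complex.volume_preserving_equiv_real_prod.symm).setLIntegral_comp_preimage_emb
      Complex.measurableEquivRealProd.symm.measurableEmbedding, hp]
    refine lintegral_congr fun q => ?_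
    congr 1; apply Complex.ext <;> simp [Complex.measurableEquivRealProd]
  have hm : Measurable fun q : ℝ × ℝ => f (q.1 + q.2 * Complex.I) := hf.comp (by fun_prop)
  rw [e, Measure.volume_eq_prod, ← Measure.prod_restrict]
  exact ⟨lintegral_prod _ hm.aemeasurable, lintegral_prod_symm _ hm.aemeasurable⟩
section
variable {φ : ℂ → ℂ} {m d : ℝ} {U : Set ℂ}
theorem la_box (hφ : DifferentiableOn ℂ φ (Str m)) (hi : InjOn φ (Str m)) (he : Eqv φ (Str m))
    (hm : MapsTo φ (Str m) U) (hU : Per U) (hm1 : m ≤ 1) {s t : ℝ} (hst : t ≤ s + 4 * m) :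
    ∫⁻ z in Ioo s t ×ℂ Ioo (-m) m, ENNReal.ofReal (‖deriv φ z‖ ^ 2) ≤ Ar U := by
  have ho : IsOpen (Ioo s t ×ℂ Ioo (-m) m) := isOpen_Ioo.reProdIm isOpen_Ioo
  have hs : (Ioo s t ×ℂ Ioo (-m) m) ⊆ Str m := fun z hz => abs_lt.2 hz.2
  rw [vol_image isOpen_Str hφ hi ho.measurableSet hs]
  refine vol_le_Ar hU (inj_isOpen isOpen_Str hφ hi ho hs).measurableSet
    (image_subset_iff.2 fun z hz => hm (hs hz)) ?_
  rintro _ ⟨z, hz, rfl⟩ k hk ⟨w, hw, hwz⟩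
  rw [← he.int per_Str k (hs hz)] at hwz
  have := hi (hs hw) ((per_Str.int k z).1 (hs hz)) hwz
  have h1 : w.re = z.re + k * (2 * π) := by rw [this, re_tp]
  have h2 : |(k:ℝ)| * (2 * π) < 4 := by
    have : |(k:ℝ) * (2 * π)| < 4 := by
      rw [abs_lt]; constructor <;> linarith [hz.1.1, hz.1.2, hw.1.1, hw.1.2]
    rwa [abs_mul, abs_of_pos Real.two_pi_pos] at this
  have h3 : (1:ℝ) ≤ |(k:ℝ)| := by exact_mod_cast Int.one_le_abs hk
  nlinarith [Real.pi_gt_three]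
theorem la_vert (hφ : DifferentiableOn ℂ φ (Str m)) (hi : InjOn φ (Str m)) (he : Eqv φ (Str m))
    (hm : MapsTo φ (Str m) U) (hU : Per U) (hm0 : 0 < m) (hm1 : m ≤ 1) (hd : 0 < d)
    (hA : Ar U < ENNReal.ofReal (d ^ 2 / 4)) (s : ℝ) :
    ∃ x ∈ Ioo s (s + 2 * m), ∀ y₁ ∈ Ioo (-m) m, ∀ y₂ ∈ Ioo (-m) m,
      ‖φ (x + y₁ * Complex.I) - φ (x + y₂ * Complex.I)‖ < d := by
  have hb := (la_box hφ hi he hm hU hm1 (s := s) (t := s + 2 * m) (by linarith)).trans_lt hA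
  rw [(la_fubini (((measurable_deriv φ).norm.pow_const 2).ennreal_ofReal)).1] at hb
  obtain ⟨x, hx, hxs⟩ := la_slice hm0 hd le_rfl hb
  have key : ∀ y₁ ∈ Ioo (-m) m, ∀ y₂ ∈ Ioo (-m) m, y₁ ≤ y₂ →
      ‖φ (x + y₂ * Complex.I) - φ (x + y₁ * Complex.I)‖ < d := by
    intro y₁ h1 y₂ h2 h12
    have hmem : ∀ y ∈ Icc y₁ y₂, (x + y * Complex.I : ℂ) ∈ Str m := fun y hy => by
      simp only [Str, mem_ofPred_eq]; simp [abs_lt]; constructor <;> linarith [h1.1, h2.2, hy.1, hy.2]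
    refine la_path (γ := fun y : ℝ => φ (x + y * Complex.I))
      (γ' := fun y : ℝ => deriv φ (x + y * Complex.I) * Complex.I) h12 (by linarith [h1.1, h2.2]) hm0 hd ?_ ?_ ?_
    · intro y hy
      have := (hφ.differentiableAt (isOpen_Str.mem_nhds (hmem y hy))).hasDerivAt
      exact this.comp_of_eq y (by simpa using ((hasDerivAt_id y).ofReal_comp.mul_const Complex.I).const_add (x:ℂ)) rfl
    · exact (((hφ.deriv isOpen_Str).continuousOn).comp (by fun_prop) hmem).mul continuousOn_const
    · refine le_trans ?_ hxs
      simp only [norm_mul, Complex.norm_I, mul_one]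
      exact lintegral_mono_set fun y hy => ⟨by linarith [h1.1, hy.1], by linarith [h2.2, hy.2]⟩
  refine ⟨x, hx, fun y₁ h1 y₂ h2 => ?_⟩
  rcases le_total y₁ y₂ with h | h
  · rw [norm_sub_rev]; exact key _ h1 _ h2 h
  · exact key _ h2 _ h1 h
theorem la_hor (hφ : DifferentiableOn ℂ φ (Str m)) (hi : InjOn φ (Str m)) (he : Eqv φ (Str m))
    (hm : MapsTo φ (Str m) U) (hU : Per U) (hm0 : 0 < m) (hm1 : m ≤ 1) (hd : 0 < d)
    (hA : Ar U < ENNReal.ofReal (d ^ 2 / 4)) {s t : ℝ} (hst : s ≤ t) (ht : t ≤ s + 4 * m) :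
    ∃ y ∈ Ioo (-m) m, ∀ x ∈ Icc s t, ‖φ (x + y * Complex.I) - φ (s + y * Complex.I)‖ < d := by
  have hb := (la_box hφ hi he hm hU hm1 (s := s) (t := t) ht).trans_lt hA
  rw [(la_fubini (((measurable_deriv φ).norm.pow_const 2).ennreal_ofReal)).2] at hb
  obtain ⟨y, hy, hys⟩ := la_slice hm0 hd (by linarith) hb
  have hmem : ∀ x : ℝ, (x + y * Complex.I : ℂ) ∈ Str m := fun x => by
    simpa [Str, abs_lt] using hy
  refine ⟨y, hy, fun x hx => ?_⟩
  refine la_path (γ := fun x : ℝ => φ (x + y * Complex.I))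
    (γ' := fun x : ℝ => deriv φ (x + y * Complex.I)) hx.1 (by linarith [hx.2]) hm0 hd ?_ ?_ ?_
  · intro x hx
    have := (hφ.differentiableAt (isOpen_Str.mem_nhds (hmem x))).hasDerivAt
    exact (this.comp_of_eq x ((hasDerivAt_id x).ofReal_comp.add_const (y * Complex.I : ℂ)) rfl).congr_deriv (by simp)
  · exact ((hφ.deriv isOpen_Str).continuousOn).comp (by fun_prop) fun x _ => hmem x
  · refine le_trans ?_ hys
    rw [restrict_Ioo_eq_restrict_Ioc]
    exact lintegral_mono_set (Ioc_subset_Ioc_right hx.2)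
end
theorem ivt_ne {X : Type*} [TopologicalSpace X] {S : Set X} (hS : IsPreconnected S) {f : X → ℝ} (hf : ContinuousOn f S)
    {c : ℝ} (hc : ∀ z ∈ S, f z ≠ c) {a b : X} (ha : a ∈ S) (hb : b ∈ S) (h : f a < c) : f b < c := by
  by_contra hn
  obtain ⟨w, hw, e⟩ := hS.intermediate_value ha hb hf ⟨h.le, not_lt.1 hn⟩
  exact hc w hw e
theorem qmono {F Fi : ℂ → ℂ} (h : SH F Fi) {r κ d : ℝ} (h0 : 0 < r) (h1 : r ≤ 1) (hκ : 0 < κ) (hd : 0 < d)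
    (hsep : ∀ x ∈ Str r, ∀ y ∈ Str r, ‖x - y‖ = κ → d ≤ ‖F x - F y‖)
    (hA : Ar (F '' Str r) < ENNReal.ofReal (d ^ 2 / 4)) {z z' : ℂ} (hz : z ∈ Str 1) (hz' : z' ∈ Str 1)
    (hzz : (GU F r z).re ≤ (GU F r z').re) : z.re ≤ z'.re + 5 * κ := by
  have hN := h.nu h0 h1
  have hs := Str_mono h1
  obtain ⟨fd, fi, fm, fe, fr⟩ := hN.inv h h1 (pU_h h h0 h1)
  have fl := pU_h h h0 h1
  have hm0 := hN.pos
  set m := mU F r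
  set φ := pU F r
  have hUp := h.per hs per_Str
  have hm1 : m ≤ 1 := hN.le_one h h1
  let ψ : ℂ → ℂ := fun w => Fi (φ w)
  let χ : ℂ → ℂ := fun u => hU F r (F u)
  have φ1 : ∀ w ∈ Str m, φ w ∈ Str 1 := fun w hw => by
    obtain ⟨u, hu, e⟩ := fm hw; rw [← e]; exact h.mF (hs hu)
  have Fψ : ∀ w ∈ Str m, F (ψ w) = φ w := fun w hw => h.r _ (φ1 w hw)
  have ψm : ∀ w ∈ Str m, ψ w ∈ Str r := fun w hw => by
    obtain ⟨u, hu, e⟩ := fm hw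
    simp only [ψ, ← e, h.l u (hs hu)]; exact hu
  have χψ : ∀ w ∈ Str m, χ (ψ w) = w := fun w hw => by simp only [χ]; rw [Fψ w hw, fr w hw]
  have χm : ∀ u ∈ Str r, χ u ∈ Str m := fun u hu => by
    rw [← hN.im]; exact mem_image_of_mem _ (mem_image_of_mem _ hu)
  have ψχ : ∀ u ∈ Str r, ψ (χ u) = u := fun u hu => by
    simp only [χ, ψ]; rw [fl _ (mem_image_of_mem _ hu), h.l u (hs hu)]
  have ψc : ContinuousOn ψ (Str m) := h.cI.comp fd.continuousOn φ1
  have χc : ContinuousOn χ (Str r) := hN.d.continuousOn.comp (h.cF.mono hs) (mapsTo_image _ _)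
  have ψe : Eqv ψ (Str m) := fun w hw => by
    simp only [ψ]; rw [fe w hw, h.ei _ (φ1 w hw)]
  have small : ∀ S ⊆ Str m, IsPreconnected S → ∀ z0 ∈ S, (∀ z ∈ S, ‖φ z - φ z0‖ < d) →
      ∀ z ∈ S, ‖ψ z - ψ z0‖ < κ := by
    intro S hS hSc z0 hz0 hh z hz
    refine ivt_ne hSc (f := fun z => ‖ψ z - ψ z0‖) ((ψc.mono hS).sub continuousOn_const).norm
      (fun w hw e => ?_) hz0 hz (by simpa using hκ)
    have := hsep _ (ψm w (hS hw)) _ (ψm z0 (hS hz0)) e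
    rw [Fψ _ (hS hw), Fψ _ (hS hz0)] at this
    exact absurd (hh w hw) (not_lt.2 this)
  have good : ∀ s : ℝ, ∃ x ∈ Ioo s (s + 2 * m), ∀ w ∈ Str m, w.re = x → |(ψ w).re - (ψ x).re| < κ := by
    intro s
    obtain ⟨x, hx, hh⟩ := la_vert fd fi fe fm hUp hm0 hm1 hd hA s
    refine ⟨x, hx, fun w hw hwx => ?_⟩
    have hlin : ∀ w : ℂ, w.re = x → w = x + w.im * Complex.I := fun w hw => by
      rw [← hw]; exact (Complex.re_add_im w).symm
    have hV : Convex ℝ ({w : ℂ | w.re = x} ∩ Str m) :=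
      ((convex_singleton x).linear_preimage (f := Complex.reLm)).inter convex_Str
    have := small ({w : ℂ | w.re = x} ∩ Str m) inter_subset_right hV.isPreconnected x
      ⟨Complex.ofReal_re x, zero_mem_Str hm0 x⟩ (fun w hw => by
        have := hh w.im (abs_lt.1 hw.2) 0 (by simp [hm0])
        rw [← hlin w hw.1] at this; simpa using this) w ⟨hwx, hw⟩
    refine lt_of_le_of_lt ?_ this
    rw [← Complex.sub_re]; exact Complex.abs_re_le_norm _
  have right : ∀ x : ℝ, (∀ w ∈ Str m, w.re = x → |(ψ w).re - (ψ x).re| < κ) → ∀ w ∈ Str m,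
      (x < w.re → (ψ x).re - κ ≤ (ψ w).re) ∧ (w.re < x → (ψ w).re ≤ (ψ x).re + κ) := by
    intro x hx w hw
    constructor
    · intro hxw
      by_contra hn
      push Not at hn
      have hS : Convex ℝ ({u : ℂ | u.re < (ψ x).re - κ} ∩ Str r) := (convex_halfSpace_re_lt _).inter convex_Str
      obtain ⟨n, hn1⟩ := exists_nat_gt (w.re - x)
      have hwn := (per_Str.int (-n) w).1 hw
      have e1 := ψe.int per_Str (-n) hw
      have hpi := Real.pi_gt_three
      have n0 : (0:ℝ) ≤ n := n.cast_nonneg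
      refine absurd (ivt_ne hS.isPreconnected (f := fun u => (χ u).re) (c := x)
        (Complex.continuous_re.comp_continuousOn (χc.mono inter_subset_right)) ?_
        (a := ψ (w + (-n:ℤ) * tp)) (b := ψ w) ⟨?_, ψm _ hwn⟩ ⟨hn, ψm _ hw⟩ ?_) ?_
      · rintro u ⟨hu1, hu2⟩ e
        have := hx (χ u) (χm u hu2) e
        rw [ψχ u hu2] at this
        have h3 : u.re < (ψ x).re - κ := hu1
        linarith [(abs_lt.1 this).1]
      · rw [mem_ofPred_eq, e1, re_tp]; push_cast; nlinarith
      · simp only [χψ _ hwn, re_tp]; push_cast; nlinarith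
      · simp only [χψ _ hw]; exact not_lt.2 hxw.le
    · intro hxw
      by_contra hn
      push Not at hn
      have hS : Convex ℝ ({u : ℂ | (ψ x).re + κ < u.re} ∩ Str r) := (convex_halfSpace_re_gt _).inter convex_Str
      obtain ⟨n, hn1⟩ := exists_nat_gt (x - w.re)
      have hwn := (per_Str.int n w).1 hw
      have e1 := ψe.int per_Str n hw
      have hpi := Real.pi_gt_three
      have n0 : (0:ℝ) ≤ n := n.cast_nonneg
      refine absurd (ivt_ne hS.isPreconnected (f := fun u => (χ u).re) (c := x)
        (Complex.continuous_re.comp_continuousOn (χc.mono inter_subset_right)) ?_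
        (b := ψ (w + (n:ℤ) * tp)) (a := ψ w) ⟨hn, ψm _ hw⟩ ⟨?_, ψm _ hwn⟩ ?_) ?_
      · rintro u ⟨hu1, hu2⟩ e
        have := hx (χ u) (χm u hu2) e
        rw [ψχ u hu2] at this
        have h3 : (ψ x).re + κ < u.re := hu1
        linarith [(abs_lt.1 this).2]
      · rw [mem_ofPred_eq, e1, re_tp]; push_cast; nlinarith
      · simp only [χψ _ hw]; exact hxw
      · simp only [χψ _ hwn, re_tp]; push_cast; exact not_lt.2 (by nlinarith)
  have main : ∀ w ∈ Str m, ∀ w' ∈ Str m, w.re ≤ w'.re → (ψ w).re ≤ (ψ w').re + 5 * κ := by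
    intro w hw w' hw' hww
    obtain ⟨x1, hx1, g1⟩ := good (w.re - 2 * m)
    obtain ⟨x2, hx2, g2⟩ := good w.re
    have a1 := (right x1 g1 w' hw').1 (by linarith [hx1.2])
    have a2 := (right x2 g2 w hw).2 hx2.1
    obtain ⟨y, hy, hh⟩ := la_hor fd fi fe fm hUp hm0 hm1 hd hA (s := x1) (t := x2)
      (by linarith [hx1.2, hx2.1]) (by linarith [hx1.1, hx2.2])
    have hmem : ∀ x : ℝ, (x + y * Complex.I : ℂ) ∈ Str m := fun x => by simpa [Str, abs_lt] using hy
    have h12 : x1 ≤ x2 := by linarith [hx1.2, hx2.1]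
    have := small ((fun x : ℝ => (x + y * Complex.I : ℂ)) '' Icc x1 x2) (by rintro _ ⟨x, -, rfl⟩; exact hmem x)
      (isPreconnected_Icc.image _ (by fun_prop)) _ (mem_image_of_mem _ (left_mem_Icc.2 h12))
      (by rintro _ ⟨x, hx, rfl⟩; exact hh x hx) _ (mem_image_of_mem _ (right_mem_Icc.2 h12))
    have b0 := (Complex.abs_re_le_norm _).trans_lt this
    rw [Complex.sub_re] at b0
    have b1 := g1 _ (hmem x1) (by simp)
    have b2 := g2 _ (hmem x2) (by simp)
    rw [abs_lt] at b0 b1 b2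
    linarith [b0.2, b1.2, b2.1]
  have hr : ∀ z ∈ Str 1, sc r z ∈ Str r := fun z hz => (sc_mem1 h0).2 hz
  have := main (χ (sc r z)) (χm _ (hr z hz)) (χ (sc r z')) (χm _ (hr z' hz')) (by simpa [GU] using hzz)
  rwa [ψχ _ (hr z hz), ψχ _ (hr z' hz'), sc_re, sc_re] at this
def BL (a : ℝ → ℝ) : Prop := ∃ l M : ℝ, 0 < l ∧ ∀ x y, x ≤ y → l * (y - x) ≤ a y - a x ∧ a y - a x ≤ M * (y - x)
theorem BL.convex {a b : ℝ → ℝ} (ha : BL a) (hb : BL b) {s t : ℝ} (hs : 0 ≤ s) (ht : 0 ≤ t) (hst : s + t = 1) :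
    BL fun x => s * a x + t * b x := by
  obtain ⟨l, M, hl, h⟩ := ha
  obtain ⟨l', M', hl', h'⟩ := hb
  refine ⟨min l l', max M M', lt_min hl hl', fun x y hxy => ?_⟩
  obtain ⟨h1, h2⟩ := h x y hxy
  obtain ⟨h1', h2'⟩ := h' x y hxy
  have hd : 0 ≤ y - x := by linarith
  have c1 := mul_le_mul_of_nonneg_right (min_le_left l l') hd
  have c2 := mul_le_mul_of_nonneg_right (min_le_right l l') hd
  have c3 := mul_le_mul_of_nonneg_right (le_max_left M M') hd
  have c4 := mul_le_mul_of_nonneg_right (le_max_right M M') hd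
  obtain rfl : t = 1 - s := by linarith
  constructor <;> nlinarith
theorem BL.id : BL fun x => x := ⟨1, 1, one_pos, fun x y _ => by constructor <;> linarith⟩
theorem BL_mix {a : ℝ → ℝ} {M l : ℝ} (ha : ∀ x y, x ≤ y → a x ≤ a y ∧ a y - a x ≤ M * (y - x))
    (hl : 0 < l) (hl1 : l ≤ 1) : BL fun x => (1 - l) * a x + l * x := by
  refine ⟨l, (1 - l) * M + l, hl, fun x y hxy => ?_⟩
  obtain ⟨h1, h2⟩ := ha x y hxy
  constructor <;> nlinarith
theorem exists_a {b : ℝ → ℝ} (hb : Continuous b) (he : ∀ x, b (x + 2 * π) = b x + 2 * π) {ε : ℝ}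
    (hε : 0 < ε) (hq : ∀ x y, x ≤ y → b x ≤ b y + ε) :
    ∃ a : ℝ → ℝ, BL a ∧ (∀ x, a (x + 2 * π) = a x + 2 * π) ∧ ∀ x, |a x - b x| ≤ 2 * ε := by
  have hp : Function.Periodic (fun x => b x - x) (2 * π) := fun x => by simp only [he]; ring
  have hpc : Continuous fun x => b x - x := hb.sub continuous_id
  obtain ⟨C, hC⟩ := isBounded_iff_forall_norm_le.1 (hp.isBounded_of_continuous Real.two_pi_pos.ne' hpc)
  replace hC : ∀ x, |b x - x| ≤ C := fun x => hC _ (mem_range_self x)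
  have hC0 : 0 ≤ C := (abs_nonneg _).trans (hC 0)
  obtain ⟨δ, hδ, hd⟩ : ∃ δ > 0, ∀ x y, x ≤ y → y - x < δ → b y < b x + ε := by
    obtain ⟨δ, hδ, hd⟩ := Metric.uniformContinuousOn_iff.1 ((isCompact_Icc (a := (0:ℝ))
      (b := 2 * π + 1)).uniformContinuousOn_of_continuous hb.continuousOn) ε hε
    refine ⟨min δ 1, lt_min hδ one_pos, fun x y hxy h => ?_⟩
    obtain ⟨k, hk, -⟩ := existsUnique_add_zsmul_mem_Ioc Real.two_pi_pos x 0
    have e1 := hp.zsmul k x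
    have e2 := hp.zsmul k y
    have l1 := h.trans_le (min_le_left _ _)
    have l2 := h.trans_le (min_le_right _ _)
    have := hd (y + k • (2 * π)) ⟨by linarith [hk.1], by linarith [hk.2]⟩ (x + k • (2 * π))
      ⟨hk.1.le, by linarith [hk.2]⟩ (by rw [dist_add_right, Real.dist_eq, abs_of_nonneg (by linarith)]; exact l1)
    rw [Real.dist_eq, abs_lt] at this
    linarith [this.2]
  obtain ⟨M, hM0, hM⟩ : ∃ M, 0 ≤ M ∧ ∀ x y, x ≤ y → b y ≤ b x + ε + M * (y - x) := by
    refine ⟨1 + 2 * C / δ, by positivity, fun x y hxy => ?_⟩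
    have h1 : 0 ≤ (1 + 2 * C / δ) * (y - x) := mul_nonneg (by positivity) (by linarith)
    rcases lt_or_ge (y - x) δ with h | h
    · linarith [hd x y hxy h]
    · have h2 : 2 * C ≤ 2 * C / δ * (y - x) := by
        rw [div_mul_eq_mul_div, le_div_iff₀ hδ]; exact mul_le_mul_of_nonneg_left h (by positivity)
      linarith [(abs_le.1 (hC x)).1, (abs_le.1 (hC y)).2]
  let g : ℝ → ℝ → ℝ := fun x η => b η - M * max (η - x) 0
  have hub : ∀ x η, g x η ≤ b x + ε := fun x η => by
    rcases le_total η x with h | h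
    · simp only [g]; rw [max_eq_right (by linarith)]; linarith [hq η x h]
    · simp only [g]; rw [max_eq_left (by linarith)]; linarith [hM x η h]
  have hbd : ∀ x, BddAbove (range (g x)) := fun x => ⟨_, by rintro _ ⟨η, rfl⟩; exact hub x η⟩
  let a1 : ℝ → ℝ := fun x => ⨆ η, g x η
  have u1 : ∀ x, a1 x ≤ b x + ε := fun x => ciSup_le (hub x)
  have u2 : ∀ x, b x ≤ a1 x := fun x => by simpa [g] using le_ciSup (hbd x) x
  have u3 : ∀ x, a1 (x + 2 * π) = a1 x + 2 * π := fun x => by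
    simp only [a1]
    rw [ciSup_add (hbd x), ← (Equiv.addRight (2 * π)).iSup_comp]
    congr 1; ext η
    simp only [g, Equiv.coe_addRight, he, add_sub_add_right_eq_sub]; ring
  have u4 : ∀ x y, x ≤ y → a1 x ≤ a1 y ∧ a1 y - a1 x ≤ M * (y - x) := fun x y hxy => by
    constructor
    · refine ciSup_mono (hbd y) fun η => ?_
      simp only [g]
      have : max (η - y) 0 ≤ max (η - x) 0 := max_le_max_right _ (by linarith)
      nlinarith
    · rw [sub_le_iff_le_add]
      refine ciSup_le fun η => ?_
      have h1 := le_ciSup (hbd x) η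
      have : max (η - x) 0 ≤ max (η - y) 0 + (y - x) :=
        max_le (by linarith [le_max_left (η - y) 0]) (by linarith [le_max_right (η - y) 0])
      simp only [g] at h1 ⊢
      have := mul_le_mul_of_nonneg_left this hM0
      simp only [a1, g]
      linarith
  have hCε : 0 < C + ε := by positivity
  set l := ε / (C + ε) with hl
  have hl0 : 0 < l := by positivity
  have hl1 : l ≤ 1 := by rw [hl, div_le_one hCε]; linarith
  have hle : l * (C + ε) = ε := by rw [hl]; field_simp
  refine ⟨_, BL_mix u4 hl0 hl1, fun x => by simp only [u3]; ring, fun x => ?_⟩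
  have := abs_le.1 (hC x)
  have h1 := u1 x
  have h2 := u2 x
  rw [abs_le]
  constructor <;> nlinarith
noncomputable def ramp (u v x : ℝ) : ℝ := max 0 (min 1 ((x - u) / (v - u)))
theorem ramp_zero {u v x : ℝ} (huv : u < v) (h : x ≤ u) : ramp u v x = 0 :=
  max_eq_left ((min_le_right _ _).trans (div_nonpos_of_nonpos_of_nonneg (by linarith) (by linarith)))
theorem ramp_one {u v x : ℝ} (huv : u < v) (h : v ≤ x) : ramp u v x = 1 := by
  rw [ramp, min_eq_left, max_eq_right one_pos.le]
  rw [le_div_iff₀ (by linarith)]; linarith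
theorem ramp_nonneg (u v x : ℝ) : 0 ≤ ramp u v x := le_max_left _ _
theorem ramp_le (u v x : ℝ) : ramp u v x ≤ 1 := max_le one_pos.le (min_le_left _ _)
theorem ramp_lip {u v : ℝ} (huv : u < v) (x y : ℝ) (h : x ≤ y) :
    ramp u v x ≤ ramp u v y ∧ ramp u v y - ramp u v x ≤ (v - u)⁻¹ * (y - x) := by
  have hp : 0 < v - u := by linarith
  have e : (y - u) / (v - u) = (x - u) / (v - u) + (v - u)⁻¹ * (y - x) := by field_simp; ring
  have : 0 ≤ (v - u)⁻¹ * (y - x) := mul_nonneg (by positivity) (by linarith)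
  constructor
  · exact max_le_max_left _ (min_le_min_left _ (by linarith))
  · rw [sub_le_iff_le_add, ramp, ramp, e]
    refine max_le (by linarith [le_max_left 0 (min 1 ((x - u) / (v - u)))]) ?_
    rcases min_cases 1 ((x - u) / (v - u)) with h1 | h1
    · rw [h1.1]; exact (min_le_left _ _).trans (by linarith [le_max_right (0:ℝ) 1])
    · rw [h1.1]; exact (min_le_right _ _).trans (by linarith [le_max_right 0 ((x - u) / (v - u))])
theorem exists_alpha {G Gi : ℂ → ℂ} (h : SH G Gi) (hU : U2 G) {s : ℝ} (hs : 0 < s) :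
    ∃ α : ℝ → ℝ, BL α ∧ (∀ x, α (-x) = -α x) ∧ α 1 = 1 ∧ ∀ z ∈ Str 1, |α (G z).im - α z.im| < s := by
  have step : ∀ v : ℝ, ∃ v', v < 1 → v < v' ∧ 0 < v' ∧ v' < 1 ∧ ∀ z ∈ Str 1, (z.im ≤ v → (G z).im < v') ∧
      ((G z).im ≤ v → z.im < v') ∧ (-v ≤ z.im → -v' < (G z).im) ∧ (-v ≤ (G z).im → -v' < z.im) := by
    intro v
    by_cases hv : v < 1
    swap
    · exact ⟨0, fun h => absurd h hv⟩
    obtain ⟨c, c0, c1, hc⟩ := h.UF hU hv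
    obtain ⟨c', c0', c1', hc'⟩ := h.symm.UF (h.U2_symm hU) hv
    refine ⟨max ((v + 1) / 2) (max c c'), fun _ => ⟨lt_max_of_lt_left (by linarith), lt_max_of_lt_right (lt_max_of_lt_left c0),
      max_lt (by linarith) (max_lt c1 c1'), fun z hz => ?_⟩⟩
    have k1 : c ≤ max ((v + 1) / 2) (max c c') := (le_max_left _ _).trans (le_max_right _ _)
    have k2 : c' ≤ max ((v + 1) / 2) (max c c') := (le_max_right _ _).trans (le_max_right _ _)
    have a1 := hc z hz
    have a2 := hc' (G z) (h.mF hz)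
    rw [h.l z hz] at a2
    refine ⟨fun hh => ?_, fun hh => ?_, fun hh => ?_, fun hh => ?_⟩ <;> by_contra hn <;> push Not at hn
    · linarith [a2.1 (by linarith)]
    · linarith [a1.1 (by linarith)]
    · linarith [a2.2 (by linarith)]
    · linarith [a1.2 (by linarith)]
  choose nx hnx using step
  let v : ℕ → ℝ := fun n => nx^[n] 0
  have vs : ∀ n, v (n + 1) = nx (v n) := fun n => Function.iterate_succ_apply' _ _ _
  have v1 : ∀ n, 0 ≤ v n ∧ v n < 1 := by
    intro n
    induction n with
    | zero => exact ⟨le_rfl, one_pos⟩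
    | succ n ih => rw [vs]; exact ⟨(hnx _ ih.2).2.1.le, (hnx _ ih.2).2.2.1⟩
  have vlt : ∀ n, v n < v (n + 1) := fun n => by rw [vs]; exact (hnx _ (v1 n).2).1
  have vst := fun n => (hnx _ (v1 n).2).2.2.2
  simp only [← vs] at vst
  let R : ℕ → ℝ → ℝ := fun j => ramp (v j) (v (j + 1))
  have shift : ∀ x x' : ℝ, (∀ j, x ≤ v j → x' < v (j + 1)) → ∀ N, ∑ j ∈ Finset.range N, R j x' ≤
      2 + ∑ j ∈ Finset.range N, R j x := by
    intro x x' hx N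
    have h1 : ∀ j, R (j + 2) x' ≤ R j x := fun j => by
      rcases le_total x (v (j + 1)) with hh | hh
      · rw [show R (j + 2) x' = 0 from ramp_zero (vlt _) (hx _ hh).le]; exact ramp_nonneg _ _ _
      · rw [show R j x = 1 from ramp_one (vlt _) hh]; exact ramp_le _ _ _
    calc ∑ j ∈ Finset.range N, R j x' ≤ ∑ j ∈ Finset.range (N + 2), R j x' :=
          Finset.sum_le_sum_of_subset_of_nonneg (Finset.range_mono (by omega)) fun _ _ _ => ramp_nonneg _ _ _
      _ = ∑ j ∈ Finset.range N, R (j + 2) x' + R 1 x' + R 0 x' := by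
          rw [Finset.sum_range_succ', Finset.sum_range_succ']
      _ ≤ ∑ j ∈ Finset.range N, R j x + 1 + 1 := by
          gcongr
          · exact h1 _
          · exact ramp_le _ _ _
          · exact ramp_le _ _ _
      _ = _ := by ring
  obtain ⟨N, hN⟩ := exists_nat_gt (max 1 (8 / s))
  have hN1 : (1:ℝ) < N := (le_max_left _ _).trans_lt hN
  have hN2 : 8 / s < N := (le_max_right _ _).trans_lt hN
  have hN0 : (0:ℝ) < N := by linarith
  have hNs : 4 / (N:ℝ) < s / 2 := by
    rw [div_lt_iff₀ hs] at hN2; rw [div_lt_iff₀ hN0]; linarith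
  let T : ℝ → ℝ := fun x => ∑ j ∈ Finset.range N, R j x
  let α0 : ℝ → ℝ := fun x => (T x - T (-x)) / N
  have Tl : ∃ M, ∀ x y, x ≤ y → T x ≤ T y ∧ T y - T x ≤ M * (y - x) := by
    refine ⟨∑ j ∈ Finset.range N, (v (j + 1) - v j)⁻¹, fun x y hxy => ⟨Finset.sum_le_sum fun j _ =>
      (ramp_lip (vlt j) x y hxy).1, ?_⟩⟩
    rw [← Finset.sum_sub_distrib, Finset.sum_mul]
    exact Finset.sum_le_sum fun j _ => (ramp_lip (vlt j) x y hxy).2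
  obtain ⟨M, hM⟩ := Tl
  have al : ∀ x y, x ≤ y → α0 x ≤ α0 y ∧ α0 y - α0 x ≤ (2 * M / N) * (y - x) := fun x y hxy => by
    have h1 := hM x y hxy
    have h2 := hM (-y) (-x) (by linarith)
    constructor
    · simp only [α0]; gcongr; exacts [h1.1, h2.1]
    · simp only [α0]; rw [← sub_div, div_mul_eq_mul_div]; gcongr; nlinarith
  have a1 : α0 1 = 1 := by
    have e1 : T 1 = N := by
      simp only [T]; rw [Finset.sum_congr rfl fun j _ => show R j 1 = 1 from ramp_one (vlt j) (v1 _).2.le]; simp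
    have e2 : T (-1) = 0 := Finset.sum_eq_zero fun j _ => ramp_zero (vlt j) (by linarith [(v1 j).1])
    simp only [α0]; rw [e1, e2, sub_zero, div_self hN0.ne']
  have disp : ∀ z ∈ Str 1, |α0 (G z).im - α0 z.im| ≤ 4 / N := fun z hz => by
    have s1 := shift z.im (G z).im (fun j hj => (vst j z hz).1 hj) N
    have s2 := shift (G z).im z.im (fun j hj => (vst j z hz).2.1 hj) N
    have s3 := shift (-z.im) (-(G z).im) (fun j hj => by linarith [(vst j z hz).2.2.1 (by linarith)]) N
    have s4 := shift (-(G z).im) (-z.im) (fun j hj => by linarith [(vst j z hz).2.2.2 (by linarith)]) N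
    simp only [α0]
    rw [← sub_div, abs_div, abs_of_pos hN0]
    gcongr
    rw [abs_le]; constructor <;> simp only [T] <;> linarith
  set l := min 1 (s / 5) with hl
  have hl0 : 0 < l := lt_min one_pos (by positivity)
  have hl1 : l ≤ 1 := min_le_left _ _
  have hl2 : l ≤ s / 5 := min_le_right _ _
  refine ⟨_, BL_mix al hl0 hl1, fun x => ?_, by simp only [a1]; ring, fun z hz => ?_⟩
  · simp only [α0, neg_neg]; ring
  · have h1 : -1 < z.im ∧ z.im < 1 := abs_lt.1 hz
    have h2 : -1 < (G z).im ∧ (G z).im < 1 := abs_lt.1 (h.mF hz)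
    have h3 := abs_le.1 (disp z hz)
    have h4 : 0 ≤ 4 / (N:ℝ) := by positivity
    rw [abs_lt]
    constructor <;> nlinarith
theorem Ar_le {U O : Set ℂ} (hO : MeasurableSet O) (h : ∀ w ∈ U, ∃ k : ℤ, w + k * tp ∈ O) : Ar U ≤ volume O := by
  have e : ∀ k : ℤ, volume (FD ∩ (fun z : ℂ => z + k * tp) ⁻¹' O) =
      volume ((fun z : ℂ => z + -(k * tp)) ⁻¹' FD ∩ O) := fun k => by
    rw [← measure_preimage_add_right volume (k * tp) ((fun z : ℂ => z + -(k * tp)) ⁻¹' FD ∩ O)]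
    congr 1; ext z; simp
  calc Ar U ≤ volume (⋃ k : ℤ, (FD ∩ (fun z : ℂ => z + k * tp) ⁻¹' O)) := by
        refine measure_mono fun w hw => ?_
        obtain ⟨k, hk⟩ := h w hw.1
        exact mem_iUnion.2 ⟨k, hw.2, hk⟩
    _ ≤ ∑' k : ℤ, volume (FD ∩ (fun z : ℂ => z + k * tp) ⁻¹' O) := measure_iUnion_le _
    _ = volume (⋃ k : ℤ, ((fun z : ℂ => z + -(k * tp)) ⁻¹' FD ∩ O)) := by
        rw [measure_iUnion]
        · exact tsum_congr e
        · intro k l hkl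
          refine disjoint_left.2 fun z h1 h2 => hkl ?_
          have := FD_uniq (z := z) (k := -k) (l := -l) (by simpa using h1.1) (by simpa using h2.1)
          exact neg_injective this
        · exact fun k => ((measurable_id.add_const _) measurable_FD).inter hO
    _ ≤ volume O := measure_mono (iUnion_subset fun k => inter_subset_right)
def QM (F : ℂ → ℂ) (r e : ℝ) : Prop := ∀ z ∈ Str 1, ∀ z' ∈ Str 1, (GU F r z).re ≤ (GU F r z').re → z.re ≤ z'.re + e
theorem rho_loc {P : Type*} [TopologicalSpace P] {F Fi : P → ℂ → ℂ} (h : CF F Fi) (p0 : P) (hN : NP (F p0))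
    {e : ℝ} (he : 0 < e) : ∃ c, 0 < c ∧ c ≤ 1 ∧ ∀ᶠ p in 𝓝 p0, ∀ r, 0 < r → r ≤ c → QM (F p) r e := by
  have hκ : 0 < e / 5 := by positivity
  set κ := e / 5 with hκe
  let R : Set ℂ := Icc 0 (2 * π) ×ℂ Icc (-(1 / 2)) (1 / 2)
  have hR : IsCompact R := isCompact_Icc.reProdIm isCompact_Icc
  let B : Set ℂ := Icc (-κ) (2 * π + κ) ×ℂ Icc (-(1 / 2)) (1 / 2)
  have hB : IsCompact B := isCompact_Icc.reProdIm isCompact_Icc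
  have hRS : ∀ z : ℂ, z.im ∈ Icc (-(1 / 2) : ℝ) (1 / 2) → z ∈ Str 1 := fun z hz =>
    mem_Str_of (by norm_num : (1 / 2 : ℝ) < 1) (abs_le.2 hz)
  have hK : IsCompact ((R ×ˢ B) ∩ {q : ℂ × ℂ | ‖q.1 - q.2‖ = κ}) :=
    (hR.prod hB).inter_right (isClosed_eq (by fun_prop) continuous_const)
  have hc1 : ∀ q ∈ (R ×ˢ B) ∩ {q : ℂ × ℂ | ‖q.1 - q.2‖ = κ},
      ContinuousAt (fun w : P × ℂ × ℂ => ‖F w.1 w.2.1 - F w.1 w.2.2‖) (p0, q) := fun q hq => by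
    refine (ContinuousAt.sub ?_ ?_).norm
    · exact ContinuousAt.comp (x := (p0, q)) (f := fun w : P × ℂ × ℂ => (w.1, w.2.1)) (h.at p0 (hRS q.1 hq.1.1.2)) (by fun_prop)
    · exact ContinuousAt.comp (x := (p0, q)) (f := fun w : P × ℂ × ℂ => (w.1, w.2.2)) (h.at p0 (hRS q.2 hq.1.2.2)) (by fun_prop)
  obtain ⟨d, hd, hdm⟩ := hK.exists_forall_le' (f := fun q : ℂ × ℂ => ‖F p0 q.1 - F p0 q.2‖) (a := 0)
    (fun q hq => (ContinuousAt.comp (x := q) (f := fun q : ℂ × ℂ => (p0, q)) (hc1 q hq) (by fun_prop)).continuousWithinAt)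
    (fun q hq => by
      rw [norm_pos_iff, sub_ne_zero]
      intro h0
      have : q.1 = q.2 := by rw [← (h.sh p0).l _ (hRS q.1 hq.1.1.2), h0, (h.sh p0).l _ (hRS q.2 hq.1.2.2)]
      have h2 : ‖q.1 - q.2‖ = κ := hq.2
      rw [this, sub_self, norm_zero] at h2; linarith)
  have hsep := hK.eventually_forall_of_forall_eventually (x₀ := p0)
    (P := fun p q => d / 2 < ‖F p q.1 - F p q.2‖)
    (fun q hq => continuousAt_const.eventually_lt (hc1 q hq) (by have := hdm q hq; dsimp only; linarith))
  have hL : volume ((fun x : ℝ => (x : ℂ)) '' Icc 0 (2 * π)) = 0 := by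
    refine measure_mono_null (t := LinearMap.ker Complex.imLm) ?_ (Measure.addHaar_submodule _ _ ?_)
    · rintro _ ⟨x, -, rfl⟩; simp
    · intro h0
      have : Complex.I ∈ LinearMap.ker Complex.imLm := by rw [h0]; trivial
      simp at this
  have hL2 := hN _ (by rintro _ ⟨x, -, rfl⟩; exact zero_mem_Str one_pos x) hL
  have hd4 : 0 < ENNReal.ofReal ((d / 2) ^ 2 / 4) := ENNReal.ofReal_pos.2 (by positivity)
  obtain ⟨O, hO1, hO2, hO3⟩ := (F p0 '' ((fun x : ℝ => (x : ℂ)) '' Icc 0 (2 * π))).exists_isOpen_lt_of_lt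
    _ (hL2.trans_lt hd4)
  have hT := (isCompact_Icc (a := (0 : ℝ)) (b := 2 * π)).eventually_forall_of_forall_eventually
    (x₀ := (p0, (0 : ℝ))) (P := fun (q : P × ℝ) (x : ℝ) => F q.1 (x + q.2 * Complex.I) ∈ O) (fun x hx => by
      have h1 := h.at p0 (zero_mem_Str one_pos x)
      have h2 : ContinuousAt (fun q : (P × ℝ) × ℝ => F q.1.1 (q.2 + q.1.2 * Complex.I)) ((p0, 0), x) := by
        refine ContinuousAt.comp (x := ((p0, (0 : ℝ)), x)) (g := fun q : P × ℂ => F q.1 q.2)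
          (f := fun q : (P × ℝ) × ℝ => (q.1.1, (q.2 + q.1.2 * Complex.I : ℂ))) ?_ (by fun_prop)
        simpa using h1
      refine h2.eventually (hO2.mem_nhds ?_)
      simpa using hO1 (mem_image_of_mem _ (mem_image_of_mem _ hx)))
  rw [nhds_prod_eq, eventually_prod_iff] at hT
  obtain ⟨u, hu, v, hv, huv⟩ := hT
  obtain ⟨c, hc, hcv⟩ := Metric.eventually_nhds_iff.1 hv
  refine ⟨min c (1 / 2), by positivity, (min_le_right _ _).trans (by norm_num), ?_⟩
  filter_upwards [hu, hsep] with p hp hs r r0 rc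
  have hrS : r ≤ 1 / 2 := rc.trans (min_le_right _ _)
  have hmS : ∀ z ∈ Str r, z ∈ Str 1 := fun z hz => Str_mono (by linarith) hz
  intro z hz z' hz' hzz
  have := qmono (h.sh p) r0 (by linarith) hκ (half_pos hd) (fun x hx y hy hxy => ?_) ?_ hz hz' hzz
  · rw [hκe] at this; linarith
  · obtain ⟨k, hk⟩ := exists_FD x
    have h1 := abs_lt.1 (show |x.im| < r from hx)
    have h2 := abs_lt.1 (show |y.im| < r from hy)
    have h3 := abs_le.1 ((Complex.abs_re_le_norm (x - y)).trans_eq hxy)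
    rw [Complex.sub_re] at h3
    have hk1 : 0 < (x + k * tp).re := hk.1
    have hk2 : (x + k * tp).re ≤ 2 * π := hk.2
    have := hs (x + k * tp, y + k * tp) ⟨⟨⟨⟨hk1.le, hk2⟩, ?_⟩, ?_, ?_⟩, ?_⟩
    · rw [(h.sh p).e.int per_Str k (hmS x hx), (h.sh p).e.int per_Str k (hmS y hy), add_sub_add_right_eq_sub] at this
      exact this.le
    · rw [mem_preimage, im_tp]; constructor <;> linarith
    · rw [re_tp] at hk1 hk2
      rw [mem_preimage, re_tp]; constructor <;> linarith
    · rw [mem_preimage, im_tp]; constructor <;> linarith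
    · rw [mem_ofPred_eq, add_sub_add_right_eq_sub, hxy]
  · refine (Ar_le hO2.measurableSet ?_).trans_lt hO3
    rintro _ ⟨x, hx, rfl⟩
    obtain ⟨k, hk⟩ := exists_FD x
    refine ⟨k, ?_⟩
    rw [← (h.sh p).e.int per_Str k (hmS x hx)]
    have := huv hp (y := x.im) (hcv (by rw [dist_zero_right]; exact (show |x.im| < r from hx).trans_le (rc.trans (min_le_left _ _))))
      (x + k * tp).re ⟨hk.1.le, hk.2⟩
    convert this using 2
    apply Complex.ext <;> simp
theorem sel {P E : Type*} [TopologicalSpace P] [NormalSpace P] [ParacompactSpace P] [AddCommGroup E] [Module ℝ E]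
    [TopologicalSpace E] [ContinuousAdd E] [ContinuousSMul ℝ E] {t : P → Set E} (hc : ∀ p, Convex ℝ (t p))
    (H : ∀ p, ∃ c, ∀ᶠ q in 𝓝 p, c ∈ t q) {ta : P → P} (hσ : Continuous ta) (hσσ : ∀ p, ta (ta p) = p)
    {τ : E → E} (hτ : Continuous τ) (h2 : ∀ x y, τ ((1 / 2 : ℝ) • x + (1 / 2 : ℝ) • y) = (1 / 2 : ℝ) • τ x + (1 / 2 : ℝ) • τ y)
    (ht : ∀ p, ∀ c ∈ t p, τ c ∈ t (ta p)) (hττ : ∀ p, ∀ c ∈ t p, τ (τ c) = c) :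
    ∃ f : C(P, E), ∀ p, f p ∈ t p ∧ f (ta p) = τ (f p) := by
  obtain ⟨g, hg⟩ := exists_continuous_forall_mem_convex_of_local_const hc H
  refine ⟨⟨fun p => (1 / 2 : ℝ) • g p + (1 / 2 : ℝ) • τ (g (ta p)), by fun_prop⟩, fun p => ⟨?_, ?_⟩⟩
  · have := ht _ _ (hg (ta p))
    rw [hσσ] at this
    exact hc p (hg p) this (by norm_num) (by norm_num) (by norm_num)
  · simp only [ContinuousMap.coe_mk, h2, hσσ]
    rw [hττ _ _ (hg (ta p)), add_comm]
theorem lip_null {X Y : Type*} [EMetricSpace X] [MeasurableSpace X] [BorelSpace X] [EMetricSpace Y] [MeasurableSpace Y]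
    [BorelSpace Y] {f : X → Y} {C : NNReal} {A : Set X} (hf : LipschitzOnWith C f A)
    (h : Measure.hausdorffMeasure 2 A = 0) : Measure.hausdorffMeasure 2 (f '' A) = 0 := by
  have := hf.hausdorffMeasure_image_le (d := 2) (by norm_num)
  rw [h, mul_zero] at this
  exact le_antisymm this zero_le
theorem cH (A : Set ℂ) : volume A = 0 ↔ Measure.hausdorffMeasure 2 A = 0 := by
  have e : volume A = volume (Complex.equivRealProdCLM '' A) := by
    have := (Complex.volume_preserving_equiv_real_prod.symm).measure_preimage_equiv A
    rw [← this]; congr 1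
    ext z; 
    constructor
    · intro hz; exact ⟨_, hz, by apply Prod.ext <;> rfl⟩
    · rintro ⟨w, hw, rfl⟩; exact hw
  rw [e, ← hausdorffMeasure_prod_real]
  constructor
  · intro h
    have := lip_null (f := Complex.equivRealProdCLM.symm) (Complex.equivRealProdCLM.symm.lipschitz.lipschitzOnWith) h
    rwa [← image_comp, ContinuousLinearEquiv.symm_comp_self, image_id] at this
  · intro h
    exact lip_null (f := Complex.equivRealProdCLM) (Complex.equivRealProdCLM.lipschitz.lipschitzOnWith) h
theorem BL.mono {a : ℝ → ℝ} (h : BL a) : StrictMono a := fun x y hxy => by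
  obtain ⟨l, M, hl, h⟩ := h
  nlinarith [(h x y hxy.le).1]
theorem BL.lip {a : ℝ → ℝ} (h : BL a) : ∃ C : NNReal, LipschitzWith C a := by
  obtain ⟨l, M, hl, h⟩ := h
  have hM : 0 < M := by linarith [h 0 1 zero_le_one]
  have key : ∀ x y, x ≤ y → |a x - a y| ≤ M * |x - y| := fun x y hxy => by
    rw [abs_sub_comm, abs_sub_comm x, abs_of_nonneg (by linarith : 0 ≤ y - x), abs_of_nonneg]
    · exact (h x y hxy).2
    · nlinarith [(h x y hxy).1]
  refine ⟨M.toNNReal, LipschitzWith.of_dist_le_mul fun x y => ?_⟩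
  rw [Real.dist_eq, Real.dist_eq, Real.coe_toNNReal _ hM.le]
  rcases le_total x y with hxy | hxy
  · exact key x y hxy
  · rw [abs_sub_comm, abs_sub_comm x]; exact key y x hxy
theorem BL.surj {a : ℝ → ℝ} (h : BL a) : Function.Surjective a := by
  have hc := h.lip.choose_spec.continuous
  obtain ⟨l, M, hl, h⟩ := h
  refine hc.surjective ?_ ?_
  · refine tendsto_atTop_mono' _ ?_ ((tendsto_id.const_mul_atTop hl).atTop_add (tendsto_const_nhds (x := a 0)))
    filter_upwards [eventually_ge_atTop 0] with x hx
    rw [_root_.id]; linarith [(h 0 x hx).1]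
  · refine tendsto_atBot_mono' _ ?_ ((tendsto_id.const_mul_atBot hl).atBot_add (tendsto_const_nhds (x := a 0)))
    filter_upwards [eventually_le_atBot 0] with x hx
    rw [_root_.id]; linarith [(h x 0 hx).1]
noncomputable def iv (a : ℝ → ℝ) : ℝ → ℝ := Function.invFun a
theorem BL.r {a : ℝ → ℝ} (h : BL a) (x : ℝ) : a (iv a x) = x := Function.rightInverse_invFun h.surj x
theorem BL.l {a : ℝ → ℝ} (h : BL a) (x : ℝ) : iv a (a x) = x := Function.leftInverse_invFun h.mono.injective x
theorem BL.lt {a : ℝ → ℝ} (h : BL a) {x y : ℝ} : iv a x < y ↔ x < a y := by rw [← h.mono.lt_iff_lt, h.r]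
theorem BL.gt {a : ℝ → ℝ} (h : BL a) {x y : ℝ} : y < iv a x ↔ a y < x := by rw [← h.mono.lt_iff_lt, h.r]
theorem BL.iv {a : ℝ → ℝ} (h : BL a) : BL (iv a) := by
  have hr := h.r
  have hm := h.mono
  obtain ⟨l, M, hl, h⟩ := h
  have hM : 0 < M := by linarith [h 0 1 zero_le_one]
  refine ⟨M⁻¹, l⁻¹, by positivity, fun x y hxy => ?_⟩
  have := h (_root_.iv a x) (_root_.iv a y) (by rwa [← hm.le_iff_le, hr, hr])
  rw [hr, hr] at this
  constructor
  · rw [inv_mul_le_iff₀ hM]; exact this.2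
  · rw [le_inv_mul_iff₀ hl]; exact this.1
noncomputable def Pr (a α : ℝ → ℝ) (z : ℂ) : ℂ := ⟨a z.re, α z.im⟩
theorem Pr_NP {a α : ℝ → ℝ} (ha : BL a) (hα : BL α) : NP (Pr a α) := by
  obtain ⟨C, hC⟩ := ha.lip
  obtain ⟨D, hD⟩ := hα.lip
  intro A _ hA
  rw [cH] at hA ⊢
  refine lip_null (C := C + D) (LipschitzWith.lipschitzOnWith (LipschitzWith.of_dist_le_mul fun z w => ?_)) hA
  rw [Complex.dist_eq]
  refine (Complex.norm_le_abs_re_add_abs_im _).trans ?_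
  have h1 := hC.dist_le_mul z.re w.re
  have h2 := hD.dist_le_mul z.im w.im
  have h3 := Complex.abs_re_le_norm (z - w)
  have h4 := Complex.abs_im_le_norm (z - w)
  rw [Real.dist_eq] at h1 h2
  rw [Complex.sub_re] at h3
  rw [Complex.sub_im] at h4
  rw [Complex.dist_eq]
  push_cast
  have h5 := mul_le_mul_of_nonneg_left h3 C.2
  have h6 := mul_le_mul_of_nonneg_left h4 D.2
  have e1 : (Pr a α z - Pr a α w).re = a z.re - a w.re := rfl
  have e2 : (Pr a α z - Pr a α w).im = α z.im - α w.im := rfl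
  rw [e1, e2]
  rw [Real.dist_eq] at h1 h2
  simp only [NNReal.val_eq_coe] at h5 h6
  linarith
theorem iv_cont {P : Type*} [TopologicalSpace P] (a : C(P, C(ℝ, ℝ))) (h : ∀ p, BL (a p)) :
    Continuous fun q : P × ℝ => iv (a q.1) q.2 := by
  have hj : ∀ y : ℝ, Continuous fun q : P × ℝ => a q.1 y := fun y => by fun_prop
  rw [continuous_iff_continuousAt]
  rintro ⟨p, y⟩
  rw [ContinuousAt, tendsto_order]
  constructor
  · intro b hb
    filter_upwards [(hj b).continuousAt.eventually_lt continuous_snd.continuousAt ((h p).gt.1 hb)] with q hq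
    exact (h q.1).gt.2 hq
  · intro b hb
    filter_upwards [continuous_snd.continuousAt.eventually_lt (hj b).continuousAt ((h p).lt.1 hb)] with q hq
    exact (h q.1).lt.2 hq
structure Al (α : ℝ → ℝ) : Prop where
  bl : BL α
  o : ∀ x, α (-x) = -α x
  n : α 1 = 1
structure Ae (a : ℝ → ℝ) : Prop where
  bl : BL a
  e : ∀ x, a (x + 2 * π) = a x + 2 * π
theorem Al.iv {α : ℝ → ℝ} (h : Al α) : Al (iv α) :=
  ⟨h.bl.iv, fun x => h.bl.mono.injective (by rw [h.o, h.bl.r, h.bl.r]), h.bl.mono.injective (by rw [h.bl.r, h.n])⟩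
theorem Ae.iv {a : ℝ → ℝ} (h : Ae a) : Ae (iv a) :=
  ⟨h.bl.iv, fun x => h.bl.mono.injective (by rw [h.e, h.bl.r, h.bl.r])⟩
theorem Al.abs {α : ℝ → ℝ} (h : Al α) {v : ℝ} (hv : |v| < 1) : |α v| < 1 := by
  rw [abs_lt] at *
  have h1 := h.bl.mono hv.1
  have h2 := h.bl.mono hv.2
  rw [h.o] at h1
  rw [h.n] at h1 h2
  exact ⟨h1, h2⟩
theorem Pr_CF {P : Type*} [TopologicalSpace P] (a α : C(P, C(ℝ, ℝ))) (ha : ∀ p, Ae (a p)) (hα : ∀ p, Al (α p)) :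
    CF (fun p => Pr (a p) (α p)) (fun p => Pr (iv (a p)) (iv (α p))) := by
  have c0 : Continuous fun q : P × ℂ => Pr (a q.1) (α q.1) q.2 :=
    Complex.equivRealProdCLM.symm.continuous.comp (f := fun q : P × ℂ => (a q.1 q.2.re, α q.1 q.2.im)) (by fun_prop)
  have c1 : Continuous fun q : P × ℂ => Pr (iv (a q.1)) (iv (α q.1)) q.2 :=
    Complex.equivRealProdCLM.symm.continuous.comp (f := fun q : P × ℂ => (iv (a q.1) q.2.re, iv (α q.1) q.2.im))
      (((iv_cont a fun p => (ha p).bl).comp (f := fun q : P × ℂ => (q.1, q.2.re)) (by fun_prop)).prodMk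
      ((iv_cont α fun p => (hα p).bl).comp (f := fun q : P × ℂ => (q.1, q.2.im)) (by fun_prop)))
  refine ⟨fun p => ⟨(c0.comp (Continuous.prodMk_right p)).continuousOn, (c1.comp (Continuous.prodMk_right p)).continuousOn,
    fun z hz => (hα p).abs hz, fun z hz => (hα p).iv.abs hz, fun z _ => ?_, fun z _ => ?_, fun z _ => ?_⟩,
    c0.continuousOn, c1.continuousOn⟩
  · apply Complex.ext <;> simp [Pr, (ha p).bl.l, (hα p).bl.l]
  · apply Complex.ext <;> simp [Pr, (ha p).bl.r, (hα p).bl.r]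
  · apply Complex.ext <;> simp [Pr, (ha p).e]
theorem CF.mul {P : Type*} [TopologicalSpace P] {F Fi G Gi : P → ℂ → ℂ} (h : CF F Fi) (g : CF G Gi) :
    CF (fun p z => F p (G p z)) (fun p z => Gi p (Fi p z)) := by
  have hf := fun p => h.sh p
  have hg := fun p => g.sh p
  refine ⟨fun p => ⟨(hf p).cF.comp (hg p).cF (hg p).mF, (hg p).cI.comp (hf p).cI (hf p).mI, (hf p).mF.comp (hg p).mF,
    (hg p).mI.comp (hf p).mI, fun z hz => ?_, fun z hz => ?_, fun z hz => ?_⟩, ?_, ?_⟩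
  · rw [(hf p).l _ ((hg p).mF hz), (hg p).l z hz]
  · rw [(hg p).r _ ((hf p).mI hz), (hf p).r z hz]
  · rw [(hg p).e z hz, (hf p).e _ ((hg p).mF hz)]
  · exact h.c.comp (continuousOn_fst.prodMk g.c) fun q hq => ⟨trivial, (hg q.1).mF hq.2⟩
  · exact g.ci.comp (continuousOn_fst.prodMk h.ci) fun q hq => ⟨trivial, (hf q.1).mI hq.2⟩
theorem NP.comp {F G : ℂ → ℂ} (hF : NP F) (hG : NP G) (hm : MapsTo G (Str 1) (Str 1)) : NP fun z => F (G z) := by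
  intro A hA h0
  have := hF _ (image_subset_iff.2 fun z hz => hm (hA hz)) (hG A hA h0)
  rwa [← image_comp] at this
theorem alpha_loc {P : Type*} [TopologicalSpace P] {G Gi : P → ℂ → ℂ} (h : CF G Gi) {p0 : P} (hU : U2 (G p0))
    {s : ℝ} (hs : 0 < s) : ∃ α : ℝ → ℝ, Al α ∧ ∀ᶠ p in 𝓝 p0, ∀ z ∈ Str 1, |α (G p z).im - α z.im| < s := by
  obtain ⟨α, hb, ho, hn, hα⟩ := exists_alpha (h.sh p0) hU hs
  have hA : Al α := ⟨hb, ho, hn⟩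
  have hc := hb.lip.choose_spec.continuous
  refine ⟨α, hA, ?_⟩
  obtain ⟨e, he0, he1, he⟩ : ∃ e, 0 < e ∧ e < 1 ∧ 1 - s < α e := by
    have h1 : ∀ᶠ x in 𝓝[<] (1 : ℝ), 1 - s < α x := by
      refine nhdsWithin_le_nhds (hc.continuousAt.eventually (lt_mem_nhds (by rw [hn]; linarith)))
    have h2 : ∀ᶠ x in 𝓝[<] (1 : ℝ), x ∈ Ioo (0 : ℝ) 1 := Ioo_mem_nhdsLT one_pos
    obtain ⟨x, hx1, hx2⟩ := (h1.and h2).exists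
    exact ⟨x, hx2.1, hx2.2, hx1⟩
  obtain ⟨c, c0, c1, hU'⟩ := h.UF hU he1
  have hb1 : max c e < 1 := max_lt c1 he1
  have hT := tube (p0 := p0) (b := max c e) (R := fun p z => |α (G p z).im - α z.im| < s) (fun p z hz k hk => by
      rwa [(h.sh p).e.int per_Str k (mem_Str_of hb1 hz), im_tp, im_tp] at hk) (fun z hz => by
      have hz1 := mem_Str_of hb1 hz
      have hca : ContinuousAt (fun q : P × ℂ => |α (G q.1 q.2).im - α q.2.im|) (p0, z) :=
        ((hc.continuousAt.comp (Complex.continuous_im.continuousAt.comp (h.at p0 hz1))).sub (by fun_prop)).abs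
      exact hca.eventually_lt continuousAt_const (hα z hz1))
  filter_upwards [hT, hU'] with p h1 h2 z hz
  rcases le_or_gt |z.im| (max c e) with h3 | h3
  · exact h1 z h3
  have b1 := abs_lt.1 (hA.abs hz)
  have b2 := abs_lt.1 (hA.abs ((h.sh p).mF hz))
  rcases lt_abs.1 h3 with h4 | h4
  · have := hb.mono ((h2 z hz).1 ((le_max_left _ _).trans h4.le))
    have := hb.mono ((le_max_right _ _).trans_lt h4)
    rw [abs_lt]; constructor <;> linarith
  · have k1 := hb.mono ((h2 z hz).2 (by linarith [le_max_left c e]))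
    have k2 := hb.mono (show z.im < -e by linarith [le_max_right c e])
    rw [ho] at k1 k2
    rw [abs_lt]; constructor <;> linarith
theorem a_tube {P : Type*} [TopologicalSpace P] {G Gi : P → ℂ → ℂ} (h : CF G Gi) {p0 : P} {e' : ℝ} {a : ℝ → ℝ}
    (ha : Ae a) (h3 : ∀ x : ℝ, |a x - (Gi p0 x).re| < e') : ∀ᶠ p in 𝓝 p0, ∀ x : ℝ, |a x - (Gi p x).re| < e' := by
  have hc := ha.bl.lip.choose_spec.continuous
  have hper : ∀ x, ∀ k : ℤ, a (x + k * (2 * π)) = a x + k * (2 * π) := fun x k => by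
    have hp : Function.Periodic (fun x => a x - x) (2 * π) := fun x => by simp only [ha.e]; ring
    have := hp.zsmul k x
    simp only [zsmul_eq_mul] at this; linarith
  filter_upwards [tube (p0 := p0) (b := 0) (R := fun p z => |a z.re - (Gi p z).re| < e') (fun p z hz k hk => by
      rw [(h.sh p).ei.int per_Str k (mem_Str_of one_pos hz), re_tp, re_tp, hper] at hk
      rwa [add_sub_add_right_eq_sub] at hk) (fun z hz => by
      have hz1 := mem_Str_of one_pos hz
      have hca : ContinuousAt (fun q : P × ℂ => |a q.2.re - (Gi q.1 q.2).re|) (p0, z) :=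
        ((by fun_prop : ContinuousAt (fun q : P × ℂ => a q.2.re) (p0, z)).sub
          (Complex.continuous_re.continuousAt.comp (h.symm.at p0 hz1))).abs
      refine hca.eventually_lt continuousAt_const ?_
      have ez : z = z.re := by apply Complex.ext <;> simp; simpa using hz
      have := h3 z.re
      rwa [← ez] at this)] with p hp x
  simpa using hp x (by simp)
theorem a_loc {G Gi : ℂ → ℂ} (h : SH G Gi) {e : ℝ} (he : 0 < e)
    (hq : ∀ z ∈ Str 1, ∀ z' ∈ Str 1, (G z).re ≤ (G z').re → z.re ≤ z'.re + e) :
    ∃ a : ℝ → ℝ, Ae a ∧ ∀ x : ℝ, |a x - (Gi x).re| ≤ 2 * e := by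
  have hS := zero_mem_Str one_pos
  obtain ⟨a, h1, h2, h3⟩ := exists_a (b := fun x : ℝ => (Gi x).re) (ε := e)
    (Complex.continuous_re.comp (h.cI.comp_continuous Complex.continuous_ofReal hS))
    (fun x => by
      have := h.ei x (hS x)
      have e1 : ((x + 2 * π : ℝ) : ℂ) = x + tp := by simp [tp]
      rw [e1, this]; simp) he (fun x y hxy => hq _ (h.mI (hS x)) _ (h.mI (hS y)) (by
        rw [h.r _ (hS x), h.r _ (hS y)]; simpa using hxy))
  exact ⟨a, ⟨h1, h2⟩, h3⟩
theorem Al.id : Al fun x => x := ⟨BL.id, fun _ => rfl, rfl⟩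
theorem Ae.id : Ae fun x => x := ⟨BL.id, fun _ => rfl⟩
theorem BL.cm {a : ℝ → ℝ} (h : BL a) : ∃ c : C(ℝ, ℝ), ⇑c = a := ⟨⟨a, h.lip.choose_spec.continuous⟩, rfl⟩
abbrev PX (X : Type*) := X × Ioi (0 : ℝ)
theorem strip_main {X : Type*} [MetricSpace X] {F Fi : X → ℂ → ℂ} (h : CF F Fi)
    (hn : ∀ x, (F x 0).re + (F x π).re = π) (hU : ∀ x, U2 (F x)) (hN : ∀ x, NP (F x)) (hNi : ∀ x, NP (Fi x))
    {ta : X → X} (hσ : Continuous ta) (hσσ : ∀ x, ta (ta x) = x) (hσF : ∀ x, ∀ z ∈ Str 1, F (ta x) z = sgi (F x (sg z))) :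
    ∃ K Ki : X × Ioi (0 : ℝ) → ℂ → ℂ, CF K Ki ∧ (∀ p, U2 (K p)) ∧ (∀ p, NP (K p)) ∧ (∀ p, NP (Ki p)) ∧
      (∀ x s, 2 ≤ s.1 → ∀ z ∈ Str 1, K (x, s) z = F x z) ∧
      (∀ x s, (∀ z ∈ Str 1, F x z = z) → ∀ z ∈ Str 1, K (x, s) z = z) ∧
      (∀ x s, ∀ z ∈ Str 1, K (ta x, s) z = sgi (K (x, s) (sg z))) ∧
      (∀ x s, s.1 ≤ 1 → ∀ z ∈ Str 1, |(K (x, s) z).re - z.re| < s.1 ∧ |(K (x, s) z).im - z.im| < s.1) := by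
  let τt : PX X → PX X := fun p => (ta p.1, p.2)
  have hτ0 : Continuous τt := by fun_prop
  have hτt : ∀ p, τt (τt p) = p := fun p => Prod.ext (hσσ _) rfl
  have hs : ∀ p : PX X, 0 < p.2.1 := fun p => p.2.2
  have hsc : Continuous fun p : PX X => p.2.1 := by fun_prop
  have near : ∀ p : PX X, ∀ k < 1, ∀ᶠ q in 𝓝 p, k * p.2.1 < q.2.1 ∧ (p.2.1 < 2 → q.2.1 < 2) := fun p k hk => by
    have h1 := hsc.continuousAt.eventually (lt_mem_nhds (show k * p.2.1 < p.2.1 by nlinarith [hs p]))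
    by_cases h2 : p.2.1 < 2
    · filter_upwards [h1, hsc.continuousAt.eventually (gt_mem_nhds h2)] with q a b using ⟨a, fun _ => b⟩
    · filter_upwards [h1] with q a using ⟨a, fun hh => absurd hh h2⟩
  have far : ∀ p : PX X, 1 < p.2.1 → ∀ᶠ q in 𝓝 p, 1 < q.2.1 := fun p hp =>
    hsc.continuousAt.eventually (lt_mem_nhds hp)
  have hcF : CF (fun p : PX X => F p.1) (fun p : PX X => Fi p.1) := h.comp continuous_fst
  obtain ⟨ρ, hρ⟩ := sel (P := PX X) (E := ℝ) (t := fun p => {r | 0 < r ∧ r ≤ 1 ∧ (2 ≤ p.2.1 → r = 1) ∧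
      (p.2.1 ≤ 1 → ∀ r', 0 < r' → r' ≤ r → QM (F p.1) r' (p.2.1 / 4))}) (fun p => by
        intro x hx y hy a b ha hb hab
        have hm : a * x + b * y ≤ max x y := by
          have e : a * max x y + b * max x y = max x y := by rw [← add_mul, hab, one_mul]
          linarith [mul_le_mul_of_nonneg_left (le_max_left x y) ha, mul_le_mul_of_nonneg_left (le_max_right x y) hb]
        refine ⟨?_, hm.trans (max_le hx.2.1 hy.2.1), fun h2 => ?_, fun h1 r' h0 hr => ?_⟩
        · show 0 < a * x + b * y
          rcases ha.eq_or_lt with rfl | ha'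
          · have : b = 1 := by linarith
            rw [this]; linarith [hy.1]
          · nlinarith [mul_pos ha' hx.1, mul_nonneg hb hy.1.le]
        · rw [hx.2.2.1 h2, hy.2.2.1 h2]; simpa using hab
        · rcases le_max_iff.1 (hr.trans hm) with h3 | h3
          · exact hx.2.2.2 h1 r' h0 h3
          · exact hy.2.2.2 h1 r' h0 h3) (fun p => by
        rcases le_or_gt p.2.1 1 with h1 | h1
        · obtain ⟨c, c0, c1, hc⟩ := rho_loc hcF p (hN _) (e := p.2.1 / 8) (by linarith [hs p])
          refine ⟨c, ?_⟩
          filter_upwards [hc, near p (1 / 2) (by norm_num)] with q hq hq2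
          refine ⟨c0, c1, fun h2 => absurd (hq2.2 (by linarith)) (by linarith), fun _ r' h0 hr z hz z' hz' hzz => ?_⟩
          have := hq r' h0 hr z hz z' hz' hzz
          linarith
        · refine ⟨1, ?_⟩
          filter_upwards [far p h1] with q hq
          exact ⟨one_pos, le_rfl, fun _ => rfl, fun h2 => absurd h2 (by linarith)⟩) hτ0 hτt continuous_id
      (fun _ _ => rfl) (fun p c hc => ⟨hc.1, hc.2.1, hc.2.2.1, fun h1 r' h0 hr z hz z' hz' hzz => by
        have e := fun z hz => SH.G_sg (h.sh p.1) (h.sh (ta p.1)) h0 (hr.trans hc.2.1) (hσF _) (z := z) hz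
        have hzz' : (GU (F (ta p.1)) r' z).re ≤ (GU (F (ta p.1)) r' z').re := hzz
        rw [e z hz, e z' hz'] at hzz'
        have := hc.2.2.2 h1 r' h0 hr _ (sg_mem.2 hz) _ (sg_mem.2 hz') (by simpa [sgi] using hzz')
        simp [sg] at this; show z.re ≤ z'.re + p.2.1 / 4; linarith⟩) (fun _ _ _ => rfl)
  have r0 := fun p => (hρ p).1.1
  have r1 := fun p => (hρ p).1.2.1
  let G : PX X → ℂ → ℂ := fun p => GU (F p.1) (ρ p)
  let Gi : PX X → ℂ → ℂ := fun p => GiU (F p.1) (Fi p.1) (ρ p)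
  have hG : CF G Gi := (hcF.G ρ.continuous r0 r1).1
  have hGU : ∀ p, U2 (G p) := fun p => (h.sh p.1).U2_G (hn _) (hU _) (r0 p) (r1 p)
  have hGσ : ∀ p, ∀ z ∈ Str 1, G (τt p) z = sgi (G p (sg z)) := fun p z hz => by
    show GU (F (ta p.1)) (ρ (τt p)) z = _
    rw [(hρ p).2]
    exact SH.G_sg (h.sh p.1) (h.sh (ta p.1)) (r0 p) (r1 p) (hσF _) hz
  have hGiσ : ∀ p, ∀ z ∈ Str 1, Gi (τt p) z = sgi (Gi p (sg z)) := fun p z hz => by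
    have m := sgi_mem.2 ((hG.sh p).mI (sg_mem.2 hz))
    have := hGσ p _ m
    rw [sg_sgi, (hG.sh p).r _ (sg_mem.2 hz), sgi_sg] at this
    rw [← (hG.sh (τt p)).l _ m, this]
  obtain ⟨α, hα⟩ := sel (P := PX X) (E := C(ℝ, ℝ)) (t := fun p => {a | Al a ∧ (2 ≤ p.2.1 → ∀ x, a x = x) ∧
      (p.2.1 ≤ 1 → ∀ z ∈ Str 1, |a (G p z).im - a z.im| < p.2.1)}) (fun p => by
        intro x hx y hy a b ha hb hab
        refine ⟨⟨hx.1.bl.convex hy.1.bl ha hb hab, fun v => ?_, ?_⟩, fun h2 v => ?_, fun h1 z hz => ?_⟩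
        · simp [hx.1.o, hy.1.o]; ring
        · simp [hx.1.n, hy.1.n, hab]
        · simp [hx.2.1 h2, hy.2.1 h2, ← add_mul, hab]
        · have := convex_ball (0 : ℝ) p.2.1 (mem_ball_zero_iff.2 (hx.2.2 h1 z hz)) (mem_ball_zero_iff.2 (hy.2.2 h1 z hz)) ha hb hab
          rw [mem_ball_zero_iff] at this
          convert this using 1
          rw [Real.norm_eq_abs]; congr 1
          simp; ring) (fun p => by
        rcases le_or_gt p.2.1 1 with h1 | h1
        · obtain ⟨a, ha, hl⟩ := alpha_loc hG (hGU p) (half_pos (hs p))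
          obtain ⟨c, rfl⟩ := ha.bl.cm
          refine ⟨c, ?_⟩
          filter_upwards [hl, near p (1 / 2) (by norm_num)] with q hq hq2
          exact ⟨ha, fun h2 => absurd (hq2.2 (by linarith)) (by linarith), fun _ z hz => (hq z hz).trans (by linarith)⟩
        · refine ⟨ContinuousMap.id ℝ, ?_⟩
          filter_upwards [far p h1] with q hq
          exact ⟨Al.id, fun _ _ => rfl, fun h2 => absurd h2 (by linarith)⟩) hτ0 hτt continuous_id
      (fun _ _ => rfl) (fun p c hc => ⟨hc.1, hc.2.1, fun h1 z hz => by
        have := hc.2.2 h1 _ (sg_mem.2 hz)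
        rw [hGσ p z hz, id]
        have e1 : (sgi (G p (sg z))).im = -(G p (sg z)).im := by simp [sgi]
        have e2 : (sg z).im = -z.im := by simp [sg]
        rw [e2, hc.1.o, ← abs_neg] at this
        rw [e1, hc.1.o]
        convert this using 2; ring⟩) (fun _ _ _ => rfl)
  let T : C(ℝ, ℝ) := ⟨fun x => x + π, by fun_prop⟩
  obtain ⟨a, ha⟩ := sel (P := PX X) (E := C(ℝ, ℝ)) (t := fun p => {a | Ae a ∧ (2 ≤ p.2.1 ∨ (∀ z ∈ Str 1, F p.1 z = z) → ∀ x, a x = x) ∧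
      (p.2.1 ≤ 1 → ∀ x : ℝ, |a x - (Gi p x).re| < 5 / 8 * p.2.1)}) (fun p => by
        intro x hx y hy a b ha hb hab
        refine ⟨⟨hx.1.bl.convex hy.1.bl ha hb hab, fun v => ?_⟩, fun h2 v => ?_, fun h1 z => ?_⟩
        · simp [hx.1.e, hy.1.e]; linear_combination (2 * π) * hab
        · simp [hx.2.1 h2, hy.2.1 h2, ← add_mul, hab]
        · have := convex_ball (0 : ℝ) (5 / 8 * p.2.1) (mem_ball_zero_iff.2 (hx.2.2 h1 z)) (mem_ball_zero_iff.2 (hy.2.2 h1 z)) ha hb hab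
          rw [mem_ball_zero_iff] at this
          convert this using 1
          rw [Real.norm_eq_abs]; congr 1
          simp; linear_combination (Gi p z).re * hab) (fun p => by
        rcases le_or_gt p.2.1 1 with h1 | h1
        · by_cases hi : ∀ z ∈ Str 1, F p.1 z = z
          · refine ⟨ContinuousMap.id ℝ, ?_⟩
            filter_upwards [near p (9 / 10) (by norm_num), a_tube hG (p0 := p) (e' := 9 / 16 * p.2.1) Ae.id (fun x => by
              have hS := zero_mem_Str one_pos x
              have : Gi p x = x := by
                conv_lhs => rw [← SH.G_id (h.sh p.1) (r0 p) (r1 p) hi hS]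
                exact (hG.sh p).l _ hS
              rw [this]; simpa using hs p)] with q h2 h3
            exact ⟨Ae.id, fun _ _ => rfl, fun _ x => (h3 x).trans (by linarith)⟩
          · push Not at hi
            obtain ⟨z, hz, hzn⟩ := hi
            obtain ⟨a, ha, ha2⟩ := a_loc (hG.sh p) (e := p.2.1 / 4) (by linarith [hs p])
              ((hρ p).1.2.2.2 h1 _ (r0 p) le_rfl)
            have hne : ∀ᶠ q : PX X in 𝓝 p, F q.1 z ≠ z :=
              (ContinuousAt.comp (x := p) (f := fun q : PX X => (q, z)) (hcF.at p hz) (by fun_prop)).eventually_ne hzn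
            have hl := a_tube hG (p0 := p) (e' := 9 / 16 * p.2.1) ha (fun x => (ha2 x).trans_lt (by linarith [hs p]))
            obtain ⟨c, rfl⟩ := ha.bl.cm
            refine ⟨c, ?_⟩
            filter_upwards [near p (9 / 10) (by norm_num), hl, hne] with q h2 h3 h4
            refine ⟨ha, ?_, fun _ x => (h3 x).trans (by linarith)⟩
            rintro (h5 | h5)
            · exact absurd (h2.2 (by linarith)) (by linarith)
            · exact absurd (h5 z hz) h4
        · refine ⟨ContinuousMap.id ℝ, ?_⟩
          filter_upwards [far p h1] with q hq
          exact ⟨Ae.id, fun _ _ => rfl, fun h2 => absurd h2 (by linarith)⟩) hτ0 hτt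
      (τ := fun a => a.comp T - ContinuousMap.const ℝ π)
      ((ContinuousMap.continuous_precomp T).sub continuous_const)
      (fun x y => by ext v; simp; ring) (fun p c hc => ⟨⟨by
        exact ⟨hc.1.bl.choose, hc.1.bl.choose_spec.choose, hc.1.bl.choose_spec.choose_spec.1, fun x y hxy => by
          have := hc.1.bl.choose_spec.choose_spec.2 (x + π) (y + π) (by linarith)
          simpa [T] using this⟩
      , fun x => by
        have := hc.1.e (x + π)
        simp only [T, ContinuousMap.sub_apply, ContinuousMap.comp_apply, ContinuousMap.coe_mk, ContinuousMap.const_apply,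
          add_right_comm, this]; ring
      ⟩, by
        intro h2 x
        have : ∀ x, c x = x := hc.2.1 (h2.imp id fun h3 z hz => by
          have := h3 _ (sgi_mem.2 hz)
          rw [hσF _ _ (sgi_mem.2 hz), sg_sgi] at this
          rw [← sg_sgi (F p.1 z), this, sg_sgi])
        simp [T, this]
      , fun h1 x => by
        rw [hGiσ p _ (zero_mem_Str one_pos x)]
        have := hc.2.2 h1 (x + π)
        have e : sg (x : ℂ) = ((x + π : ℝ) : ℂ) := by simp [sg]
        rw [e]
        simpa [T, sgi] using this
      ⟩) (fun p c hc => by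
        ext x
        have := hc.1.e x
        simp only [T, ContinuousMap.sub_apply, ContinuousMap.comp_apply, ContinuousMap.coe_mk, ContinuousMap.const_apply]
        rw [add_assoc, ← two_mul, this]; ring
      )
  have hA := fun p => (ha p).1.1
  have hL := fun p => (hα p).1.1
  let Ic : C(PX X, C(ℝ, ℝ)) := ContinuousMap.const _ (ContinuousMap.id ℝ)
  have hI : ∀ p, Ae (Ic p) := fun _ => Ae.id
  have c1 := Pr_CF a α hA hL
  have c2 := Pr_CF Ic α hI hL
  have hK := (c1.mul hG).mul c2.symm
  have hid : ∀ p x, iv (Ic p) x = x := fun p x => BL.id.l x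
  refine ⟨_, _, hK, fun p => ?_, fun p => ?_, fun p => ?_, fun x s h2 z hz => ?_, fun x s hF z hz => ?_, fun x s z hz => ?_,
    fun x s h1 z hz => ?_⟩
  · obtain ⟨c, c0, c1, hc⟩ := hGU p
    have z0 : α p 0 = 0 := by have := (hL p).o 0; rw [neg_zero] at this; linarith
    have hm := (hL p).bl.mono
    refine ⟨α p c, by have := hm c0; rwa [z0] at this, by have := hm c1; rwa [(hL p).n] at this, fun z hz => ?_⟩
    have mz : Pr (iv (Ic p)) (iv (α p)) z ∈ Str 1 := (hL p).iv.abs hz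
    refine ⟨fun h1 => ?_, fun h1 => ?_⟩
    · have := hm ((hc _ mz).1 (hm.le_iff_le.1 (h1.trans_eq ((hL p).bl.r _).symm)))
      rw [z0] at this; exact this
    · have := hm ((hc _ mz).2 (hm.le_iff_le.1 (by rw [(hL p).o]; exact ((hL p).bl.r _).trans_le h1)))
      rw [z0] at this; exact this
  · exact ((Pr_NP (hA p).bl (hL p).bl).comp ((h.sh p.1).G_null (r0 p) (r1 p) (hN _)) (hG.sh p).mF).comp
      (Pr_NP (hI p).bl.iv (hL p).bl.iv) (c2.sh p).mI
  · exact (Pr_NP (hI p).bl (hL p).bl).comp (((h.sh p.1).Gi_null (r0 p) (r1 p) (hNi _)).comp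
      (Pr_NP (hA p).bl.iv (hL p).bl.iv) (c1.sh p).mI) ((hG.sh p).mI.comp (c1.sh p).mI)
  · have e1 := (hα (x, s)).1.2.1 h2
    have e2 := (ha (x, s)).1.2.1 (.inl h2)
    have e3 := (hρ (x, s)).1.2.2.1 h2
    have e4 : ∀ v, iv (α (x, s)) v = v := fun v => by conv_lhs => rw [← e1 v, (hL (x, s)).bl.l]
    have e5 : Pr (iv (Ic (x, s))) (iv (α (x, s))) z = z := Complex.ext (hid _ _) (e4 _)
    show Pr (a (x, s)) (α (x, s)) (GU (F x) (ρ (x, s)) (Pr (iv (Ic (x, s))) (iv (α (x, s))) z)) = _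
    rw [e5, e3, (h.sh x).G_one (hn x) hz]
    exact Complex.ext (e2 _) (e1 _)
  · have e2 := (ha (x, s)).1.2.1 (.inr hF)
    show Pr (a (x, s)) (α (x, s)) (GU (F x) (ρ (x, s)) (Pr (iv (Ic (x, s))) (iv (α (x, s))) z)) = _
    rw [(h.sh x).G_id (r0 (x, s)) (r1 (x, s)) hF ((c2.sh (x, s)).mI hz)]
    exact Complex.ext ((e2 _).trans (hid _ _)) ((hL _).bl.r _)
  · have ea : a (ta x, s) = _ := (ha (x, s)).2
    have eα : α (ta x, s) = α (x, s) := (hα (x, s)).2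
    have ew : Pr (iv (Ic (x, s))) (iv (α (x, s))) (sg z) = sg (Pr (iv (Ic (x, s))) (iv (α (x, s))) z) := by
      apply Complex.ext
      · simp [Pr, sg, hid]
      · simp [Pr, sg, (hL (x, s)).iv.o]
    show Pr (a (ta x, s)) (α (ta x, s)) (G (τt (x, s)) (Pr (iv (Ic (x, s))) (iv (α (ta x, s))) z)) =
      sgi (Pr (a (x, s)) (α (x, s)) (G (x, s) (Pr (iv (Ic (x, s))) (iv (α (x, s))) (sg z))))
    rw [ew, eα, ea, hGσ _ _ ((c2.sh (x, s)).mI hz)]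
    apply Complex.ext
    · simp [Pr, sgi, T]
    · simp [Pr, sgi, (hL (x, s)).o]
  · have mz := (c2.sh (x, s)).mI hz
    have k1 := (hα (x, s)).1.2.2 h1 _ mz
    have k2 := (ha (x, s)).1.2.2 h1 (G (x, s) (Pr (iv (Ic (x, s))) (iv (α (x, s))) z)).re
    have k3 := (hρ (x, s)).1.2.2.2 h1 _ (r0 _) le_rfl
    refine ⟨?_, ?_⟩
    · set w := Pr (iv (Ic (x, s))) (iv (α (x, s))) z with hw
      have hR := zero_mem_Str one_pos (G (x, s) w).re
      have mi := (hG.sh (x, s)).mI hR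
      have er : (G (x, s) (Gi (x, s) (G (x, s) w).re)).re = (G (x, s) w).re := by
        rw [(hG.sh (x, s)).r _ hR]; simp
      have q1 := k3 _ mi _ mz er.le
      have q2 := k3 _ mz _ mi er.ge
      have ewz : w.re = z.re := hid _ _
      rw [ewz] at q1 q2
      show |a (x, s) (G (x, s) w).re - z.re| < s.1
      rw [abs_lt] at k2 ⊢
      dsimp only at k2 q1 q2
      constructor <;> linarith [k2.1, k2.2, hs (x, s)]
    · have : α (x, s) (Pr (iv (Ic (x, s))) (iv (α (x, s))) z).im = z.im := (hL _).bl.r _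
      rw [this] at k1
      exact k1
noncomputable section
theorem cgraph {X Y : Type*} [TopologicalSpace X] [TopologicalSpace Y] [CompactSpace Y] {f : X → Y}
    (h : IsClosed {p : X × Y | f p.1 = p.2}) : Continuous f := by
  rw [continuous_iff_isClosed]
  intro C hC
  convert isClosedMap_fst_of_compactSpace (X := X) _ (h.inter (hC.preimage continuous_snd)) using 1
  ext x; constructor
  · intro hx; exact ⟨(x, f x), ⟨rfl, hx⟩, rfl⟩
  · rintro ⟨⟨a, b⟩, ⟨h1, h2⟩, rfl⟩
    have h1 : f a = b := h1
    show f a ∈ C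
    rw [h1]; exact h2
theorem c1_null {V W : Type*} [NormedAddCommGroup V] [NormedSpace ℝ V] [MeasurableSpace V] [BorelSpace V]
    [SecondCountableTopology V] [NormedAddCommGroup W] [NormedSpace ℝ W] [MeasurableSpace W] [BorelSpace W]
    {φ : V → W} {A : Set V} (hφ : ∀ x ∈ A, ContDiffAt ℝ 1 φ x) (h : Measure.hausdorffMeasure 2 A = 0) :
    Measure.hausdorffMeasure 2 (φ '' A) = 0 := by
  have : ∀ x, ∃ t : Set V, x ∈ A → t ∈ 𝓝 x ∧ ∃ K, LipschitzOnWith K φ t := fun x => by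
    by_cases hx : x ∈ A
    · obtain ⟨K, t, ht, hK⟩ := (hφ x hx).exists_lipschitzOnWith
      exact ⟨t, fun _ => ⟨ht, K, hK⟩⟩
    · exact ⟨univ, fun h => absurd h hx⟩
  choose t ht using this
  obtain ⟨s, hs, hc, hA⟩ := TopologicalSpace.countable_cover_nhdsWithin (s := A) (f := t)
    (fun x hx => mem_nhdsWithin_of_mem_nhds (ht x hx).1)
  have : φ '' A ⊆ ⋃ x ∈ s, φ '' (A ∩ t x) := by
    rintro _ ⟨y, hy, rfl⟩
    obtain ⟨x, hx, hyx⟩ := mem_iUnion₂.1 (hA hy)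
    exact mem_iUnion₂.2 ⟨x, hx, y, ⟨hy, hyx⟩, rfl⟩
  refine measure_mono_null this ((measure_biUnion_null_iff hc).2 fun x hx => ?_)
  obtain ⟨K, hK⟩ := (ht x (hs hx)).2
  exact lip_null (hK.mono inter_subset_right) (measure_mono_null inter_subset_left h)
theorem nul (B : Set Sph) : μSph B = 0 ↔ Measure.hausdorffMeasure 2 ((↑) '' B : Set E3) = 0 := by
  rw [isometry_subtype_coe.hausdorffMeasure_image (.inl zero_le_two)]; rfl
theorem nm {f : Sph → Sph} {φ : E3 → E3} (hφ : ∀ x : Sph, ContDiffAt ℝ 1 φ x) (hf : ∀ x, (f x : E3) = φ x)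
    (A : Set Sph) (h : μSph A = 0) : μSph (f '' A) = 0 := by
  rw [nul] at h ⊢
  have := c1_null (φ := φ) (by rintro _ ⟨x, _, rfl⟩; exact hφ x) h
  rw [image_image] at this ⊢
  simpa only [hf] using this
def mkH (f fi : Sph → Sph) (cf : Continuous f) (l : ∀ x, fi (f x) = x) (r : ∀ x, f (fi x) = x)
    (nf : ∀ A, μSph A = 0 → μSph (f '' A) = 0) (nfi : ∀ A, μSph A = 0 → μSph (fi '' A) = 0) : HomNS2 :=
  ⟨⟨f, cf⟩, isHomeomorph_iff_continuous_bijective.2 ⟨cf, Function.LeftInverse.injective l, Function.RightInverse.surjective r⟩,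
    fun A => ⟨nf A, fun h => by
      have := nfi _ h
      rwa [image_image, show (fun x => fi ((⟨f, cf⟩ : C(Sph, Sph)) x)) = id from funext l, image_id] at this⟩⟩
theorem HomNS2.ext' {f g : HomNS2} (h : ∀ x, f.1 x = g.1 x) : f = g := Subtype.ext (ContinuousMap.ext h)
def hc (f g : HomNS2) : HomNS2 := ⟨f.1.comp g.1, f.2.1.comp g.2.1, fun A => by
  rw [g.2.2, f.2.2, ← image_comp]; rfl⟩
def hi (f : HomNS2) : HomNS2 := mkH f.2.1.homeomorph.symm f.1 f.2.1.homeomorph.symm.continuous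
  (fun x => f.2.1.homeomorph.apply_symm_apply x) (fun x => f.2.1.homeomorph.symm_apply_apply x)
  (fun A h => by
    rw [f.2.2, image_image]
    rwa [show (fun x => f.1 (f.2.1.homeomorph.symm x)) = id from funext fun x => f.2.1.homeomorph.apply_symm_apply x, image_id])
  (fun A h => (f.2.2 A).1 h)
@[simp] theorem hi_l (f : HomNS2) (x : Sph) : (hi f).1 (f.1 x) = x := f.2.1.homeomorph.symm_apply_apply x
@[simp] theorem hi_r (f : HomNS2) (x : Sph) : f.1 ((hi f).1 x) = x := f.2.1.homeomorph.apply_symm_apply x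
theorem c_ev : Continuous fun q : HomNS2 × Sph => q.1.1 q.2 := by fun_prop
theorem c_hi : Continuous fun q : HomNS2 × Sph => (hi q.1).1 q.2 := by
  apply cgraph
  have : {p : (HomNS2 × Sph) × Sph | (hi p.1.1).1 p.1.2 = p.2} = {p | p.1.1.1 p.2 = p.1.2} := by
    ext ⟨⟨f, x⟩, y⟩
    constructor
    · rintro (h : (hi f).1 x = y)
      show f.1 y = x
      rw [← h, hi_r]
    · rintro (h : f.1 y = x)
      show (hi f).1 x = y
      rw [← h, hi_l]
  rw [this]
  exact isClosed_eq (c_ev.comp (by fun_prop : Continuous fun p : (HomNS2 × Sph) × Sph => (p.1.1, p.2))) (by fun_prop)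
abbrev O3 := Matrix.orthogonalGroup (Fin 3) ℝ
theorem cont_hom {P : Type*} [TopologicalSpace P] {f : P → HomNS2} (h : Continuous fun q : P × Sph => (f q.1).1 q.2) :
    Continuous f :=
  continuous_induced_rng.2 (ContinuousMap.continuous_of_continuous_uncurry _ h)
def mvE (M : Matrix (Fin 3) (Fin 3) ℝ) (x : E3) : E3 := WithLp.toLp 2 (M.mulVec x.ofLp)
theorem mvE_c : Continuous fun q : Matrix (Fin 3) (Fin 3) ℝ × E3 => mvE q.1 q.2 := by
  unfold mvE
  exact (PiLp.continuous_toLp 2 _).comp (continuous_fst.matrix_mulVec ((PiLp.continuous_ofLp 2 _).comp continuous_snd))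
theorem mvE_mul (M N : Matrix (Fin 3) (Fin 3) ℝ) (x : E3) : mvE (M * N) x = mvE M (mvE N x) := by
  simp [mvE, Matrix.mulVec_mulVec]
theorem mvE_norm (M : O3) (x : E3) : ‖mvE M.1 x‖ = ‖x‖ := by
  have h := M.2
  rw [Matrix.mem_orthogonalGroup_iff'] at h
  have e : ∀ y : E3, ‖y‖ ^ 2 = y.ofLp ⬝ᵥ y.ofLp := fun y => by
    rw [EuclideanSpace.real_norm_sq_eq]; simp [dotProduct, sq]
  have : ‖mvE M.1 x‖ ^ 2 = ‖x‖ ^ 2 := by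
    rw [e, e]
    simp only [mvE]
    rw [Matrix.dotProduct_mulVec, Matrix.vecMul_mulVec, h, Matrix.vecMul_one]
  exact (sq_eq_sq₀ (norm_nonneg _) (norm_nonneg _)).1 this
def mv (M : O3) (x : Sph) : Sph := ⟨mvE M.1 x, by simp [mvE_norm]⟩
@[simp] theorem mv_mul (M N : O3) (x : Sph) : mv (M * N) x = mv M (mv N x) := Subtype.ext (mvE_mul _ _ _)
@[simp] theorem mv_one (x : Sph) : mv 1 x = x := Subtype.ext (by simp [mv, mvE])
@[simp] theorem mv_inv (M : O3) (x : Sph) : mv M⁻¹ (mv M x) = x := by rw [← mv_mul]; simp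
@[simp] theorem mv_inv' (M : O3) (x : Sph) : mv M (mv M⁻¹ x) = x := by rw [← mv_mul]; simp
theorem mv_c : Continuous fun q : O3 × Sph => mv q.1 q.2 :=
  Continuous.subtype_mk (mvE_c.comp (by fun_prop : Continuous fun q : O3 × Sph => (q.1.1, (q.2 : E3)))) _
theorem mvE_cd (M : Matrix (Fin 3) (Fin 3) ℝ) (x : E3) : ContDiffAt ℝ 1 (mvE M) x := by
  have : ContDiff ℝ 1 (mvE M) := by
    unfold mvE
    rw [contDiff_euclidean]
    intro i
    simp only [Matrix.mulVec, dotProduct]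
    fun_prop
  exact this.contDiffAt
def om (M : O3) : HomNS2 := mkH (mv M) (mv M⁻¹) (mv_c.comp (by fun_prop : Continuous fun x => (M, x))) (mv_inv M) (mv_inv' M)
  (nm (fun _ => mvE_cd M.1 _) fun _ => rfl) (nm (fun _ => mvE_cd M⁻¹.1 _) fun _ => rfl)
instance : CompactSpace O3 := by
  suffices hk : IsCompact (O3 : Set (Matrix (Fin 3) (Fin 3) ℝ)) from isCompact_iff_compactSpace.1 hk
  have hcl : IsClosed (O3 : Set (Matrix (Fin 3) (Fin 3) ℝ)) := by
    have : (O3 : Set (Matrix (Fin 3) (Fin 3) ℝ)) = {A | A.transpose * A = 1} := by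
      ext A; exact Matrix.mem_orthogonalGroup_iff' _ _
    rw [this]
    exact isClosed_eq (by fun_prop) continuous_const
  refine IsCompact.of_isClosed_subset (isCompact_univ_pi fun i => isCompact_univ_pi fun j => isCompact_Icc (a := (-1 : ℝ)) (b := 1)) hcl ?_
  intro A hA i _ j _
  have h1 := (Matrix.mem_orthogonalGroup_iff' _ _).1 hA
  have h2 := congrFun (congrFun h1 j) j
  simp only [Matrix.mul_apply, Matrix.transpose_apply, Matrix.one_apply_eq] at h2
  have h3 : A i j * A i j ≤ 1 := h2 ▸ Finset.single_le_sum (f := fun k => A k j * A k j) (fun k _ => mul_self_nonneg _) (Finset.mem_univ i)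
  exact ⟨by nlinarith, by nlinarith⟩
def an : O3 := ⟨-1, by rw [Matrix.mem_orthogonalGroup_iff']; simp⟩
theorem an_v (x : Sph) : (mv an x : E3) = -x := by
  ext i; simp [mv, mvE, an, Matrix.neg_mulVec]
theorem an_an (x : Sph) : mv an (mv an x) = x := Subtype.ext (by simp [an_v])
theorem an_mul (M : O3) : an * M = M * an := Subtype.ext (by simp [an])
theorem an_mv (M : O3) (x : Sph) : mv an (mv M x) = mv M (mv an x) := by rw [← mv_mul, an_mul, mv_mul]
def pN : Sph := ⟨!₂[0, 0, 1], by simp [EuclideanSpace.norm_eq, Fin.sum_univ_three]⟩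
def pS : Sph := mv an pN
noncomputable section
def cl (v : ℝ) : ℝ := max (-1) (min v 1)
theorem cl_c : Continuous cl := by unfold cl; fun_prop
theorem cl_sq (v : ℝ) : 0 ≤ 1 - cl v ^ 2 := by
  have h1 : -1 ≤ cl v := le_max_left _ _
  have h2 : cl v ≤ 1 := max_le (by norm_num) (min_le_right _ _)
  nlinarith
theorem cl_id {z : ℂ} (hz : z ∈ Str 1) : cl z.im = z.im := by
  have h : -1 < z.im ∧ z.im < 1 := abs_lt.1 hz
  rw [cl, min_eq_left h.2.le, max_eq_right h.1.le]
def eE (z : ℂ) : E3 := !₂[√(1 - cl z.im ^ 2) * Real.cos z.re, √(1 - cl z.im ^ 2) * Real.sin z.re, cl z.im]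
theorem sp_iff (x : E3) : ‖x‖ = 1 ↔ x 0 ^ 2 + x 1 ^ 2 + x 2 ^ 2 = 1 := by
  rw [← sq_eq_sq₀ (norm_nonneg _) zero_le_one, EuclideanSpace.real_norm_sq_eq, Fin.sum_univ_three, one_pow]
def Es (z : ℂ) : Sph := ⟨eE z, by
  rw [mem_sphere_zero_iff_norm, sp_iff]
  simp only [eE]
  simp
  rw [mul_pow, mul_pow, Real.sq_sqrt (cl_sq _)]
  linear_combination (1 - cl z.im ^ 2) * Real.cos_sq_add_sin_sq z.re⟩
theorem Es_c : Continuous Es := by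
  refine Continuous.subtype_mk ?_ _
  unfold eE
  refine (PiLp.continuous_toLp 2 _).comp ?_
  have := cl_c
  refine continuous_pi fun i => ?_
  fin_cases i <;> simp <;> fun_prop
def xy (p : Sph) : ℂ := ⟨(p : E3) 0, (p : E3) 1⟩
def ht (p : Sph) : ℝ := (p : E3) 2
theorem xy_c : Continuous xy := by
  have : xy = fun p : Sph => ((p : E3) 0 : ℂ) + ((p : E3) 1 : ℂ) * Complex.I := by
    ext p; apply Complex.ext <;> simp [xy]
  rw [this]; fun_prop
theorem ht_c : Continuous ht := by unfold ht; fun_prop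
theorem sp_eq {p q : Sph} (h : xy p = xy q) (h' : ht p = ht q) : p = q := by
  apply Subtype.ext; ext i
  fin_cases i
  · exact congrArg Complex.re h
  · exact congrArg Complex.im h
  · exact h'
theorem sp_sq (p : Sph) : ‖xy p‖ ^ 2 = 1 - ht p ^ 2 := by
  have := (sp_iff p).1 (mem_sphere_zero_iff_norm.1 p.2)
  rw [Complex.sq_norm, Complex.normSq_apply]
  simp only [xy, ht]; linarith
theorem xy_ne {p : Sph} : xy p ≠ 0 ↔ |ht p| < 1 := by
  rw [← norm_pos_iff, ← sq_lt_one_iff_abs_lt_one]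
  have := sp_sq p
  constructor
  · intro h; nlinarith
  · intro h
    by_contra h0
    have : ‖xy p‖ = 0 := le_antisymm (not_lt.1 h0) (norm_nonneg _)
    nlinarith
theorem ht_pN : ht pN = 1 := by simp [ht, pN]
theorem ht_an (p : Sph) : ht (mv an p) = -ht p := by simp [ht, an_v]
theorem xy_an (p : Sph) : xy (mv an p) = -xy p := by apply Complex.ext <;> simp [xy, an_v]
theorem ht_pS : ht pS = -1 := by rw [pS, ht_an, ht_pN]
theorem xy_pole {p : Sph} (h : ht p ^ 2 = 1) : xy p = 0 := by
  have := sp_sq p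
  rw [h, sub_self] at this
  exact norm_eq_zero.1 (pow_eq_zero_iff two_ne_zero |>.1 this)
theorem eq_pN {p : Sph} (h : ht p = 1) : p = pN :=
  sp_eq (by rw [xy_pole (by rw [h]; norm_num), xy_pole (by rw [ht_pN]; norm_num)]) (by rw [h, ht_pN])
theorem eq_pS {p : Sph} (h : ht p = -1) : p = pS :=
  sp_eq (by rw [xy_pole (by rw [h]; norm_num), xy_pole (by rw [ht_pS]; norm_num)]) (by rw [h, ht_pS])
theorem ht_le (p : Sph) : |ht p| ≤ 1 := by
  rw [← sq_le_one_iff_abs_le_one]; nlinarith [sp_sq p, sq_nonneg ‖xy p‖]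
theorem poles (p : Sph) : |ht p| < 1 ∨ p = pN ∨ p = pS := by
  rcases (ht_le p).lt_or_eq with h | h
  · exact .inl h
  · rcases eq_or_eq_neg_of_abs_eq h with h | h
    · exact .inr (.inl (eq_pN h))
    · exact .inr (.inr (eq_pS h))
def un (w : ℂ) : Circle := Circle.exp w.arg
theorem un_mul (w : ℂ) : (‖w‖ : ℂ) * un w = w := by simp [un, Complex.norm_mul_exp_arg_mul_I]
theorem un_eq {w : ℂ} {r : ℝ} {u : Circle} (hr : 0 < r) (h : w = r * u) : un w = u := by
  have hn : ‖w‖ = r := by rw [h, norm_mul, Circle.norm_coe]; simp [abs_of_pos hr]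
  have := un_mul w
  rw [hn] at this
  exact Subtype.ext (mul_left_cancel₀ (Complex.ofReal_ne_zero.2 hr.ne') (this.trans h))
theorem un_mul_u {w : ℂ} (hw : w ≠ 0) (u : Circle) : un (u * w) = u * un w :=
  un_eq (norm_pos_iff.2 hw) (by push_cast; conv_lhs => rw [← un_mul w]
                                ring)
theorem un_conj {w : ℂ} (hw : w ≠ 0) : un (conj w) = (un w)⁻¹ :=
  un_eq (norm_pos_iff.2 hw) (by conv_lhs => rw [← un_mul w]
                                rw [Circle.coe_inv_eq_conj]; simp)
theorem un_c : ContinuousOn un {w | w ≠ 0} := by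
  rw [(show IsEmbedding (fun u : Circle => (u : ℂ)) from IsEmbedding.subtypeVal).continuousOn_iff]
  have : ContinuousOn (fun w : ℂ => w / ‖w‖) {w | w ≠ 0} :=
    continuousOn_id.div (by fun_prop) (fun w hw => by simpa using hw)
  refine this.congr fun w hw => ?_
  have h0 : (‖w‖ : ℂ) ≠ 0 := by simpa using hw
  show (un w : ℂ) = _
  rw [eq_div_iff h0, mul_comm]; exact un_mul w
theorem Es_ht {z : ℂ} (hz : z ∈ Str 1) : ht (Es z) = z.im := by
  simp [ht, Es, eE, cl_id hz]
theorem Es_lt {z : ℂ} (hz : z ∈ Str 1) : |ht (Es z)| < 1 := by rw [Es_ht hz]; exact hz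
theorem Es_xy (z : ℂ) : xy (Es z) = (√(1 - cl z.im ^ 2) : ℝ) * Circle.exp z.re := by
  apply Complex.ext <;> simp [xy, Es, eE, Complex.exp_re, Complex.exp_im]
theorem Es_un {z : ℂ} (hz : z ∈ Str 1) : un (xy (Es z)) = Circle.exp z.re :=
  un_eq (Real.sqrt_pos.2 (by rw [cl_id hz, sub_pos]; exact (sq_lt_one_iff_abs_lt_one _).2 hz)) (Es_xy z)
theorem Es_of {p : Sph} (hp : |ht p| < 1) {z : ℂ} (h1 : Circle.exp z.re = un (xy p)) (h2 : z.im = ht p) :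
    z ∈ Str 1 ∧ Es z = p := by
  have hz : z ∈ Str 1 := by show |z.im| < 1; rwa [h2]
  refine ⟨hz, sp_eq ?_ ((Es_ht hz).trans h2)⟩
  rw [Es_xy, h1, cl_id hz, h2, ← sp_sq, Real.sqrt_sq (norm_nonneg _), un_mul]
theorem Es_inj {z w : ℂ} (hz : z ∈ Str 1) (hw : w ∈ Str 1) (h : Es z = Es w) : ∃ k : ℤ, z = w + k * tp := by
  have h1 : Circle.exp z.re = Circle.exp w.re := by rw [← Es_un hz, h, Es_un hw]
  obtain ⟨k, hk⟩ := Circle.exp_eq_exp.1 h1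
  refine ⟨k, Complex.ext (by rw [re_tp, hk]) (by rw [im_tp, ← Es_ht hz, h, Es_ht hw])⟩
theorem Es_tp (z : ℂ) : Es (z + tp) = Es z := by
  apply Subtype.ext; simp [Es, eE]
theorem Es_tpk (z : ℂ) (k : ℤ) : Es (z + k * tp) = Es z := by
  apply Subtype.ext; simp [Es, eE]
theorem Es_sg {z : ℂ} (hz : z ∈ Str 1) : Es (sg z) = mv an (Es z) := by
  refine (Es_of (by rw [ht_an, abs_neg]; exact Es_lt hz) ?_ ?_).2
  · rw [xy_an, ← neg_one_mul]
    have := un_mul_u (xy_ne.2 (Es_lt hz)) (Circle.exp π)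
    rw [show ((Circle.exp π : Circle) : ℂ) = -1 by simp] at this
    rw [this, Es_un hz, ← Circle.exp_add]; simp [sg, add_comm]
  · rw [ht_an, Es_ht hz]; simp [sg]
theorem Es_sgi {z : ℂ} (hz : z ∈ Str 1) : Es (sgi z) = mv an (Es z) := by
  rw [← an_an (Es (sgi z)), ← Es_sg (sgi_mem.2 hz), sg_sgi]
def ch (p : Sph) : ℂ := ⟨(xy p).arg, ht p⟩
theorem ch_spec {p : Sph} (hp : |ht p| < 1) : ch p ∈ Str 1 ∧ Es (ch p) = p := Es_of hp rfl rfl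
theorem ch_Es {z : ℂ} (hz : z ∈ Str 1) : ∃ k : ℤ, ch (Es z) = z + k * tp :=
  Es_inj (ch_spec (Es_lt hz)).1 hz (ch_spec (Es_lt hz)).2
noncomputable section
def rx (θ : ℝ) (p : E3) : ℂ := Circle.exp (-θ) * ((p 0 : ℝ) + (p 1 : ℝ) * Complex.I)
def chx (θ : ℝ) (p : E3) : ℂ := (θ + (Complex.log (rx θ p)).im : ℝ) + (p 2 : ℝ) * Complex.I
theorem rx_Es (θ : ℝ) {w : ℂ} (hw : w ∈ Str 1) (h : |w.re - θ| < π) :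
    rx θ (Es w) ∈ Complex.slitPlane ∧ chx θ (Es w) = w := by
  have e1 : rx θ (Es w) = (‖xy (Es w)‖ : ℝ) * (Complex.cos (w.re - θ : ℝ) + Complex.sin (w.re - θ : ℝ) * Complex.I) := by
    have : ((((Es w : E3) 0 : ℝ) : ℂ) + ((Es w : E3) 1 : ℝ) * Complex.I) = xy (Es w) := by apply Complex.ext <;> simp [xy]
    rw [rx, this, ← Complex.exp_mul_I, ← Circle.coe_exp, sub_eq_add_neg, Circle.exp_add, ← Es_un hw]
    conv_lhs => rw [← un_mul (xy (Es w))]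
    push_cast; ring
  have h2 := abs_lt.1 h
  have ha : (rx θ (Es w)).arg = w.re - θ := by
    rw [e1, Complex.arg_mul_cos_add_sin_mul_I (norm_pos_iff.2 (xy_ne.2 (Es_lt hw))) ⟨h2.1, h2.2.le⟩]
  refine ⟨?_, ?_⟩
  · rw [Complex.mem_slitPlane_iff_arg, ha]
    refine ⟨h2.2.ne, ?_⟩
    rw [rx]
    refine mul_ne_zero (Circle.coe_ne_zero _) ?_
    have := xy_ne.2 (Es_lt hw)
    contrapose! this
    apply Complex.ext
    · simpa [xy] using congrArg Complex.re this
    · simpa [xy] using congrArg Complex.im this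
  · rw [chx, Complex.log_im, ha]
    have := Es_ht hw
    apply Complex.ext
    · simp
    · simpa [ht] using this
theorem rx_cd (θ : ℝ) (p : E3) : ContDiffAt ℝ 1 (rx θ) p := by
  have : ContDiff ℝ 1 (rx θ) := by
    unfold rx
    have : ∀ i : Fin 3, ContDiff ℝ 1 (fun x : E3 => ((x i : ℝ) : ℂ)) := fun i =>
      Complex.ofRealCLM.contDiff.comp (by fun_prop)
    exact contDiff_const.mul ((this 0).add ((this 1).mul contDiff_const))
  exact this.contDiffAt
theorem chx_cd (θ : ℝ) (p : E3) (h : rx θ p ∈ Complex.slitPlane) : ContDiffAt ℝ 1 (chx θ) p := by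
  unfold chx
  have h1 : ContDiffAt ℝ 1 (fun p => (Complex.log (rx θ p)).im) p :=
    Complex.imCLM.contDiff.contDiffAt.comp p (((Complex.contDiffAt_log h).restrict_scalars ℝ).comp p (rx_cd θ p))
  have h2 : ContDiffAt ℝ 1 (fun x : E3 => ((x 2 : ℝ) : ℂ)) p :=
    (Complex.ofRealCLM.contDiff.comp (by fun_prop : ContDiff ℝ 1 fun x : E3 => x 2)).contDiffAt
  exact ((Complex.ofRealCLM.contDiff.contDiffAt.comp p (contDiffAt_const.add h1))).add (h2.mul contDiffAt_const)
theorem NE2 {B : Set Sph} (h : μSph B = 0) : volume (Str 1 ∩ Es ⁻¹' B) = 0 := by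
  refine measure_null_of_locally_null _ fun z hz => ⟨{w | |w.re - z.re| < π} ∩ (Str 1 ∩ Es ⁻¹' B), ?_, ?_⟩
  · refine inter_mem (mem_nhdsWithin_of_mem_nhds ?_) self_mem_nhdsWithin
    refine (isOpen_lt (by fun_prop) continuous_const).mem_nhds ?_
    show |z.re - z.re| < _
    simp [Real.pi_pos]
  · rw [nul] at h
    rw [cH]
    have := c1_null (φ := chx z.re) (A := (↑) '' B ∩ {p | rx z.re p ∈ Complex.slitPlane}) (fun x hx => chx_cd _ _ hx.2)
      (measure_mono_null inter_subset_left h)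
    refine measure_mono_null ?_ this
    rintro w ⟨h1, h2, h3⟩
    have := rx_Es z.re h2 h1
    exact ⟨Es w, ⟨⟨_, h3, rfl⟩, this.1⟩, this.2⟩
theorem eE_cd {z : ℂ} (hz : z ∈ Str 1) : ContDiffAt ℝ 1 eE z := by
  have : eE =ᶠ[𝓝 z] fun z => !₂[√(1 - z.im ^ 2) * Real.cos z.re, √(1 - z.im ^ 2) * Real.sin z.re, z.im] := by
    filter_upwards [isOpen_Str.mem_nhds hz] with w hw
    rw [eE, cl_id hw]
  refine ContDiffAt.congr_of_eventuallyEq ?_ this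
  have hp : 1 - z.im ^ 2 ≠ 0 := (sub_pos.2 ((sq_lt_one_iff_abs_lt_one _).2 hz)).ne'
  have hi : ContDiffAt ℝ 1 (fun w : ℂ => w.im) z := Complex.imCLM.contDiff.contDiffAt
  have hr : ContDiffAt ℝ 1 (fun w : ℂ => w.re) z := Complex.reCLM.contDiff.contDiffAt
  have hs := (contDiffAt_const (c := (1 : ℝ)).sub (hi.pow 2)).sqrt hp
  rw [contDiffAt_euclidean]
  intro i
  fin_cases i
  · exact hs.mul hr.cos
  · exact hs.mul hr.sin
  · exact hi
theorem NE1 {A : Set ℂ} (hA : A ⊆ Str 1) (h : volume A = 0) : μSph (Es '' A) = 0 := by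
  rw [nul, image_image]
  exact c1_null (φ := eE) (fun x hx => eE_cd (hA hx)) ((cH A).1 h)
theorem null_iff (B : Set Sph) : μSph B = 0 ↔ volume (Str 1 ∩ Es ⁻¹' B) = 0 := by
  refine ⟨NE2, fun h => ?_⟩
  have h1 := NE1 inter_subset_left h
  have : B ⊆ Es '' (Str 1 ∩ Es ⁻¹' B) ∪ {pN, pS} := fun p hp => by
    rcases poles p with h | h
    · exact .inl ⟨ch p, ⟨(ch_spec h).1, by rwa [mem_preimage, (ch_spec h).2]⟩, (ch_spec h).2⟩
    · exact .inr h
  refine measure_mono_null this (measure_union_null h1 ?_)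
  have : NullSingletonClass μSph := Measure.nullSingletonClass_hausdorff _ two_pos
  exact (Set.toFinite _).measure_zero _
noncomputable section
abbrev Yt := {g : HomNS2 // g.1 pN = pN ∧ g.1 pS = pS}
theorem y_lt (g : Yt) {p : Sph} (hp : |ht p| < 1) : |ht (g.1.1 p)| < 1 := by
  rcases poles (g.1.1 p) with h | h | h
  · exact h
  · rw [g.1.2.1.injective (h.trans g.2.1.symm), ht_pN] at hp; simp at hp
  · rw [g.1.2.1.injective (h.trans g.2.2.symm), ht_pS] at hp; simp at hp
def wy (g : Yt) (z : ℂ) : Circle := un (xy (g.1.1 (Es z)))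
theorem wy_c : ContinuousOn (fun q : Yt × ℂ => wy q.1 q.2) (univ ×ˢ Str 1) := by
  refine un_c.comp (t := {w | w ≠ 0}) (f := fun q : Yt × ℂ => xy (q.1.1.1 (Es q.2))) ?_ fun q hq => xy_ne.2 (y_lt _ (Es_lt hq.2))
  have := Es_c
  exact (xy_c.comp (c_ev.comp (by fun_prop : Continuous fun q : Yt × ℂ => (q.1.1, Es q.2)))).continuousOn
theorem smul_Str (t : I) {z : ℂ} (hz : z ∈ Str 1) : (t.1 : ℂ) * z ∈ Str 1 := by
  show |((t.1 : ℂ) * z).im| < 1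
  have hz : |z.im| < 1 := hz
  simp only [Complex.im_ofReal_mul, abs_mul, abs_of_nonneg t.2.1]
  nlinarith [t.2.2, t.2.1, abs_nonneg z.im]
theorem lift_ex : ∃ La : Yt → ℂ → ℝ, ContinuousOn (fun q : Yt × ℂ => La q.1 q.2) (univ ×ˢ Str 1) ∧ (∀ g, La g 0 = 0) ∧
    ∀ g, ∀ z ∈ Str 1, Circle.exp (La g z) = wy g z / wy g 0 := by
  have m0 : (0 : ℂ) ∈ Str 1 := by simpa using zero_mem_Str one_pos 0
  let H : C(I × (Yt × ↥(Str 1)), Circle) := ⟨fun q => wy q.2.1 (q.1.1 * q.2.2) / wy q.2.1 0, by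
    refine Continuous.div' (wy_c.comp_continuous (f := fun q : I × (Yt × ↥(Str 1)) => (q.2.1, ((q.1.1 : ℝ) : ℂ) * q.2.2.1)) (by fun_prop) fun q => ⟨trivial, smul_Str _ q.2.2.2⟩)
      (wy_c.comp_continuous (f := fun q : I × (Yt × ↥(Str 1)) => (q.2.1, (0 : ℂ))) (by fun_prop) fun q => ⟨trivial, m0⟩)⟩
  let L := Circle.isCoveringMap_exp.liftHomotopy H (ContinuousMap.const _ 0) (fun a => by simp [H])
  have hL : ∀ q, Circle.exp (L q) = H q := congrFun (Circle.isCoveringMap_exp.liftHomotopy_lifts H _ _)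
  classical
  let l : Yt → ℂ → ℝ := fun g z => if h : z ∈ Str 1 then L (1, g, ⟨z, h⟩) - L (1, g, ⟨0, m0⟩) else 0
  refine ⟨l, ?_, fun g => by simp [l, m0], fun g z hz => ?_⟩
  · rw [continuousOn_iff_continuous_domRestrict]
    have : Continuous fun q : (univ ×ˢ Str 1 : Set (Yt × ℂ)) => L (1, q.1.1, ⟨q.1.2, q.2.2⟩) - L (1, q.1.1, ⟨0, m0⟩) := by
      fun_prop
    refine this.congr fun q => ?_
    have := q.2.2
    simp [l, this]
  · simp only [l, hz, dif_pos]
    rw [Circle.exp_sub, hL, hL]; simp [H]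
def La : Yt → ℂ → ℝ := lift_ex.choose
theorem La_c : ContinuousOn (fun q : Yt × ℂ => La q.1 q.2) (univ ×ˢ Str 1) := lift_ex.choose_spec.1
theorem La_0 (g : Yt) : La g 0 = 0 := lift_ex.choose_spec.2.1 g
theorem La_e (g : Yt) {z : ℂ} (hz : z ∈ Str 1) : Circle.exp (La g z) = wy g z / wy g 0 := lift_ex.choose_spec.2.2 g z hz
theorem La_cg (g : Yt) : ContinuousOn (La g) (Str 1) :=
  La_c.comp (f := fun z => (g, z)) (by fun_prop) fun _ hz => ⟨trivial, hz⟩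
theorem m0 : (0 : ℂ) ∈ Str 1 := by simpa using zero_mem_Str one_pos 0
theorem lift_uq {a b : ℂ → ℝ} (ha : ContinuousOn a (Str 1)) (hb : ContinuousOn b (Str 1))
    (h : ∀ z ∈ Str 1, Circle.exp (a z) = Circle.exp (b z)) {z0 : ℂ} (h0 : z0 ∈ Str 1) (e : a z0 = b z0) :
    ∀ z ∈ Str 1, a z = b z := by
  have : PreconnectedSpace ↥(Str 1) := isPreconnected_iff_preconnectedSpace.1 convex_Str.isPreconnected
  have := Circle.isCoveringMap_exp.eq_of_comp_eq (continuousOn_iff_continuous_domRestrict.1 ha)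
    (continuousOn_iff_continuous_domRestrict.1 hb) (funext fun z => h z z.2) ⟨z0, h0⟩ e
  exact fun z hz => congrFun this ⟨z, hz⟩
theorem tp_mem {z : ℂ} (hz : z ∈ Str 1) : z + tp ∈ Str 1 := (per_Str z).1 hz
theorem La_tp (g : Yt) : ∃ k : ℤ, La g tp = k * (2 * π) ∧ ∀ z ∈ Str 1, La g (z + tp) = La g z + k * (2 * π) := by
  have h1 := La_e g (tp_mem m0)
  rw [wy, Es_tp, ← wy, div_self', zero_add, Circle.exp_eq_one] at h1
  obtain ⟨k, hk⟩ := h1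
  refine ⟨k, hk, lift_uq ((La_cg g).comp (by fun_prop) fun z hz => tp_mem hz) ((La_cg g).add continuousOn_const) (fun z hz => ?_) m0
    (by rw [zero_add, La_0, hk, zero_add])⟩
  rw [La_e g (tp_mem hz), Circle.exp_add, La_e g hz, wy, Es_tp, ← wy]
  simp
noncomputable section
def hiY (g : Yt) : Yt := ⟨hi g.1, by
  have h1 := hi_l g.1 pN
  have h2 := hi_l g.1 pS
  rw [g.2.1] at h1; rw [g.2.2] at h2
  exact ⟨h1, h2⟩⟩
theorem hiY_c : Continuous hiY := Continuous.subtype_mk (cont_hom (f := fun g : Yt => hi g.1)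
  (c_hi.comp (by fun_prop : Continuous fun q : Yt × Sph => (q.1.1, q.2)))) _
theorem lift_uq2 {L M : ℂ → ℂ} (cL : ContinuousOn L (Str 1)) (cM : ContinuousOn M (Str 1)) (mL : MapsTo L (Str 1) (Str 1))
    (mM : MapsTo M (Str 1) (Str 1)) (h : ∀ z ∈ Str 1, Es (L z) = Es (M z)) {z0 : ℂ} (h0 : z0 ∈ Str 1) (e : L z0 = M z0) :
    ∀ z ∈ Str 1, L z = M z := fun z hz => by
  refine Complex.ext (lift_uq (Complex.continuous_re.comp_continuousOn cL) (Complex.continuous_re.comp_continuousOn cM)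
    (fun w hw => ?_) h0 (by simp [e]) z hz) ?_
  · simp only [Function.comp]
    rw [← Es_un (mL hw), h w hw, Es_un (mM hw)]
  · rw [← Es_ht (mL hz), h z hz, Es_ht (mM hz)]
def Fl (θ : ℝ) (g : Yt) (z : ℂ) : ℂ := (θ + La g z : ℝ) + (ht (g.1.1 (Es z)) : ℝ) * Complex.I
theorem Fl_re (θ : ℝ) (g : Yt) (z : ℂ) : (Fl θ g z).re = θ + La g z := by simp [Fl]
theorem Fl_im (θ : ℝ) (g : Yt) (z : ℂ) : (Fl θ g z).im = ht (g.1.1 (Es z)) := by simp [Fl]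
theorem Fl_Es {θ : ℝ} {g : Yt} (h : Circle.exp θ = wy g 0) {z : ℂ} (hz : z ∈ Str 1) :
    Fl θ g z ∈ Str 1 ∧ Es (Fl θ g z) = g.1.1 (Es z) :=
  Es_of (y_lt g (Es_lt hz)) (by rw [Fl_re, Circle.exp_add, h, La_e g hz, mul_div_cancel]; rfl) (Fl_im _ _ _)
theorem Fl_cc {P : Type*} [TopologicalSpace P] {θ : P → ℝ} (hθ : Continuous θ) {g : P → Yt} (hg : Continuous g) :
    ContinuousOn (fun q : P × ℂ => Fl (θ q.1) (g q.1) q.2) (univ ×ˢ Str 1) := by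
  have h1 : ContinuousOn (fun q : P × ℂ => La (g q.1) q.2) (univ ×ˢ Str 1) :=
    La_c.comp (f := fun q : P × ℂ => (g q.1, q.2)) (by fun_prop) fun q hq => ⟨trivial, hq.2⟩
  have h2 : Continuous fun q : P × ℂ => ht ((g q.1).1.1 (Es q.2)) := by
    have := Es_c
    exact ht_c.comp (c_ev.comp (by fun_prop : Continuous fun q : P × ℂ => ((g q.1).1, Es q.2)))
  unfold Fl
  refine ContinuousOn.add (Complex.continuous_ofReal.comp_continuousOn (ContinuousOn.add (by fun_prop) h1)) ?_
  exact ((Complex.continuous_ofReal.comp h2).mul continuous_const).continuousOn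
theorem Fl_c (θ : ℝ) (g : Yt) : ContinuousOn (Fl θ g) (Str 1) :=
  (Fl_cc (P := Unit) (θ := fun _ => θ) continuous_const (g := fun _ => g) continuous_const).comp (f := fun z => ((), z))
    (by fun_prop) fun z hz => ⟨trivial, hz⟩
def tg (θ : ℝ) (g : Yt) : ℝ := -La (hiY g) (Fl θ g 0)
theorem tg_e {θ : ℝ} {g : Yt} (h : Circle.exp θ = wy g 0) : Circle.exp (tg θ g) = wy (hiY g) 0 := by
  have h1 := Fl_Es h m0
  rw [tg, Circle.exp_neg, La_e _ h1.1]
  have : wy (hiY g) (Fl θ g 0) = 1 := by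
    rw [wy, h1.2, show (hiY g).1.1 (g.1.1 (Es 0)) = Es 0 from hi_l _ _, Es_un m0]; simp
  rw [this]; simp
theorem Fl_l {θ : ℝ} {g : Yt} (h : Circle.exp θ = wy g 0) {z : ℂ} (hz : z ∈ Str 1) : Fl (tg θ g) (hiY g) (Fl θ g z) = z := by
  have h' := tg_e h
  refine lift_uq2 (L := fun z => Fl (tg θ g) (hiY g) (Fl θ g z)) (M := id) ((Fl_c _ _).comp (Fl_c _ _) fun z hz => (Fl_Es h hz).1) continuousOn_id
    (fun z hz => (Fl_Es h' (Fl_Es h hz).1).1) (fun z hz => hz) (fun z hz => ?_) m0 ?_ z hz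
  · rw [(Fl_Es h' (Fl_Es h hz).1).2, (Fl_Es h hz).2]; exact hi_l _ _
  · apply Complex.ext
    · rw [Fl_re, tg]; simp
    · rw [← Es_ht (Fl_Es h' (Fl_Es h m0).1).1, (Fl_Es h' (Fl_Es h m0).1).2, (Fl_Es h m0).2, show (hiY g).1.1 (g.1.1 (Es 0)) = Es 0 from hi_l _ _, Es_ht m0]
      rfl
theorem Fl_r {θ : ℝ} {g : Yt} (h : Circle.exp θ = wy g 0) {z : ℂ} (hz : z ∈ Str 1) : Fl θ g (Fl (tg θ g) (hiY g) z) = z := by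
  have h' := tg_e h
  refine lift_uq2 (L := fun z => Fl θ g (Fl (tg θ g) (hiY g) z)) (M := id) ((Fl_c _ _).comp (Fl_c _ _) fun z hz => (Fl_Es h' hz).1) continuousOn_id
    (fun z hz => (Fl_Es h (Fl_Es h' hz).1).1) (fun z hz => hz) (fun z hz => ?_) (Fl_Es h m0).1 (by simp only [Fl_l h m0, id]) z hz
  rw [(Fl_Es h (Fl_Es h' hz).1).2, (Fl_Es h' hz).2]; exact hi_r _ _
theorem La_int (g : Yt) {k : ℤ} (hk : ∀ z ∈ Str 1, La g (z + tp) = La g z + k * (2 * π)) (n : ℤ) :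
    ∀ z ∈ Str 1, La g (z + n * tp) = La g z + n * (k * (2 * π)) := by
  have mem : ∀ (n : ℤ) z, z ∈ Str 1 → z + n * tp ∈ Str 1 := fun n z hz => by show |_| < (1 : ℝ); rw [im_tp]; exact hz
  induction n using Int.induction_on with
  | zero => simp
  | succ n ih =>
    intro z hz
    have := hk _ (mem n z hz)
    rw [ih z hz] at this
    push_cast at this ⊢
    rw [add_mul, one_mul, ← add_assoc, this]; ring
  | pred n ih =>
    intro z hz
    have := hk _ (mem (-n - 1) z hz)
    rw [add_assoc, show (((-(n : ℤ) - 1 : ℤ) : ℂ) * tp + tp) = ((-(n : ℤ) : ℤ) : ℂ) * tp by push_cast; ring, ih z hz] at this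
    push_cast at this ⊢
    linarith
theorem La_deg (g : Yt) : La g tp = 2 * π ∨ La g tp = -(2 * π) := by
  obtain ⟨k, h1, h2⟩ := La_tp g
  obtain ⟨k', h1', h2'⟩ := La_tp (hiY g)
  obtain ⟨θ, hθ⟩ : ∃ θ, Circle.exp θ = wy g 0 := Circle.exp_surjective _
  have e1 := congrArg Complex.re (Fl_l hθ (tp_mem m0))
  have e2 := congrArg Complex.re (Fl_l hθ m0)
  have e3 : Fl θ g (0 + tp) = Fl θ g 0 + k * tp := by
    apply Complex.ext
    · rw [re_tp, Fl_re, Fl_re, h2 _ m0]; ring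
    · rw [im_tp, Fl_im, Fl_im, Es_tp]
  rw [e3, Fl_re, La_int _ h2' _ _ (Fl_Es hθ m0).1] at e1
  rw [Fl_re] at e2
  simp at e1 e2
  have e4 : (k * k' : ℝ) = 1 := by
    have : (k * k' : ℝ) * (2 * π) = 1 * (2 * π) := by linarith
    exact mul_right_cancel₀ (by positivity) this
  rw [h1]
  rcases Int.eq_one_or_neg_one_of_mul_eq_one (by exact_mod_cast e4 : k * k' = 1) with rfl | rfl
  · left; simp
  · right; simp
def thY (g : Yt) : ℝ := (π - La g π) / 2
abbrev Xt := {g : Yt // La g tp = 2 * π ∧ Circle.exp (thY g) = wy g 0}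
theorem mpi : (π : ℂ) ∈ Str 1 := zero_mem_Str one_pos _
theorem La_ce {P : Type*} [TopologicalSpace P] {g : P → Yt} (hg : Continuous g) {z : P → ℂ} (hz : Continuous z)
    (hm : ∀ p, z p ∈ Str 1) : Continuous fun p => La (g p) (z p) :=
  La_c.comp_continuous (f := fun p => (g p, z p)) (by fun_prop) fun p => ⟨trivial, hm p⟩
theorem thY_c : Continuous thY := by
  have := La_ce (P := Yt) continuous_id (z := fun _ => (π : ℂ)) continuous_const (fun _ => mpi)
  unfold thY; simp only [id] at this; fun_prop
def FX (x : Xt) : ℂ → ℂ := Fl (thY x.1) x.1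
def FXi (x : Xt) : ℂ → ℂ := Fl (tg (thY x.1) x.1) (hiY x.1)
theorem FX_CF : CF FX FXi where
  sh x := by
    have h := x.2.2
    refine ⟨Fl_c _ _, Fl_c _ _, fun z hz => (Fl_Es h hz).1, fun z hz => (Fl_Es (tg_e h) hz).1, fun z hz => Fl_l h hz, fun z hz => Fl_r h hz,
      fun z hz => ?_⟩
    obtain ⟨k, h1, h2⟩ := La_tp x.1
    rw [x.2.1] at h1
    apply Complex.ext
    · rw [FX, Fl_re, Complex.add_re, Fl_re, h2 z hz, ← h1, tp_re]; ring
    · rw [FX, Fl_im, Complex.add_im, Fl_im, Es_tp]; simp [tp]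
  c := Fl_cc (thY_c.comp continuous_subtype_val) continuous_subtype_val
  ci := by
    have h1 : Continuous fun x : Xt => hiY x.1 := hiY_c.comp continuous_subtype_val
    refine Fl_cc (θ := fun x : Xt => tg (thY x.1) x.1) ?_ h1
    refine (La_ce h1 ?_ fun x => (Fl_Es x.2.2 m0).1).neg
    exact (Fl_cc (P := Xt) (thY_c.comp continuous_subtype_val) continuous_subtype_val).comp_continuous (f := fun x => (x, (0 : ℂ)))
      (by fun_prop) fun x => ⟨trivial, m0⟩
theorem FX_n (x : Xt) : (FX x 0).re + (FX x π).re = π := by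
  rw [FX, Fl_re, Fl_re, La_0, thY]; ring
theorem FX_Es (x : Xt) {z : ℂ} (hz : z ∈ Str 1) : FX x z ∈ Str 1 ∧ Es (FX x z) = x.1.1.1 (Es z) := Fl_Es x.2.2 hz
theorem FXi_Es (x : Xt) {z : ℂ} (hz : z ∈ Str 1) : FXi x z ∈ Str 1 ∧ Es (FXi x z) = (hi x.1.1).1 (Es z) := Fl_Es (tg_e x.2.2) hz
theorem X_char (g : Yt) {L : ℂ → ℂ} (cL : ContinuousOn L (Str 1)) (mL : MapsTo L (Str 1) (Str 1))
    (hL : ∀ z ∈ Str 1, Es (L z) = g.1.1 (Es z)) (hp : (L tp).re = (L 0).re + 2 * π) (hn : (L 0).re + (L π).re = π) :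
    ∃ h, ∀ z ∈ Str 1, FX ⟨g, h⟩ z = L z := by
  have hw : ∀ z ∈ Str 1, Circle.exp (L z).re = wy g z := fun z hz => by rw [← Es_un (mL hz), hL z hz, wy]
  have e : ∀ z ∈ Str 1, La g z = (L z).re - (L 0).re :=
    lift_uq (La_cg g) ((Complex.continuous_re.comp_continuousOn cL).sub continuousOn_const) (fun z hz => by
      rw [La_e g hz, Circle.exp_sub, hw _ hz, hw _ m0]) m0 (by rw [La_0, sub_self])
  have t : thY g = (L 0).re := by rw [thY, e _ mpi]; linarith
  refine ⟨⟨?_, ?_⟩, fun z hz => Complex.ext ?_ ?_⟩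
  · rw [e _ (by simpa using tp_mem m0), hp]; ring
  · rw [t, hw _ m0]
  · rw [FX, Fl_re]
    have := e z hz
    linarith
  · rw [FX, Fl_im, ← hL z hz, Es_ht (mL hz)]
noncomputable section
theorem N_basis {U : Set Sph} (hU : U ∈ 𝓝 pN) : ∃ c, 0 < c ∧ c < 1 ∧ ∀ p, c ≤ ht p → p ∈ U := by
  have hK : IsCompact (interior U)ᶜ := isOpen_interior.isClosed_compl.isCompact
  rcases (interior U)ᶜ.eq_empty_or_nonempty with h | h
  · refine ⟨1 / 2, by norm_num, by norm_num, fun p _ => ?_⟩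
    rw [compl_empty_iff] at h
    exact interior_subset (h ▸ mem_univ p)
  · obtain ⟨p0, h0, hm⟩ := hK.exists_isMaxOn h ht_c.continuousOn
    have : ht p0 < 1 := lt_of_le_of_ne (abs_le.1 (ht_le p0)).2 fun h => h0 (by rw [eq_pN h]; exact mem_interior_iff_mem_nhds.2 hU)
    refine ⟨max (1 / 2) ((ht p0 + 1) / 2), lt_max_of_lt_left (by norm_num), max_lt (by norm_num) (by linarith), fun p hp => ?_⟩
    by_contra hpU
    have : ht p ≤ ht p0 := hm (fun h => hpU (interior_subset h))
    linarith [le_max_right (1 / 2) ((ht p0 + 1) / 2)]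
theorem an_c : Continuous (mv an) := mv_c.comp (by fun_prop : Continuous fun x => (an, x))
theorem S_basis {U : Set Sph} (hU : U ∈ 𝓝 pS) : ∃ c, 0 < c ∧ c < 1 ∧ ∀ p, ht p ≤ -c → p ∈ U := by
  obtain ⟨c, h0, h1, h⟩ := N_basis (U := mv an ⁻¹' U) (an_c.continuousAt hU)
  refine ⟨c, h0, h1, fun p hp => ?_⟩
  have := h (mv an p) (by rw [ht_an]; linarith)
  rwa [mem_preimage, an_an] at this
theorem FX_U2 (x : Xt) : U2 (FX x) := by
  have hc : Continuous fun p => ht (x.1.1.1 p) := ht_c.comp x.1.1.1.continuous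
  obtain ⟨c, h0, h1, h⟩ := N_basis (hc.continuousAt.eventually (lt_mem_nhds (show (0 : ℝ) < ht (x.1.1.1 pN) by rw [x.1.2.1, ht_pN]; norm_num)))
  obtain ⟨c', h0', h1', h'⟩ := S_basis (hc.continuousAt.eventually (gt_mem_nhds (show ht (x.1.1.1 pS) < (0 : ℝ) by rw [x.1.2.2, ht_pS]; norm_num)))
  refine ⟨max c c', lt_max_of_lt_left h0, max_lt h1 h1', fun z hz => ⟨fun hm => ?_, fun hm => ?_⟩⟩
  · rw [FX, Fl_im]; exact h _ (by rw [Es_ht hz]; exact (le_max_left _ _).trans hm)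
  · rw [FX, Fl_im]; exact h' _ (by rw [Es_ht hz]; linarith [le_max_right c c'])
theorem NP_of (g : HomNS2) {L : ℂ → ℂ} (h : ∀ z ∈ Str 1, L z ∈ Str 1 ∧ Es (L z) = g.1 (Es z)) : NP L := fun A hA h0 => by
  refine measure_mono_null ?_ (NE2 ((g.2.2 _).1 (NE1 hA h0)))
  rintro _ ⟨z, hz, rfl⟩
  exact ⟨(h z (hA hz)).1, by rw [mem_preimage, (h z (hA hz)).2]; exact ⟨_, ⟨z, hz, rfl⟩, rfl⟩⟩
def taY (g : Yt) : Yt := ⟨hc (om an) (hc g.1 (om an)), by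
  have h1 : mv an (g.1.1 (mv an pN)) = pN := by
    show mv an (g.1.1 pS) = pN
    rw [g.2.2]; exact an_an pN
  have h2 : mv an (g.1.1 (mv an pS)) = pS := by
    show mv an (g.1.1 (mv an (mv an pN))) = mv an pN
    rw [an_an, g.2.1]
  exact ⟨h1, h2⟩⟩
theorem taY_v (g : Yt) (p : Sph) : (taY g).1.1 p = mv an (g.1.1 (mv an p)) := rfl
theorem taY_c : Continuous taY := by
  refine Continuous.subtype_mk (cont_hom (f := fun g : Yt => hc (om an) (hc g.1 (om an))) ?_) _
  have := an_c
  exact an_c.comp (c_ev.comp (by fun_prop : Continuous fun q : Yt × Sph => (q.1.1, mv an q.2)))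
theorem sgi_c : Continuous sgi := by unfold sgi; fun_prop
theorem sg_c : Continuous sg := by unfold sg; fun_prop
theorem taX_h (x : Xt) : ∃ h, ∀ z ∈ Str 1, FX ⟨taY x.1, h⟩ z = sgi (FX x (sg z)) := by
  have e := (FX_CF.sh x).e
  have s0 : sg 0 = π := by simp [sg]
  have sp : sg π = 0 + tp := by simp [sg, tp]; ring
  refine X_char _ (sgi_c.comp_continuousOn ((FX_CF.sh x).cF.comp sg_c.continuousOn fun z hz => sg_mem.2 hz))
    (fun z hz => sgi_mem.2 ((FX_CF.sh x).mF (sg_mem.2 hz))) (fun z hz => ?_) ?_ ?_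
  · have := FX_Es x (sg_mem.2 hz)
    rw [Es_sgi this.1, this.2, Es_sg hz, taY_v]
  · rw [show sg tp = sg 0 + tp by rw [← sg_tp, zero_add], e _ (sg_mem.2 m0), sgi_tp]; simp
  · have := FX_n x
    rw [s0, sp, e _ m0, sgi_tp]
    simp [sgi]
    linarith
def taX (x : Xt) : Xt := ⟨taY x.1, (taX_h x).choose⟩
theorem taX_c : Continuous taX := Continuous.subtype_mk (taY_c.comp continuous_subtype_val) _
theorem taX_taX (x : Xt) : taX (taX x) = x := Subtype.ext (Subtype.ext (HomNS2.ext' fun p => by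
  show (taY (taY x.1)).1.1 p = _
  rw [taY_v, taY_v, an_an, an_an]))
theorem FX_id (x : Xt) (h : ∀ p, x.1.1.1 p = p) : ∀ z ∈ Str 1, FX x z = z := by
  obtain ⟨_, h2⟩ := X_char x.1 (L := id) continuousOn_id (fun z hz => hz) (fun z _ => (h _).symm) (by simp) (by simp)
  exact h2
def sph (L : ℂ → ℂ) (p : Sph) : Sph := open Classical in if |ht p| < 1 then Es (L (ch p)) else p
theorem sph_N (L : ℂ → ℂ) : sph L pN = pN := by simp [sph, ht_pN]
theorem sph_S (L : ℂ → ℂ) : sph L pS = pS := by simp [sph, ht_pS]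
theorem sph_Es {L Li : ℂ → ℂ} (h : SH L Li) {z : ℂ} (hz : z ∈ Str 1) : sph L (Es z) = Es (L z) := by
  rw [sph, if_pos (Es_lt hz)]
  obtain ⟨k, hk⟩ := ch_Es hz
  rw [hk, h.e.int per_Str k hz, Es_tpk]
theorem sph_l {L Li : ℂ → ℂ} (h : SH L Li) (p : Sph) : sph Li (sph L p) = p := by
  rcases poles p with hp | rfl | rfl
  · obtain ⟨h1, h2⟩ := ch_spec hp
    rw [← h2, sph_Es h h1, sph_Es h.symm (h.mF h1), h.l _ h1]
  · simp [sph_N]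
  · simp [sph_S]
theorem sph_null {L Li : ℂ → ℂ} (h : SH L Li) (hN : NP L) (A : Set Sph) (hA : μSph A = 0) : μSph (sph L '' A) = 0 := by
  rw [null_iff]
  refine measure_mono_null ?_ (hN _ inter_subset_left (NE2 hA))
  rintro w ⟨hw, p, hp, h2⟩
  refine ⟨Li w, ⟨h.mI hw, ?_⟩, h.r w hw⟩
  rw [mem_preimage, ← sph_Es h.symm hw, ← h2, sph_l h]; exact hp
theorem sph_c {P : Type*} [TopologicalSpace P] {K Ki : P → ℂ → ℂ} (h : CF K Ki) (hU : ∀ p, U2 (K p)) :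
    Continuous fun q : P × Sph => sph (K q.1) q.2 := by
  rw [continuous_iff_continuousAt]
  rintro ⟨p, x⟩
  have hh : Continuous fun q : P × Sph => ht q.2 := ht_c.comp continuous_snd
  rcases poles x with hx | rfl | rfl
  · obtain ⟨h1, h2⟩ := ch_spec hx
    set z := ch x with hz
    obtain ⟨h3, h4⟩ := rx_Es z.re h1 (by simp [Real.pi_pos])
    rw [h2] at h3 h4
    have hc : ContinuousAt (fun q : P × Sph => chx z.re q.2) (p, x) :=
      ContinuousAt.comp (x := (p, x)) (g := chx z.re) (f := fun q : P × Sph => (q.2 : E3)) (chx_cd _ _ h3).continuousAt (continuous_subtype_val.comp continuous_snd).continuousAt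
    have h5 : ContinuousAt (fun q : P × Sph => Es (K q.1 (chx z.re q.2))) (p, x) := by
      refine Es_c.continuousAt.comp ?_
      refine ContinuousAt.comp (f := fun q : P × Sph => (q.1, chx z.re q.2)) (g := fun q : P × ℂ => K q.1 q.2) ?_ (continuousAt_fst.prodMk hc)
      show ContinuousAt _ (p, chx z.re x)
      rw [h4]; exact h.at p h1
    refine h5.congr ?_
    have h6 : ContinuousAt (fun q : P × Sph => rx z.re q.2) (p, x) :=
      ContinuousAt.comp (x := (p, x)) (g := rx z.re) (f := fun q : P × Sph => (q.2 : E3)) (rx_cd _ _).continuousAt (continuous_subtype_val.comp continuous_snd).continuousAt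
    filter_upwards [hh.abs.continuousAt.eventually (gt_mem_nhds hx), h6.eventually (Complex.isOpen_slitPlane.mem_nhds h3)] with q hq hr
    have hm : |ht q.2| < 1 := hq
    suffices hs : chx z.re q.2 ∈ Str 1 ∧ Es (chx z.re q.2) = q.2 by
      conv_rhs => rw [← hs.2]
      rw [sph_Es (h.sh _) hs.1]
    refine Es_of hm ?_ (by simp [chx, ht])
    have e1 : rx z.re q.2 = Circle.exp (-z.re) * xy q.2 := by
      rw [rx]; congr 1; apply Complex.ext <;> simp [xy]
    have e2 : Circle.exp (rx z.re q.2).arg = Circle.exp (-z.re) * un (xy q.2) := by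
      rw [← un_mul_u (xy_ne.2 hm), ← e1]; rfl
    have e3 : (chx z.re q.2).re = z.re + (rx z.re q.2).arg := by simp [chx, Complex.log_im]
    rw [e3, Circle.exp_add, e2, ← mul_assoc, ← Circle.exp_add]; simp
  · show Tendsto _ _ (𝓝 (sph (K p) pN))
    rw [sph_N]
    intro U hUm
    obtain ⟨e, h0, h1, he⟩ := N_basis hUm
    obtain ⟨c, h0', h1', hc⟩ := h.UF (hU p) h1
    have h2 : ∀ᶠ q : P × Sph in 𝓝 (p, pN), c < ht q.2 := hh.continuousAt.eventually (lt_mem_nhds (by simpa [ht_pN] using h1'))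
    have h3 : ∀ᶠ q : P × Sph in 𝓝 (p, pN), _ := continuousAt_fst.eventually hc
    show ∀ᶠ q : P × Sph in 𝓝 (p, pN), sph (K q.1) q.2 ∈ U
    filter_upwards [h2,h3] with q hq hk
    refine he _ ?_
    rcases poles q.2 with hx | hx | hx
    · obtain ⟨m1, m2⟩ := ch_spec hx
      rw [← m2, sph_Es (h.sh _) m1, Es_ht ((h.sh _).mF m1)]
      exact ((hk _ m1).1 hq.le).le
    · rw [hx, sph_N, ht_pN]; exact h1.le
    · rw [hx, ht_pS] at hq; linarith
  · show Tendsto _ _ (𝓝 (sph (K p) pS))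
    rw [sph_S]
    intro U hUm
    obtain ⟨e, h0, h1, he⟩ := S_basis hUm
    obtain ⟨c, h0', h1', hc⟩ := h.UF (hU p) h1
    have h2 : ∀ᶠ q : P × Sph in 𝓝 (p, pS), ht q.2 < -c := hh.continuousAt.eventually (gt_mem_nhds (by simpa [ht_pS] using h1'))
    have h3 : ∀ᶠ q : P × Sph in 𝓝 (p, pS), _ := continuousAt_fst.eventually hc
    show ∀ᶠ q : P × Sph in 𝓝 (p, pS), sph (K q.1) q.2 ∈ U
    filter_upwards [h2,h3] with q hq hk
    refine he _ ?_
    rcases poles q.2 with hx | hx | hx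
    · obtain ⟨m1, m2⟩ := ch_spec hx
      rw [← m2, sph_Es (h.sh _) m1, Es_ht ((h.sh _).mF m1)]
      exact ((hk _ m1).2 hq.le).le
    · rw [hx, ht_pN] at hq; linarith
    · rw [hx, sph_S, ht_pS]; linarith
noncomputable section
theorem Es_uc {e : ℝ} (he : 0 < e) : ∃ d, 0 < d ∧ ∀ p w, |ht p| < 1 → ‖w - ch p‖ < d → dist (Es w) p < e := by
  have hC : IsCompact (Icc (-π) π ×ℂ Icc (-1 : ℝ) 1) := isCompact_Icc.reProdIm isCompact_Icc
  have h1 := hC.uniformContinuousAt_of_continuousAt Es (fun a _ => Es_c.continuousAt) (dist_mem_uniformity he)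
  obtain ⟨d, h0, hd⟩ := Metric.mem_uniformity_dist.1 h1
  refine ⟨d, h0, fun p w hp hw => ?_⟩
  have h2 := hd (a := ch p) (b := w) (by rwa [dist_comm, dist_eq_norm])
    ⟨⟨(Complex.neg_pi_lt_arg _).le, Complex.arg_le_pi _⟩, abs_le.1 (ht_le p)⟩
  have h3 : dist (Es (ch p)) (Es w) < e := h2
  rwa [(ch_spec hp).2, dist_comm] at h3
theorem nsum (w : ℂ) {s : ℝ} (h : |w.re| < s) (h' : |w.im| < s) : ‖w‖ < 2 * s := by
  linarith [Complex.norm_le_abs_re_add_abs_im w]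
theorem Ph_ex : ∃ Φ : Xt × ℝ → HomNS2, Continuous Φ ∧ (∀ x s, 2 ≤ s → Φ (x, s) = x.1.1) ∧ (∀ x s, s ≤ 0 → ∀ p, (Φ (x, s)).1 p = p) ∧
    (∀ x s, (∀ p, x.1.1.1 p = p) → ∀ p, (Φ (x, s)).1 p = p) ∧
    (∀ x s p, (Φ (taX x, s)).1 p = mv an ((Φ (x, s)).1 (mv an p))) := by
  obtain ⟨K, Ki, hK, hU, hN, hNi, h2, hid, hta, hcl⟩ := strip_main FX_CF FX_n FX_U2
    (fun x => NP_of x.1.1 fun z hz => FX_Es x hz) (fun x => NP_of (hi x.1.1) fun z hz => FXi_Es x hz) taX_c taX_taX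
    (fun x => (taX_h x).choose_spec)
  let Φ : Xt × ℝ → HomNS2 := fun q => open Classical in if h : 0 < q.2 then
    mkH (sph (K (q.1, ⟨q.2, h⟩))) (sph (Ki (q.1, ⟨q.2, h⟩)))
      ((sph_c hK hU).comp (by fun_prop : Continuous fun p => (((q.1, ⟨q.2, h⟩) : Xt × Ioi (0 : ℝ)), p)))
      (sph_l (hK.sh _)) (sph_l (hK.sh _).symm) (sph_null (hK.sh _) (hN _)) (sph_null (hK.sh _).symm (hNi _)) else om 1
  have e1 : ∀ x s (h : 0 < s) p, (Φ (x, s)).1 p = sph (K (x, ⟨s, h⟩)) p := fun x s h p => by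
    simp only [Φ, dif_pos h]; rfl
  have e2 : ∀ x s, s ≤ 0 → ∀ p, (Φ (x, s)).1 p = p := fun x s h p => by
    simp only [Φ, dif_neg (not_lt.2 h)]; exact mv_one p
  have sphL : ∀ (L : ℂ → ℂ), (∀ z ∈ Str 1, L z = z) → ∀ p, sph L p = p := fun L hL p => by
    rw [sph]; split_ifs with hp
    · rw [hL _ (ch_spec hp).1, (ch_spec hp).2]
    · rfl
  refine ⟨Φ, cont_hom ?_, fun x s hs => ?_, e2, fun x s hx p => ?_, fun x s p => ?_⟩
  · rw [continuous_iff_continuousAt]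
    rintro ⟨⟨x, s⟩, p⟩
    rcases lt_or_ge 0 s with hs | hs
    · have : ContinuousOn (fun q : (Xt × ℝ) × Sph => (Φ q.1).1 q.2) {q | 0 < q.1.2} := by
        rw [continuousOn_iff_continuous_domRestrict]
        refine ((sph_c hK hU).comp (f := fun q : {q : (Xt × ℝ) × Sph | 0 < q.1.2} => (((q.1.1.1, ⟨q.1.1.2, q.2⟩) : Xt × Ioi (0 : ℝ)), q.1.2)) ?_).congr ?_
        · refine Continuous.prodMk (Continuous.prodMk (by fun_prop) (Continuous.subtype_mk (by fun_prop) _)) (by fun_prop)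
        · rintro ⟨⟨⟨x, s⟩, p⟩, h⟩
          exact (e1 x s h p).symm
      exact this.continuousAt ((isOpen_lt continuous_const (by fun_prop)).mem_nhds hs)
    · show Tendsto _ _ (𝓝 ((Φ (x, s)).1 p))
      rw [e2 x s hs p, Metric.tendsto_nhds]
      intro e he
      obtain ⟨d, hd, hE⟩ := Es_uc (half_pos he)
      have t1 : ∀ᶠ q : (Xt × ℝ) × Sph in 𝓝 ((x, s), p), q.1.2 < min 1 (d / 2) :=
        (by fun_prop : Continuous fun q : (Xt × ℝ) × Sph => q.1.2).continuousAt.eventually (gt_mem_nhds (lt_of_le_of_lt hs (by positivity)))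
      have t2 : ∀ᶠ q : (Xt × ℝ) × Sph in 𝓝 ((x, s), p), dist q.2 p < e / 2 :=
        (continuous_snd.tendsto ((x, s), p)).eventually (Metric.ball_mem_nhds p (half_pos he))
      filter_upwards [t1, t2]
      rintro ⟨⟨x', s'⟩, p'⟩ h1 h3
      have h1 : s' < min 1 (d / 2) := h1
      have h3 : dist p' p < e / 2 := h3
      have h5 : dist ((Φ (x', s')).1 p') p' < e / 2 := by
        rcases lt_or_ge 0 s' with h | h
        · rw [e1 _ _ h, sph]
          split_ifs with hp
          · refine hE _ _ hp ?_
            obtain ⟨a, b⟩ := hcl x' ⟨s', h⟩ (h1.trans_le (min_le_left _ _)).le _ (ch_spec hp).1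
            have := nsum (K (x', ⟨s', h⟩) (ch p') - ch p') (by simpa using a) (by simpa using b)
            linarith [min_le_right 1 (d / 2)]
          · simpa using he
        · rw [e2 _ _ h]; simpa using he
      exact (dist_triangle _ _ _).trans_lt (by linarith)
  · refine HomNS2.ext' fun p => ?_
    rw [e1 x s (by linarith)]
    rcases poles p with hp | rfl | rfl
    · obtain ⟨m, e⟩ := ch_spec hp
      rw [sph, if_pos hp, h2 x _ hs _ m, (FX_Es x m).2, e]
    · rw [sph_N, x.1.2.1]
    · rw [sph_S, x.1.2.2]
  · rcases lt_or_ge 0 s with h | h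
    · rw [e1 x s h]; exact sphL _ (hid x _ (FX_id x hx)) p
    · exact e2 x s h p
  · rcases lt_or_ge 0 s with h | h
    · rw [e1 _ _ h, e1 _ _ h]
      rcases poles p with hp | rfl | rfl
      · obtain ⟨m, e⟩ := ch_spec hp
        have sm := sg_mem.2 m
        rw [← e, ← Es_sg m, sph_Es (hK.sh _) m, sph_Es (hK.sh _) sm, hta x _ _ m, Es_sgi ((hK.sh _).mF sm)]
      · show sph _ pN = mv an (sph _ pS)
        rw [sph_N, sph_S]; exact (an_an pN).symm
      · rw [sph_S]
        show pS = mv an (sph _ (mv an (mv an pN)))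
        rw [an_an, sph_N]; rfl
    · rw [e2 _ _ h, e2 _ _ h, an_an]
noncomputable section
theorem mv_sum (M : O3) (p : Sph) (i : Fin 3) : (mv M p : E3) i = M.1 i 0 * (p : E3) 0 + M.1 i 1 * (p : E3) 1 + M.1 i 2 * (p : E3) 2 := by
  simp [mv, mvE, Matrix.mulVec, dotProduct, Fin.sum_univ_three]
theorem mv_ext {M N : O3} (h : ∀ p, mv M p = mv N p) : M = N := by
  apply Subtype.ext; ext i j
  have := congrArg (fun q : Sph => (q : E3) i) (h ⟨EuclideanSpace.single j 1, by simp⟩)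
  simp only [mv_sum] at this
  fin_cases j <;> simpa using this
theorem hh_o (k x y z : ℝ) (hv : k * (x ^ 2 + y ^ 2 + z ^ 2) = 2) :
    (!![1 - k * x * x, -k * x * y, -k * x * z; -k * y * x, 1 - k * y * y, -k * y * z; -k * z * x, -k * z * y, 1 - k * z * z]).transpose *
      !![1 - k * x * x, -k * x * y, -k * x * z; -k * y * x, 1 - k * y * y, -k * y * z; -k * z * x, -k * z * y, 1 - k * z * z] = 1 := by
  ext i j
  fin_cases i <;> fin_cases j <;> simp [Matrix.mul_apply, Fin.sum_univ_three]
  · linear_combination k * x * x * hv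
  · linear_combination k * x * y * hv
  · linear_combination k * x * z * hv
  · linear_combination k * x * y * hv
  · linear_combination k * y * y * hv
  · linear_combination k * y * z * hv
  · linear_combination k * x * z * hv
  · linear_combination k * y * z * hv
  · linear_combination k * z * z * hv
theorem tr_ex (p q : Sph) : ∃ M : O3, mv M p = q := by
  have hp : (p : E3) 0 ^ 2 + (p : E3) 1 ^ 2 + (p : E3) 2 ^ 2 = 1 := (sp_iff p).1 (mem_sphere_zero_iff_norm.1 p.2)
  have hq : (q : E3) 0 ^ 2 + (q : E3) 1 ^ 2 + (q : E3) 2 ^ 2 = 1 := (sp_iff q).1 (mem_sphere_zero_iff_norm.1 q.2)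
  by_cases hpq : p = q
  · exact ⟨1, by rw [mv_one, hpq]⟩
  have hd : 1 - ((p : E3) 0 * (q : E3) 0 + (p : E3) 1 * (q : E3) 1 + (p : E3) 2 * (q : E3) 2) ≠ 0 := fun h0 => by
    apply hpq
    have h1 : ((p : E3) 0 - (q : E3) 0) ^ 2 + ((p : E3) 1 - (q : E3) 1) ^ 2 + ((p : E3) 2 - (q : E3) 2) ^ 2 = 0 := by
      linear_combination hp + hq + 2 * h0
    apply Subtype.ext; ext i
    fin_cases i <;> simp <;> nlinarith [sq_nonneg ((p : E3) 0 - (q : E3) 0), sq_nonneg ((p : E3) 1 - (q : E3) 1), sq_nonneg ((p : E3) 2 - (q : E3) 2)]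
  generalize ha : (p : E3) 0 = a at *
  generalize hb : (p : E3) 1 = b at *
  generalize hc : (p : E3) 2 = c at *
  generalize ha' : (q : E3) 0 = a' at *
  generalize hb' : (q : E3) 1 = b' at *
  generalize hc' : (q : E3) 2 = c' at *
  obtain ⟨k, hk⟩ : ∃ k, k * (1 - (a * a' + b * b' + c * c')) = 1 := ⟨_, inv_mul_cancel₀ hd⟩
  have hv : k * ((a - a') ^ 2 + (b - b') ^ 2 + (c - c') ^ 2) = 2 := by linear_combination k * hp + k * hq + 2 * hk
  have hw : k * ((a - a') * a + (b - b') * b + (c - c') * c) = 1 := by linear_combination k * hp + hk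
  let M : Matrix (Fin 3) (Fin 3) ℝ := !![1 - k * (a - a') * (a - a'), - k * (a - a') * (b - b'), - k * (a - a') * (c - c');
     - k * (b - b') * (a - a'), 1 - k * (b - b') * (b - b'), - k * (b - b') * (c - c');
     - k * (c - c') * (a - a'), - k * (c - c') * (b - b'), 1 - k * (c - c') * (c - c')]
  have hM : M ∈ Matrix.orthogonalGroup (Fin 3) ℝ := by
    rw [Matrix.mem_orthogonalGroup_iff']
    exact hh_o _ _ _ _ hv
  refine ⟨⟨M, hM⟩, Subtype.ext ?_⟩
  ext i
  rw [mv_sum, ha, hb, hc]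
  fin_cases i <;> simp [M, ha', hb', hc']
  · linear_combination -(a - a') * hw
  · linear_combination -(b - b') * hw
  · linear_combination -(c - c') * hw
theorem rot_ex (u : Circle) : ∃ M : O3, ∀ p, xy (mv M p) = u * xy p ∧ ht (mv M p) = ht p := by
  have hu : (u : ℂ).re ^ 2 + (u : ℂ).im ^ 2 = 1 := by
    have := Circle.normSq_coe u
    rw [Complex.normSq_apply] at this; linarith
  generalize hz : (u : ℂ) = z at *
  let M : Matrix (Fin 3) (Fin 3) ℝ := !![z.re, -z.im, 0; z.im, z.re, 0; 0, 0, 1]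
  refine ⟨⟨M, ?_⟩, fun p => ⟨Complex.ext ?_ ?_, ?_⟩⟩
  · rw [Matrix.mem_orthogonalGroup_iff']
    ext i j
    fin_cases i <;> fin_cases j <;> simp [M, Matrix.mul_apply, Fin.sum_univ_three] <;> linarith
  · simp only [xy, mv_sum]; simp [M]; ring
  · simp only [xy, mv_sum]; simp [M]; ring
  · simp only [ht, mv_sum]; simp [M]
theorem ref_ex : ∃ M : O3, ∀ p, xy (mv M p) = conj (xy p) ∧ ht (mv M p) = ht p := by
  let M : Matrix (Fin 3) (Fin 3) ℝ := !![1, 0, 0; 0, -1, 0; 0, 0, 1]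
  refine ⟨⟨M, ?_⟩, fun p => ⟨Complex.ext ?_ ?_, ?_⟩⟩
  · rw [Matrix.mem_orthogonalGroup_iff']
    ext i j
    fin_cases i <;> fin_cases j <;> simp [M, Matrix.mul_apply, Fin.sum_univ_three]
  · simp only [xy, mv_sum]; simp [M]
  · simp only [xy, mv_sum]; simp [M]
  · simp only [ht, mv_sum]; simp [M]
theorem P_st (P : O3) (h : mv P pN = pN) : (∀ p, ht (mv P p) = ht p) ∧ ∃ u : Circle,
    ((∀ p, xy (mv P p) = u * xy p) ∨ (∀ p, xy (mv P p) = u * conj (xy p))) := by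
  have hc : ∀ i, P.1 i 2 = (pN : E3) i := fun i => by
    have := congrArg (fun q : Sph => (q : E3) i) h
    simpa [mv_sum, pN] using this
  have c0 := hc 0
  have c1 := hc 1
  have c2 := hc 2
  simp [pN] at c0 c1 c2
  have o := (Matrix.mem_orthogonalGroup_iff' _ _).1 P.2
  have oo : ∀ i j, P.1 0 i * P.1 0 j + P.1 1 i * P.1 1 j + P.1 2 i * P.1 2 j = (1 : Matrix (Fin 3) (Fin 3) ℝ) i j := fun i j => by
    rw [← o]; simp [Matrix.mul_apply, Fin.sum_univ_three]
  have o02 := oo 0 2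
  have o12 := oo 1 2
  have o00 := oo 0 0
  have o01 := oo 0 1
  have o11 := oo 1 1
  simp [c0, c1, c2] at o02 o12 o00 o01 o11
  simp [o02, o12] at o00 o01 o11
  refine ⟨fun p => by simp [ht, mv_sum, o02, o12, c2], ?_⟩
  generalize ha : P.1 0 0 = a at *
  generalize hb : P.1 0 1 = b at *
  generalize hcc : P.1 1 0 = c at *
  generalize hd : P.1 1 1 = d at *
  let u : Circle := ⟨⟨a, c⟩, by
    rw [← SetLike.mem_coe, Submonoid.coe_unitSphere, mem_sphere_zero_iff_norm, ← sq_eq_sq₀ (norm_nonneg _) zero_le_one, Complex.sq_norm, Complex.normSq_apply]; simpa using o00⟩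
  have hdet : (a * d - b * c) ^ 2 = 1 := by linear_combination (b * b + d * d) * o00 + o11 - (a * b + c * d) * o01
  refine ⟨u, ?_⟩
  rcases sq_eq_one_iff.1 hdet with h1 | h1
  · left; intro p
    have e1 : d = a := by linear_combination -d * o00 + c * o01 + a * h1
    have e2 : b = -c := by linear_combination -b * o00 + a * o01 - c * h1
    apply Complex.ext <;> simp [xy, mv_sum, u, ha, hb, hcc, hd, c0, c1, e1, e2] <;> ring
  · right; intro p
    have e1 : d = -a := by linear_combination -d * o00 + c * o01 + a * h1
    have e2 : b = c := by linear_combination -b * o00 + a * o01 - c * h1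
    apply Complex.ext <;> simp [xy, mv_sum, u, ha, hb, hcc, hd, c0, c1, e1, e2] <;> ring
noncomputable section
theorem La_u {g g' : Yt} {u : Circle} (h : ∀ p, xy (g'.1.1 p) = u * xy (g.1.1 p)) :
    (∀ z ∈ Str 1, wy g' z = u * wy g z) ∧ ∀ z ∈ Str 1, La g' z = La g z := by
  have h1 : ∀ z ∈ Str 1, wy g' z = u * wy g z := fun z hz => by
    rw [wy, h, un_mul_u (xy_ne.2 (y_lt g (Es_lt hz)))]; rfl
  refine ⟨h1, lift_uq (La_cg _) (La_cg _) (fun z hz => ?_) m0 (by rw [La_0, La_0])⟩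
  rw [La_e _ hz, La_e _ hz, h1 z hz, h1 0 m0, mul_div_mul_left_eq_div]
theorem La_j {g g' : Yt} {u : Circle} (h : ∀ p, xy (g'.1.1 p) = u * conj (xy (g.1.1 p))) :
    ∀ z ∈ Str 1, La g' z = -La g z := by
  have h1 : ∀ z ∈ Str 1, wy g' z = u * (wy g z)⁻¹ := fun z hz => by
    have h0 := xy_ne.2 (y_lt g (Es_lt hz))
    rw [wy, h, un_mul_u (by simpa using h0), un_conj h0]; rfl
  refine lift_uq (La_cg _) (La_cg _).neg (fun z hz => ?_) m0 (by rw [La_0, La_0, neg_zero])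
  rw [La_e _ hz, Circle.exp_neg, La_e _ hz, h1 z hz, h1 0 m0, mul_div_mul_left_eq_div, inv_div_inv, inv_div]
theorem P_uq {x x' : Xt} {P : O3} (h : ∀ p, mv P (x.1.1.1 p) = x'.1.1.1 p) : P = 1 := by
  have hN : mv P pN = pN := by have := h pN; rwa [x.1.2.1, x'.1.2.1] at this
  obtain ⟨h1, u, h2 | h2⟩ := P_st P hN
  · obtain ⟨a, b⟩ := La_u (g := x.1) (g' := x'.1) (u := u) fun p => by rw [← h, h2]
    have e1 := x.2.2
    have e2 := x'.2.2
    have e3 : thY x'.1 = thY x.1 := by rw [thY, thY, b _ mpi]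
    rw [e3, a _ m0, e1] at e2
    have hu : u = 1 := right_eq_mul.1 e2
    refine mv_ext fun p => ?_
    rw [mv_one]
    exact sp_eq (by rw [h2, hu]; simp) (h1 p)
  · have := La_j (g := x.1) (g' := x'.1) (u := u) (fun p => by rw [← h, h2]) tp (by simpa using tp_mem m0)
    rw [x.2.1, x'.2.1] at this
    linarith [Real.pi_pos]
theorem D_uq {x x' : Xt} {P P' : O3} (h : ∀ p, mv P (x.1.1.1 p) = mv P' (x'.1.1.1 p)) : P = P' ∧ x = x' := by
  have e : P'⁻¹ * P = 1 := P_uq (x := x) (x' := x') fun p => by rw [mv_mul, h, mv_inv]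
  have e' : P = P' := by rw [inv_mul_eq_one] at e; exact e.symm
  refine ⟨e', Subtype.ext (Subtype.ext (HomNS2.ext' fun p => ?_))⟩
  have := congrArg (mv P⁻¹) (h p)
  rwa [e', mv_inv, mv_inv] at this
abbrev Zt := {f : HomNS2 // f.1 pS = mv an (f.1 pN)}
def toY (f : Zt) (P : O3) (h : mv P (f.1.1 pN) = pN) : Yt := ⟨hc (om P) f.1, h, by
  show mv P (f.1.1 pS) = pS
  rw [f.2, ← an_mv, h]; rfl⟩
theorem D_ex (f : Zt) : ∃ q : O3 × Xt, ∀ p, f.1.1 p = mv q.1 (q.2.1.1.1 p) := by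
  obtain ⟨P, hP⟩ := tr_ex (f.1.1 pN) pN
  obtain ⟨P1, h1, hL⟩ : ∃ P1 : O3, ∃ h1 : mv P1 (f.1.1 pN) = pN, La (toY f P1 h1) tp = 2 * π := by
    rcases La_deg (toY f P hP) with h | h
    · exact ⟨P, hP, h⟩
    · obtain ⟨J, hJ⟩ := ref_ex
      have hh : mv (J * P) (f.1.1 pN) = pN := by rw [mv_mul, hP]; exact eq_pN (by rw [(hJ _).2, ht_pN])
      refine ⟨J * P, hh, ?_⟩
      rw [La_j (g := toY f P hP) (u := 1) (fun p => ?_) _ (by simpa using tp_mem m0), h, neg_neg]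
      show xy (mv (J * P) _) = _
      rw [mv_mul, (hJ _).1]; simp; rfl
  set g := toY f P1 h1 with hg
  obtain ⟨J, hJ⟩ := rot_ex (Circle.exp (thY g) / wy g 0)
  have hh : mv (J * P1) (f.1.1 pN) = pN := by rw [mv_mul, h1]; exact eq_pN (by rw [(hJ _).2, ht_pN])
  obtain ⟨a, b⟩ := La_u (g := g) (g' := toY f _ hh) (u := Circle.exp (thY g) / wy g 0) fun p => by
    show xy (mv (J * P1) _) = _
    rw [mv_mul, (hJ _).1]; rfl
  refine ⟨((J * P1)⁻¹, ⟨toY f _ hh, ?_, ?_⟩), fun p => ?_⟩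
  · rw [b _ (by simpa using tp_mem m0), hL]
  · rw [a _ m0, div_mul_cancel, thY, b _ mpi]; rfl
  · exact (mv_inv _ _).symm
def qZ (f : Zt) : O3 := (D_ex f).choose.1
def xZ (f : Zt) : Xt := (D_ex f).choose.2
theorem Z_e (f : Zt) (p : Sph) : f.1.1 p = mv (qZ f) ((xZ f).1.1.1 p) := (D_ex f).choose_spec p
theorem Z_uq {f : Zt} {P : O3} {x : Xt} (h : ∀ p, f.1.1 p = mv P (x.1.1.1 p)) : qZ f = P ∧ xZ f = x :=
  D_uq fun p => by rw [← Z_e, h]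
theorem X_cl : IsClosed (range fun x : Xt => x.1.1) := by
  have c1 : IsClosed {g : HomNS2 | g.1 pN = pN ∧ g.1 pS = pS} :=
    (isClosed_eq (c_ev.comp (by fun_prop : Continuous fun g : HomNS2 => (g, pN))) continuous_const).inter
      (isClosed_eq (c_ev.comp (by fun_prop : Continuous fun g : HomNS2 => (g, pS))) continuous_const)
  have c2 : IsClosed {g : Yt | La g tp = 2 * π ∧ Circle.exp (thY g) = wy g 0} :=
    (isClosed_eq (La_ce continuous_id (z := fun _ => tp) continuous_const fun _ => by simpa using tp_mem m0) continuous_const).inter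
      (isClosed_eq (Circle.exp.continuous.comp thY_c) (wy_c.comp_continuous (f := fun g : Yt => (g, (0 : ℂ))) (by fun_prop) fun g => ⟨trivial, m0⟩))
  exact (c1.isClosedEmbedding_subtypeVal.comp c2.isClosedEmbedding_subtypeVal).isClosed_range
theorem hcom_c : Continuous fun q : O3 × HomNS2 => hc (om q.1) q.2 :=
  cont_hom (mv_c.comp ((by fun_prop : Continuous fun q : (O3 × HomNS2) × Sph => q.1.1).prodMk
    (c_ev.comp (by fun_prop : Continuous fun q : (O3 × HomNS2) × Sph => (q.1.2, q.2)))))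
theorem oinv_c : Continuous fun q : O3 => q⁻¹ := continuous_inv
theorem qZ_c : Continuous qZ := by
  apply cgraph
  have h1 : Continuous fun q : Zt × O3 => hc (om q.2⁻¹) q.1.1 :=
    hcom_c.comp ((oinv_c.comp continuous_snd).prodMk (continuous_subtype_val.comp continuous_fst))
  convert X_cl.preimage h1 using 1
  ext ⟨f, Q⟩
  constructor
  · rintro (rfl : qZ f = Q)
    refine ⟨xZ f, HomNS2.ext' fun p => ?_⟩
    show _ = mv _ (f.1.1 p)
    rw [Z_e, mv_inv]
  · rintro ⟨x, hx⟩
    refine (Z_uq (x := x) fun p => ?_).1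
    have : x.1.1.1 p = mv Q⁻¹ (f.1.1 p) := by
      have hx : x.1.1 = hc (om Q⁻¹) f.1 := hx
      rw [hx]; rfl
    rw [this, mv_inv']
theorem xZ_c : Continuous xZ := by
  rw [continuous_induced_rng, continuous_induced_rng]
  refine (hcom_c.comp (f := fun f : Zt => ((qZ f)⁻¹, f.1)) ((oinv_c.comp qZ_c).prodMk continuous_subtype_val)).congr fun f => HomNS2.ext' fun p => ?_
  show mv _ (f.1.1 p) = _
  rw [Z_e, mv_inv]; rfl
theorem X_id : ∃ x : Xt, ∀ p, x.1.1.1 p = p := by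
  let g : Yt := ⟨om 1, mv_one _, mv_one _⟩
  obtain ⟨h, _⟩ := X_char g (L := id) continuousOn_id (fun z hz => hz) (fun z _ => (mv_one _).symm) (by simp) (by simp)
  exact ⟨⟨g, h⟩, fun p => mv_one p⟩
noncomputable section
def RE (a x : E3) : E3 := ‖x - a‖⁻¹ • (x - a)
def rr (a u : E3) : ℝ := -inner ℝ a u + √((inner ℝ a u) ^ 2 + 1 - ‖a‖ ^ 2)
def RI (a u : E3) : E3 := a + rr a u • u
abbrev Bl : Type := {a : E3 // ‖a‖ < 1}
theorem blt (a : Bl) : ‖(a : E3)‖ < 1 := a.2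
theorem bl_ne (a : Bl) (x : Sph) : (x : E3) - a ≠ 0 := fun h => by
  have h1 := blt a
  rw [← sub_eq_zero.1 h, mem_sphere_zero_iff_norm.1 x.2] at h1
  exact lt_irrefl _ h1
theorem nx (x : Sph) : ‖(x : E3)‖ = 1 := mem_sphere_zero_iff_norm.1 x.2
theorem disc_pos (a : Bl) (u : E3) : 0 < (inner ℝ (a : E3) u) ^ 2 + 1 - ‖(a : E3)‖ ^ 2 := by
  nlinarith [blt a, norm_nonneg (a : E3), sq_nonneg (inner ℝ (a : E3) u)]
theorem rr_sq (a : Bl) (u : E3) : (rr a u + inner ℝ (a : E3) u) ^ 2 = (inner ℝ (a : E3) u) ^ 2 + 1 - ‖(a : E3)‖ ^ 2 := by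
  rw [rr, neg_add_cancel_comm, Real.sq_sqrt (disc_pos a u).le]
theorem rr_pos (a : Bl) (u : E3) : 0 < rr a u := by
  have : inner ℝ (a : E3) u < √((inner ℝ (a : E3) u) ^ 2 + 1 - ‖(a : E3)‖ ^ 2) := by
    refine (le_abs_self _).trans_lt ?_
    rw [← Real.sqrt_sq_eq_abs]
    exact Real.sqrt_lt_sqrt (sq_nonneg _) (by nlinarith [blt a, norm_nonneg (a : E3)])
  rw [rr]; linarith
def Rm (a : Bl) (x : Sph) : Sph := ⟨RE a x, by
  rw [mem_sphere_zero_iff_norm, RE, norm_smul, norm_inv, norm_norm, inv_mul_cancel₀ (norm_ne_zero_iff.2 (bl_ne a x))]⟩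
def Ri (a : Bl) (u : Sph) : Sph := ⟨RI a u, by
  rw [mem_sphere_zero_iff_norm, ← sq_eq_sq₀ (norm_nonneg _) zero_le_one, RI, norm_add_sq_real, norm_smul, mul_pow, nx, real_inner_smul_right, Real.norm_eq_abs, sq_abs]
  linear_combination rr_sq a u⟩
theorem Rm_r (a : Bl) (u : Sph) : Rm a (Ri a u) = u := Subtype.ext (by
  show RE a (RI a u) = u
  rw [RE, RI, add_sub_cancel_left, norm_smul, nx, mul_one, smul_smul, Real.norm_of_nonneg (rr_pos a u).le, inv_mul_cancel₀ (rr_pos a u).ne', one_smul])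
theorem Rm_l (a : Bl) (x : Sph) : Ri a (Rm a x) = x := Subtype.ext (by
  show RI a (RE a x) = x
  have hn : 0 < ‖(x : E3) - a‖ := norm_pos_iff.2 (bl_ne a x)
  have key : rr a (RE a x) = ‖(x : E3) - a‖ := by
    have h1 := rr_sq a (RE a x)
    have h2 := rr_pos a (RE a x)
    have h3 : ‖(x : E3) - a‖ ^ 2 + 2 * inner ℝ (a : E3) (x - a) + ‖(a : E3)‖ ^ 2 = 1 := by
      have := norm_add_sq_real (a : E3) (x - a)
      rw [add_sub_cancel, nx] at this
      linarith
    have h4 : inner ℝ (a : E3) (x - a) = ‖(x : E3) - a‖ * inner ℝ (a : E3) (RE a x) := by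
      rw [RE, real_inner_smul_right, mul_inv_cancel_left₀ hn.ne']
    rw [h4] at h3
    generalize rr a (RE a x) = r at *
    generalize ‖(x : E3) - a‖ = n at *
    generalize inner ℝ (a : E3) (RE a x) = i at *
    have hb := blt a
    have hb0 := norm_nonneg (a : E3)
    generalize ‖(a : E3)‖ = m at *
    have h5 : (r - n) * (r + n + 2 * i) = 0 := by linear_combination h1 - h3
    rcases mul_eq_zero.1 h5 with h | h
    · linarith
    · nlinarith [mul_pos h2 hn, congrArg (fun t => r * t) h]
  rw [RI, key, RE, smul_smul, mul_inv_cancel₀ hn.ne', one_smul, add_sub_cancel])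
theorem RE_cd (a : Bl) (x : Sph) : ContDiffAt ℝ 1 (RE a) x := by
  have h0 := bl_ne a x
  have h1 : ContDiffAt ℝ 1 (fun y : E3 => y - a) (x : E3) := by fun_prop
  exact ((h1.norm ℝ h0).inv (norm_ne_zero_iff.2 h0)).smul h1
theorem RI_cd (a : Bl) (x : Sph) : ContDiffAt ℝ 1 (RI a) x := by
  have h1 : ContDiffAt ℝ 1 (fun y : E3 => inner ℝ (a : E3) y) (x : E3) := contDiffAt_const.inner ℝ contDiffAt_id
  have h2 : ContDiffAt ℝ 1 (fun y : E3 => (inner ℝ (a : E3) y) ^ 2 + 1 - ‖(a : E3)‖ ^ 2) (x : E3) := ((h1.pow 2).add contDiffAt_const).sub contDiffAt_const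
  exact contDiffAt_const.add ((h1.neg.add (h2.sqrt (disc_pos a x).ne')).smul contDiffAt_id)
theorem Rm_c : Continuous fun q : Bl × Sph => Rm q.1 q.2 := by
  refine Continuous.subtype_mk ?_ _
  have h1 : Continuous fun q : Bl × Sph => (q.2 : E3) - q.1 := by fun_prop
  exact (h1.norm.inv₀ fun q => norm_ne_zero_iff.2 (bl_ne q.1 q.2)).smul h1
theorem Rm_ca (a : Bl) : Continuous (Rm a) := by
  have h : Continuous fun x : Sph => ((a, x) : Bl × Sph) := by fun_prop
  exact (Rm_c.comp h).congr fun x => rfl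
theorem Rm_n (a : Bl) (A : Set Sph) (h : μSph A = 0) : μSph (Rm a '' A) = 0 := nm (f := Rm a) (φ := RE a) (RE_cd a) (fun _ => rfl) A h
theorem Ri_n (a : Bl) (A : Set Sph) (h : μSph A = 0) : μSph (Ri a '' A) = 0 := nm (f := Ri a) (φ := RI a) (RI_cd a) (fun _ => rfl) A h
def Rh (a : Bl) : HomNS2 := mkH (Rm a) (Ri a) (Rm_ca a) (Rm_l a) (Rm_r a) (Rm_n a) (Ri_n a)
def ce (f : HomNS2) : E3 := (1 / 2 : ℝ) • ((f.1 pN : E3) + f.1 pS)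
theorem NS_ne : pN ≠ pS := fun h => by
  have := congrArg ht h
  rw [ht_pN, ht_pS] at this; norm_num at this
theorem ce_lt (f : HomNS2) : ‖ce f‖ < 1 := by
  have h := parallelogram_law_with_norm ℝ (f.1 pN : E3) (f.1 pS)
  have h1 : 0 < ‖(f.1 pN : E3) - f.1 pS‖ := norm_pos_iff.2 (sub_ne_zero.2 fun h => NS_ne (f.2.1.injective (Subtype.ext h)))
  rw [nx, nx] at h
  rw [ce, norm_smul]
  norm_num
  nlinarith [norm_nonneg ((f.1 pN : E3) + f.1 pS)]
theorem ce_c : Continuous ce := by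
  have h1 : Continuous fun f : HomNS2 => f.1 pN := c_ev.comp (by fun_prop : Continuous fun g : HomNS2 => (g, pN))
  have h2 : Continuous fun f : HomNS2 => f.1 pS := c_ev.comp (by fun_prop : Continuous fun g : HomNS2 => (g, pS))
  unfold ce; fun_prop
def cB (f : HomNS2) (t : I) : Bl := ⟨min 1 (2 * t.1) • ce f, by
  rw [norm_smul, Real.norm_of_nonneg (le_min zero_le_one (by linarith [t.2.1]))]
  nlinarith [min_le_left 1 (2 * t.1), ce_lt f, norm_nonneg (ce f)]⟩
theorem cB_c : Continuous fun q : HomNS2 × I => cB q.1 q.2 := by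
  have := ce_c
  exact Continuous.subtype_mk (by fun_prop) _
def r1 (q : HomNS2 × I) : HomNS2 := hc (Rh (cB q.1 q.2)) q.1
theorem r1_v (f : HomNS2) (t : I) (p : Sph) : (r1 (f, t)).1 p = Rm (cB f t) (f.1 p) := rfl
theorem r1_c : Continuous r1 := by
  have h1 : Continuous fun q : (HomNS2 × I) × Sph => cB q.1.1 q.1.2 := cB_c.comp continuous_fst
  have h2 : Continuous fun q : (HomNS2 × I) × Sph => q.1.1.1 q.2 :=
    c_ev.comp (by fun_prop : Continuous fun q : (HomNS2 × I) × Sph => (q.1.1, q.2))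
  exact cont_hom ((Rm_c.comp (h1.prodMk h2)).congr fun q => (r1_v _ _ _).symm)
theorem Rm_0 {a : Bl} (h : (a : E3) = 0) (x : Sph) : Rm a x = x := Subtype.ext (by
  show RE a x = x
  rw [RE, h, sub_zero, nx]; simp)
theorem r1_0 (f : HomNS2) : r1 (f, 0) = f := HomNS2.ext' fun p => by
  rw [r1_v, Rm_0]; simp [cB]
theorem r1_om (Q : O3) (t : I) : r1 (om Q, t) = om Q := HomNS2.ext' fun p => by
  rw [r1_v, Rm_0]
  have : ce (om Q) = 0 := by
    show (1 / 2 : ℝ) • ((mv Q pN : E3) + mv Q (mv an pN)) = 0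
    rw [← an_mv, an_v]; simp
  simp [cB, this]
theorem mvE_lin (P : O3) (c : ℝ) (x y : E3) : mvE P.1 (c • (x - y)) = c • (mvE P.1 x - mvE P.1 y) := by
  ext i; simp [mvE, Matrix.mulVec_smul, Matrix.mulVec_sub]
theorem mvE_a (P : O3) (c : ℝ) (x y : E3) : mvE P.1 (c • (x + y)) = c • (mvE P.1 x + mvE P.1 y) := by
  ext i; simp [mvE, Matrix.mulVec_smul, Matrix.mulVec_add]
theorem mvE_s (P : O3) (c : ℝ) (x : E3) : mvE P.1 (c • x) = c • mvE P.1 x := by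
  ext i; simp [mvE, Matrix.mulVec_smul]
theorem RE_eq (P : O3) (a x : E3) : RE (mvE P.1 a) (mvE P.1 x) = mvE P.1 (RE a x) := by
  have h : mvE P.1 x - mvE P.1 a = mvE P.1 (x - a) := by simpa using (mvE_lin P 1 x a).symm
  rw [RE, RE, mvE_s, h, mvE_norm]
theorem r1_P (P : O3) (f : HomNS2) (t : I) (p : Sph) : (r1 (hc (om P) f, t)).1 p = mv P ((r1 (f, t)).1 p) := Subtype.ext (by
  show RE (min 1 (2 * t.1) • ce (hc (om P) f)) (mvE P.1 (f.1 p)) = mvE P.1 (RE (min 1 (2 * t.1) • ce f) (f.1 p))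
  have : ce (hc (om P) f) = mvE P.1 (ce f) := (mvE_a P _ _ _).symm
  rw [this, ← mvE_s, RE_eq])
theorem r1_an (f : HomNS2) (t : I) (p : Sph) : (r1 (hc f (om an), t)).1 p = (r1 (f, t)).1 (mv an p) := Subtype.ext (by
  show RE (min 1 (2 * t.1) • ce (hc f (om an))) (f.1 (mv an p)) = RE (min 1 (2 * t.1) • ce f) (f.1 (mv an p))
  have : ce (hc f (om an)) = ce f := by
    show (1 / 2 : ℝ) • ((f.1 pS : E3) + f.1 (mv an (mv an pN))) = _
    rw [an_an, add_comm]; rfl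
  rw [this])
def f1 (f : HomNS2) : Zt := ⟨r1 (f, 1), Subtype.ext (by
  rw [an_v]
  have e : ((cB f 1 : Bl) : E3) = ce f := by simp [cB]
  show RE (cB f 1 : Bl) (f.1 pS) = -RE (cB f 1 : Bl) (f.1 pN)
  have h : (f.1 pS : E3) - ce f = -((f.1 pN : E3) - ce f) := by rw [ce]; module
  rw [e, RE, RE, h, norm_neg, smul_neg])⟩
theorem f1_c : Continuous f1 := Continuous.subtype_mk (r1_c.comp (by fun_prop : Continuous fun f : HomNS2 => (f, (1 : I)))) _
theorem r1_half (f : HomNS2) {t : I} (h : 1 / 2 ≤ t.1) : r1 (f, t) = r1 (f, 1) := by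
  have : cB f t = cB f 1 := Subtype.ext (by
    show min 1 (2 * t.1) • ce f = min 1 (2 * (1 : ℝ)) • ce f
    rw [min_eq_left (by linarith), min_eq_left (by norm_num)])
  simp only [r1, this]
theorem rho_ex : ∃ ρ : HomNS2 × I → HomNS2, Continuous ρ ∧ (∀ f, ρ (f, 0) = f) ∧ (∀ f, ∃ Q, ρ (f, 1) = om Q) ∧
    (∀ Q t, ρ (om Q, t) = om Q) ∧ (∀ P f t p, (ρ (hc (om P) f, t)).1 p = mv P ((ρ (f, t)).1 p)) ∧
    (∀ f t p, (ρ (hc f (om an), t)).1 p = (ρ (f, t)).1 (mv an p)) := by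
  obtain ⟨Φ, hc', h2, h0, hid, hta⟩ := Ph_ex
  let r2 : HomNS2 × I → HomNS2 := fun q => hc (om (qZ (f1 q.1))) (Φ (xZ (f1 q.1), 4 * (1 - q.2.1)))
  have r2_v : ∀ f t p, (r2 (f, t)).1 p = mv (qZ (f1 f)) ((Φ (xZ (f1 f), 4 * (1 - t.1))).1 p) := fun _ _ _ => rfl
  have c2 : Continuous r2 := by
    have a := qZ_c.comp f1_c
    have b := xZ_c.comp f1_c
    exact hcom_c.comp ((a.comp continuous_fst).prodMk (hc'.comp ((b.comp continuous_fst).prodMk (by fun_prop))))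
  have half : ∀ f (t : I), t.1 = 1 / 2 → r1 (f, t) = r2 (f, t) := fun f t ht => HomNS2.ext' fun p => by
    rw [r2_v, h2 _ _ (by rw [ht]; norm_num), ← Z_e, r1_half f ht.ge]; rfl
  refine ⟨fun q => open Classical in if q.2.1 ≤ 1 / 2 then r1 q else r2 q, ?_, fun f => ?_, fun f => ⟨qZ (f1 f), ?_⟩, fun Q t => ?_, fun P f t p => ?_, fun f t p => ?_⟩
  · exact Continuous.if_le r1_c c2 (by fun_prop) continuous_const fun q hq => half q.1 q.2 hq
  · simp only; rw [if_pos (by simp), r1_0]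
  · simp only; rw [if_neg (by norm_num)]
    refine HomNS2.ext' fun p => ?_
    rw [r2_v, h0 _ _ (by simp)]; rfl
  · simp only; split_ifs
    · exact r1_om Q t
    · obtain ⟨x, hx⟩ := X_id
      obtain ⟨e1, e2⟩ := Z_uq (f := f1 (om Q)) (P := Q) (x := x) fun p => by
        show (r1 (om Q, 1)).1 p = _
        rw [r1_om, hx]; rfl
      refine HomNS2.ext' fun p => ?_
      rw [r2_v, e1, e2, hid x _ hx]; rfl
  · simp only; split_ifs
    · exact r1_P P f t p
    · obtain ⟨e1, e2⟩ := Z_uq (f := f1 (hc (om P) f)) (P := P * qZ (f1 f)) (x := xZ (f1 f)) fun p => by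
        show (r1 (hc (om P) f, 1)).1 p = _
        rw [r1_P, mv_mul, ← Z_e]; rfl
      rw [r2_v, r2_v, e1, e2, mv_mul]
  · simp only; split_ifs
    · exact r1_an f t p
    · obtain ⟨e1, e2⟩ := Z_uq (f := f1 (hc f (om an))) (P := qZ (f1 f) * an) (x := taX (xZ (f1 f))) fun p => by
        show (r1 (hc f (om an), 1)).1 p = mv _ (mv an ((xZ (f1 f)).1.1.1 (mv an p)))
        rw [r1_an, mv_mul, an_an, ← Z_e]; rfl
      rw [r2_v, r2_v, e1, e2, mv_mul, hta, an_an]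

/-- There is a strong `(O₃ × ℤ₂)`-equivariant deformation retraction from `Hom_N(S²)` to `O₃`. -/
theorem deformation_retraction_homNS2_to_O3 :
    ∃ ρ : HomNS2 × unitInterval → HomNS2,
      Continuous ρ ∧
      (∀ f : HomNS2, ρ (f, 0) = f) ∧
      (∀ f : HomNS2, ∃ Q ∈ Matrix.orthogonalGroup (Fin 3) ℝ, AgreesWith (ρ (f, 1)) Q) ∧
      (∀ Q ∈ Matrix.orthogonalGroup (Fin 3) ℝ, ∀ g : HomNS2, AgreesWith g Q →
        ∀ t : unitInterval, ρ (g, t) = g) ∧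
      (∀ Q ∈ Matrix.orthogonalGroup (Fin 3) ℝ, ∀ s : ℝ, s = 1 ∨ s = -1 →
        ∀ f σs g : HomNS2,
          (∀ x : Sph, ((σs.1 x : E3)) = s • (x : E3)) →
          (∀ x : Sph, ((g.1 x : E3)) = Q.mulVec ((f.1 (σs.1 x)) : E3)) →
          ∀ t : unitInterval, ∀ x : Sph,
            (((ρ (g, t)).1 x : E3)) = Q.mulVec (((ρ (f, t)).1 (σs.1 x)) : E3)) := by
  obtain ⟨ρ, c, h0, h1, hQ, hP, ha⟩ := rho_ex
  have ag : ∀ (g : HomNS2) (Q : O3), (∀ x : Sph, ((g.1 x : E3) : Fin 3 → ℝ) = Q.1.mulVec (x : E3)) → g = om Q := fun g Q h =>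
    HomNS2.ext' fun x => Subtype.ext (by
      apply (WithLp.ofLp_injective 2); exact h x)
  refine ⟨ρ, c, h0, fun f => ?_, fun Q hq g hg t => ?_, fun Q hq s hs f σs g h2 h3 t x => ?_⟩
  · obtain ⟨Q, e⟩ := h1 f
    refine ⟨Q.1, Q.2, fun x => ?_⟩
    rw [e]; rfl
  · rw [ag g ⟨Q, hq⟩ hg, hQ]
  · rcases hs with rfl | rfl
    · have e : ∀ x, σs.1 x = x := fun x => Subtype.ext (by rw [h2, one_smul])
      have eg : g = hc (om ⟨Q, hq⟩) f := HomNS2.ext' fun x => Subtype.ext (by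
        apply (WithLp.ofLp_injective 2)
        rw [h3, e]; rfl)
      rw [eg, hP, e]; rfl
    · have e : ∀ x, σs.1 x = mv an x := fun x => Subtype.ext (by rw [h2, an_v, neg_one_smul])
      have eg : g = hc (om ⟨Q, hq⟩) (hc f (om an)) := HomNS2.ext' fun x => Subtype.ext (by
        apply (WithLp.ofLp_injective 2)
        rw [h3, e]; rfl)
      rw [eg, hP, ha, e]; rfl
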